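/- Let u be a smooth solution of (−Δ)^{3/2}u = 2e^{3u} with finite volume and let p := u − v. Then p is a polynomial of degree 0 or of degree 2 (never of degree 1), Δp ≤ 0 everywhere (Δp being constant), and sup_{ℝ³} p < ∞. -/

import Mathlib

open MeasureTheory Real Filter

noncomputable section

abbrev E3 := EuclideanSpace ℝ (Fin 3)

/-- The Laplacian of `f : ℝ³ → ℝ` as the sum of second partial derivatives. -/
def lap (f : E3 → ℝ) (x : E3) : ℝ :=
  ∑ i, fderiv ℝ (fun y => fderiv ℝ f y (EuclideanSpace.single i 1)) x (EuclideanSpace.single i 1)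

/-- The half Laplacian `(-Δ)^{1/2} φ` of a Schwartz function on ℝ³, defined as a
principal value: `(1/π²) lim_{ε→0⁺} ∫_{|x−y|>ε} (φ(x)−φ(y))/|x−y|⁴ dy`. -/
def halfLap (φ : SchwartzMap E3 ℝ) (x : E3) : ℝ :=
  limUnder (nhdsWithin (0:ℝ) (Set.Ioi 0)) fun ε =>
    (1 / π ^ 2) * ∫ y in {y : E3 | ε < ‖x - y‖}, (φ x - φ y) / ‖x - y‖ ^ 4

/-- `w ∈ L_{1/2}(ℝ³)`. -/
def MemL12 (w : E3 → ℝ) : Prop :=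
  LocallyIntegrable w volume ∧ Integrable (fun x => |w x| / (1 + ‖x‖ ^ 4)) volume

/-- `u` is a smooth solution of `(-Δ)^{3/2} u = 2 e^{3u}` in ℝ³ with finite volume. -/
def IsSolution (u : E3 → ℝ) : Prop :=
  ContDiff ℝ (⊤ : ℕ∞) u ∧ MemL12 (lap u) ∧ Integrable (fun x => exp (3 * u x)) volume ∧
    ∀ φ : SchwartzMap E3 ℝ,
      ∫ x, (-(lap u x)) * halfLap φ x = 2 * ∫ x, exp (3 * u x) * φ x

/-- `u` is a spherical solution. -/
def IsSpherical (u : E3 → ℝ) : Prop :=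
  ∃ lam : ℝ, 0 < lam ∧ ∃ x₀ : E3, ∀ x, u x = log (2 * lam / (1 + lam ^ 2 * ‖x - x₀‖ ^ 2))

/-- `α = (1/π²) ∫ e^{3u}`. -/
def solAlpha (u : E3 → ℝ) : ℝ := (1 / π ^ 2) * ∫ y, exp (3 * u y)

/-- `v(x) = (1/π²) ∫ log(|y|/|x−y|) e^{3u(y)} dy`. -/
def solV (u : E3 → ℝ) (x : E3) : ℝ :=
  (1 / π ^ 2) * ∫ y, log (‖y‖ / ‖x - y‖) * exp (3 * u y)

end


/-! ### Gaussians as Schwartz functions -/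

theorem pow_mul_exp_neg_le (m : ℕ) {t : ℝ} (ht : 0 ≤ t) : t ^ m * exp (-t) ≤ m.factorial := by
  have h := Real.pow_div_factorial_le_exp t ht m
  rw [div_le_iff₀ (by positivity)] at h
  rw [Real.exp_neg, ← div_eq_mul_inv, div_le_iff₀ (exp_pos t)]
  linarith

theorem exists_pow_mul_gaussian_le {a : ℝ} (ha : 0 < a) (x₀ : E3) (m : ℕ) :
    ∃ C : ℝ, ∀ x : E3, (1 + ‖x‖) ^ m * exp (-(a * ‖x - x₀‖ ^ 2)) ≤ C := by
  refine ⟨(1 + ‖x₀‖) ^ m * (exp (2 * a) * (m.factorial / a ^ m)), fun x => ?_⟩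
  set r := ‖x - x₀‖ with hr
  have hr0 : 0 ≤ r := norm_nonneg _
  have h1 : 1 + ‖x‖ ≤ (1 + ‖x₀‖) * (2 + r ^ 2) := by
    have : ‖x‖ ≤ r + ‖x₀‖ := by
      have := norm_add_le (x - x₀) x₀
      simpa using this
    nlinarith [norm_nonneg x₀, sq_nonneg (r - 1), mul_nonneg (norm_nonneg x₀) (sq_nonneg r)]
  have h2 := pow_mul_exp_neg_le m (t := a * (2 + r ^ 2)) (by positivity)
  have h3 : (2 + r ^ 2) ^ m * exp (-(a * r ^ 2)) ≤ exp (2 * a) * (m.factorial / a ^ m) := by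
    have e : exp (-(a * r ^ 2)) = exp (2 * a) * exp (-(a * (2 + r ^ 2))) := by
      rw [← exp_add]; ring_nf
    rw [e, mul_left_comm]
    refine mul_le_mul_of_nonneg_left ?_ (exp_pos _).le
    rw [le_div_iff₀ (by positivity)]
    calc _ = (a * (2 + r ^ 2)) ^ m * exp (-(a * (2 + r ^ 2))) := by rw [mul_pow]; ring
      _ ≤ _ := h2
  calc (1 + ‖x‖) ^ m * exp (-(a * r ^ 2))
      ≤ ((1 + ‖x₀‖) * (2 + r ^ 2)) ^ m * exp (-(a * r ^ 2)) := by gcongr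
    _ = (1 + ‖x₀‖) ^ m * ((2 + r ^ 2) ^ m * exp (-(a * r ^ 2))) := by rw [mul_pow]; ring
    _ ≤ _ := by gcongr

theorem gaussian_schwartz_decay {a : ℝ} (ha : 0 < a) (x₀ : E3) (k n : ℕ) :
    ∃ C : ℝ, ∀ x : E3, ‖x‖ ^ k *
      ‖iteratedFDeriv ℝ n (fun x : E3 => exp (-(a * ‖x - x₀‖ ^ 2))) x‖ ≤ C := by
  have hf : Function.HasTemperateGrowth (fun x : E3 => -(a * ‖x - x₀‖ ^ 2)) := by
    have e : (fun x : E3 => -(a * ‖x - x₀‖ ^ 2)) =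
        -(fun x : E3 => a * (‖x‖ ^ 2 - 2 * inner ℝ x x₀ + ‖x₀‖ ^ 2)) := by
      ext x; simp only [Pi.neg_apply]; rw [norm_sub_sq_real]
    rw [e]
    refine Function.HasTemperateGrowth.neg ?_
    refine (Function.HasTemperateGrowth.const a).mul ?_
    refine Function.HasTemperateGrowth.add (Function.HasTemperateGrowth.sub ?_ ?_)
      (Function.HasTemperateGrowth.const _)
    · exact Function.hasTemperateGrowth_norm_sq E3
    · exact (Function.HasTemperateGrowth.const 2).mul (Function.hasTemperateGrowth_inner_left x₀)
  obtain ⟨l, K, hK0, hK⟩ := hf.norm_iteratedFDeriv_le_uniform n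
  obtain ⟨C, hC⟩ := exists_pow_mul_gaussian_le ha x₀ (k + l * n)
  refine ⟨n.factorial * (1 + K) ^ n * C, fun x => ?_⟩
  have hD1 : 1 ≤ (1 + K) * (1 + ‖x‖) ^ l := by
    have : 1 ≤ (1 + ‖x‖) ^ l := one_le_pow₀ (by linarith [norm_nonneg x])
    nlinarith
  have := norm_iteratedFDeriv_comp_le (𝕜 := ℝ) (g := Real.exp) (N := (⊤ : ℕ∞)) (n := n)
    (f := fun x : E3 => -(a * ‖x - x₀‖ ^ 2)) Real.contDiff_exp hf.1 (by exact_mod_cast le_top) x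
    (C := exp (-(a * ‖x - x₀‖ ^ 2))) (D := (1 + K) * (1 + ‖x‖) ^ l)
    (fun i _ => by
      rw [norm_iteratedFDeriv_eq_norm_iteratedDeriv, iteratedDeriv_eq_iterate, iter_deriv_exp]
      simp)
    (fun i hi hin => by
      refine (hK i hin x).trans ?_
      refine le_trans ?_ (le_self_pow₀ hD1 (by omega))
      gcongr; linarith)
  calc ‖x‖ ^ k * ‖iteratedFDeriv ℝ n (fun x : E3 => exp (-(a * ‖x - x₀‖ ^ 2))) x‖
      ≤ (1 + ‖x‖) ^ k * (n.factorial * exp (-(a * ‖x - x₀‖ ^ 2)) *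
          ((1 + K) * (1 + ‖x‖) ^ l) ^ n) := by
        gcongr
        · linarith
        · exact this
    _ = n.factorial * (1 + K) ^ n *
          ((1 + ‖x‖) ^ (k + l * n) * exp (-(a * ‖x - x₀‖ ^ 2))) := by
        rw [mul_pow, pow_add, pow_mul]; ring
    _ ≤ _ := by gcongr; exact hC x

/-- The Gaussian `x ↦ exp (-a |x - x₀|²)` as a Schwartz function. -/
noncomputable def gaussianSchwartz {a : ℝ} (ha : 0 < a) (x₀ : E3) : SchwartzMap E3 ℝ where
  toFun x := exp (-(a * ‖x - x₀‖ ^ 2))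
  smooth' := (((contDiff_id.sub contDiff_const).norm_sq ℝ).const_smul a).neg.exp
  decay' := gaussian_schwartz_decay ha x₀

theorem gaussianSchwartz_apply {a : ℝ} (ha : 0 < a) (x₀ x : E3) :
    gaussianSchwartz ha x₀ x = exp (-(a * ‖x - x₀‖ ^ 2)) := rfl

/-! ### The heat profile and its derivatives -/

/-- The heat profile `s^{-3/2} exp (-ρ / s)`. -/
noncomputable def heat (s ρ : ℝ) : ℝ := (s * √s)⁻¹ * exp (-(ρ / s))

/-- The derivative of `heat` in its first variable. -/
noncomputable def heatDeriv (s ρ : ℝ) : ℝ := (ρ / s ^ 2 - 3 / (2 * s)) * heat s ρ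

/-- The second derivative of `heat` in its first variable. -/
noncomputable def heatDeriv2 (s ρ : ℝ) : ℝ :=
  ((ρ / s ^ 2 - 3 / (2 * s)) ^ 2 + (3 / (2 * s ^ 2) - 2 * ρ / s ^ 3)) * heat s ρ

theorem heat_nonneg {s : ℝ} (hs : 0 < s) (ρ : ℝ) : 0 ≤ heat s ρ := by
  unfold heat; positivity

theorem hasDerivAt_heat {s : ℝ} (hs : 0 < s) (ρ : ℝ) :
    HasDerivAt (fun s => heat s ρ) (heatDeriv s ρ) s := by
  have h1 : HasDerivAt (fun s : ℝ => s * √s) (1 * √s + s * (1 / (2 * √s))) s :=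
    (hasDerivAt_id s).mul (Real.hasDerivAt_sqrt hs.ne')
  have h2 : HasDerivAt (fun s : ℝ => exp (-(ρ / s))) (exp (-(ρ / s)) * (-(ρ * -(s ^ 2)⁻¹))) s := by
    have := ((hasDerivAt_inv hs.ne').const_mul ρ).neg.exp
    simp only [div_eq_mul_inv]
    exact this
  have hq : 0 < √s := Real.sqrt_pos.2 hs
  have hss : √s ^ 2 = s := Real.sq_sqrt hs.le
  have h3 := (h1.inv (by positivity)).mul h2
  refine h3.congr_deriv ?_
  unfold heatDeriv heat
  have : (1 * √s + s * (1 / (2 * √s))) = 3 / 2 * √s := by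
    field_simp; rw [hss]; ring
  rw [this]
  field_simp
  simp only [Pi.inv_apply]
  field_simp
  ring

theorem hasDerivAt_heatDeriv {s : ℝ} (hs : 0 < s) (ρ : ℝ) :
    HasDerivAt (fun s => heatDeriv s ρ) (heatDeriv2 s ρ) s := by
  have h1 : HasDerivAt (fun s : ℝ => ρ / s ^ 2 - 3 / (2 * s))
      (3 / (2 * s ^ 2) - 2 * ρ / s ^ 3) s := by
    have a := ((hasDerivAt_pow 2 s).inv (by positivity)).const_mul ρ
    have b := ((hasDerivAt_id s).const_mul 2).inv (by simpa using hs.ne') |>.const_mul 3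
    have := a.sub b
    refine (this.congr_deriv ?_).congr_of_eventuallyEq ?_
    · simp; field_simp; ring
    · exact Eventually.of_forall fun y => by simp [div_eq_mul_inv]
  refine (h1.mul (hasDerivAt_heat hs ρ)).congr_deriv ?_
  unfold heatDeriv2 heatDeriv
  ring

theorem measurable_heat : Measurable (fun p : ℝ × ℝ => heat p.1 p.2) := by
  unfold heat; fun_prop

theorem measurable_heatDeriv : Measurable (fun p : ℝ × ℝ => heatDeriv p.1 p.2) := by
  unfold heatDeriv heat; fun_prop

theorem heat_le {s : ℝ} (hs : 0 < s) {ρ : ℝ} (hρ : 0 ≤ ρ) : heat s ρ ≤ (s * √s)⁻¹ := by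
  unfold heat
  refine mul_le_of_le_one_right (by positivity) ?_
  rw [Real.exp_le_one_iff]; simp; positivity

theorem abs_heatDeriv_le {s : ℝ} (hs : 0 < s) {ρ : ℝ} (hρ : 0 ≤ ρ) :
    |heatDeriv s ρ| ≤ 20 * (√s)⁻¹ * ((s + ρ) ^ 2)⁻¹ := by
  obtain ⟨t, rfl⟩ : ∃ t, ρ = s * t := ⟨ρ / s, by field_simp⟩
  have ht : 0 ≤ t := by
    by_contra h; push Not at h; nlinarith
  have hq : 0 < √s := Real.sqrt_pos.2 hs
  have e1 := pow_mul_exp_neg_le 0 ht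
  have e2 := pow_mul_exp_neg_le 1 ht
  have e3 := pow_mul_exp_neg_le 2 ht
  have e4 := pow_mul_exp_neg_le 3 ht
  simp [Nat.factorial] at e1 e2 e3 e4
  have key : |t - 3 / 2| * exp (-t) * (1 + t) ^ 2 ≤ 20 := by
    have h1 : |t - 3 / 2| ≤ t + 3 / 2 := by rw [abs_le]; constructor <;> linarith
    calc |t - 3 / 2| * exp (-t) * (1 + t) ^ 2 ≤ (t + 3 / 2) * exp (-t) * (1 + t) ^ 2 := by gcongr
      _ = t ^ 3 * exp (-t) + 7 / 2 * (t ^ 2 * exp (-t)) + 4 * (t * exp (-t)) +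
          3 / 2 * exp (-t) := by ring
      _ ≤ 20 := by
        have : exp (-t) ≤ 1 := by simpa using ht
        linarith
  have : heatDeriv s (s * t) = (s ^ 2 * √s)⁻¹ * ((t - 3 / 2) * exp (-t)) := by
    unfold heatDeriv heat
    rw [mul_div_cancel_left₀ _ hs.ne']
    field_simp
  rw [this, abs_mul, abs_mul, abs_of_pos (exp_pos _), abs_of_pos (by positivity)]
  rw [show s + s * t = s * (1 + t) by ring, mul_pow]
  have : |t - 3 / 2| * exp (-t) ≤ 20 * ((1 + t) ^ 2)⁻¹ := by
    rw [← div_eq_mul_inv, le_div_iff₀ (by positivity)]; exact key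
  calc (s ^ 2 * √s)⁻¹ * (|t - 3 / 2| * exp (-t)) ≤ (s ^ 2 * √s)⁻¹ * (20 * ((1 + t) ^ 2)⁻¹) := by
        gcongr
    _ = _ := by field_simp

theorem abs_heatDeriv2_le {s : ℝ} (hs : 0 < s) {ρ : ℝ} (hρ : 0 ≤ ρ) :
    |heatDeriv2 s ρ| ≤ 300 * (s * √s)⁻¹ * ((s + ρ) ^ 2)⁻¹ := by
  obtain ⟨t, rfl⟩ : ∃ t, ρ = s * t := ⟨ρ / s, by field_simp⟩
  have ht : 0 ≤ t := by
    by_contra h; push Not at h; nlinarith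
  have hq : 0 < √s := Real.sqrt_pos.2 hs
  have e2 := pow_mul_exp_neg_le 1 ht
  have e3 := pow_mul_exp_neg_le 2 ht
  have e4 := pow_mul_exp_neg_le 3 ht
  have e5 := pow_mul_exp_neg_le 4 ht
  simp [Nat.factorial] at e2 e3 e4 e5
  have key : |t ^ 2 - 5 * t + 15 / 4| * exp (-t) * (1 + t) ^ 2 ≤ 300 := by
    have h1 : |t ^ 2 - 5 * t + 15 / 4| ≤ t ^ 2 + 5 * t + 15 / 4 := by
      rw [abs_le]; constructor <;> nlinarith
    calc _ ≤ (t ^ 2 + 5 * t + 15 / 4) * exp (-t) * (1 + t) ^ 2 := by gcongr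
      _ = t ^ 4 * exp (-t) + 7 * (t ^ 3 * exp (-t)) + 59 / 4 * (t ^ 2 * exp (-t)) +
          50 / 4 * (t * exp (-t)) + 15 / 4 * exp (-t) := by ring
      _ ≤ 300 := by
        have : exp (-t) ≤ 1 := by simpa using ht
        linarith
  have : heatDeriv2 s (s * t) = (s ^ 3 * √s)⁻¹ * ((t ^ 2 - 5 * t + 15 / 4) * exp (-t)) := by
    unfold heatDeriv2 heat
    rw [mul_div_cancel_left₀ _ hs.ne']
    field_simp
    ring
  rw [this, abs_mul, abs_mul, abs_of_pos (exp_pos _), abs_of_pos (by positivity)]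
  rw [show s + s * t = s * (1 + t) by ring, mul_pow]
  have : |t ^ 2 - 5 * t + 15 / 4| * exp (-t) ≤ 300 * ((1 + t) ^ 2)⁻¹ := by
    rw [← div_eq_mul_inv, le_div_iff₀ (by positivity)]; exact key
  calc (s ^ 3 * √s)⁻¹ * (|t ^ 2 - 5 * t + 15 / 4| * exp (-t))
      ≤ (s ^ 3 * √s)⁻¹ * (300 * ((1 + t) ^ 2)⁻¹) := by gcongr
    _ = _ := by field_simp

/-! ### The principal value as a symmetrised integral -/

theorem integrable_inv_sq_mul_one_add_sq :
    Integrable (fun z : E3 => (‖z‖ ^ 2 * (1 + ‖z‖ ^ 2))⁻¹) := by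
  have := (integrable_fun_norm_addHaar (volume : Measure E3)
    (f := fun r : ℝ => (r ^ 2 * (1 + r ^ 2))⁻¹)).2 ?_
  · exact this
  · have h : IntegrableOn (fun r : ℝ => (1 + r ^ 2)⁻¹) (Set.Ioi 0) :=
      integrable_inv_one_add_sq.integrableOn
    refine h.congr_fun (fun r hr => ?_) measurableSet_Ioi
    have hr : 0 < r := hr
    simp
    field_simp

theorem ae_ne_point (a : E3) : ∀ᵐ x : E3, x ≠ a := by
  simp [ae_iff, measure_singleton]

theorem integrable_inv_one_add_norm_sq_sq :
    Integrable (fun z : E3 => ((1 + ‖z‖ ^ 2) ^ 2)⁻¹) := by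
  have := integrable_rpow_neg_one_add_norm_sq (E := E3) (μ := volume) (r := 4) (by simp; norm_num)
  refine this.congr (Eventually.of_forall fun x => ?_)
  simp only
  rw [show (-4 / 2 : ℝ) = -(2 : ℕ) by norm_num, Real.rpow_neg (by positivity), Real.rpow_natCast]

theorem integrableOn_pv {φ : E3 → ℝ} (hφ : Continuous φ) (hb : ∀ x, |φ x| ≤ 1) (x : E3)
    {ε : ℝ} (hε : 0 < ε) :
    IntegrableOn (fun y => (φ x - φ y) / ‖x - y‖ ^ 4) {y : E3 | ε < ‖x - y‖} := by
  have hm : MeasurableSet {y : E3 | ε < ‖x - y‖} :=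
    (isOpen_lt continuous_const (by fun_prop)).measurableSet
  have h1 : Integrable (fun y : E3 => 2 * (1 + (ε ^ 2)⁻¹) ^ 2 * ((1 + ‖x - y‖ ^ 2) ^ 2)⁻¹) :=
    (integrable_inv_one_add_norm_sq_sq.comp_sub_left x).const_mul _
  refine Integrable.mono' h1.integrableOn ?_ ?_
  · exact ((continuous_const.sub hφ).measurable.div
      (by fun_prop : Measurable fun y : E3 => ‖x - y‖ ^ 4)).aestronglyMeasurable
  · refine (ae_restrict_iff' hm).2 (Eventually.of_forall fun y hy => ?_)
    have hy : ε < ‖x - y‖ := hy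
    set r := ‖x - y‖
    have hr : 0 < r := hε.trans hy
    have h2 : |φ x - φ y| ≤ 2 := by
      have a := hb x; have b := hb y
      rw [abs_le] at *; constructor <;> linarith [a.1, a.2, b.1, b.2]
    rw [Real.norm_eq_abs, abs_div, abs_of_pos (by positivity : 0 < r ^ 4)]
    have h3 : 1 + r ^ 2 ≤ (1 + (ε ^ 2)⁻¹) * r ^ 2 := by
      have : 1 ≤ (ε ^ 2)⁻¹ * r ^ 2 := by
        rw [inv_mul_eq_div, one_le_div (by positivity)]; gcongr
      linarith
    have h4 : (1 + r ^ 2) ^ 2 ≤ (1 + (ε ^ 2)⁻¹) ^ 2 * r ^ 4 := by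
      calc _ ≤ ((1 + (ε ^ 2)⁻¹) * r ^ 2) ^ 2 := by gcongr
        _ = _ := by ring
    calc |φ x - φ y| / r ^ 4 ≤ 2 / r ^ 4 := by gcongr
      _ ≤ _ := by
        rw [← div_eq_mul_inv, div_le_div_iff₀ (by positivity) (by positivity)]
        linarith

theorem integrable_second_difference {φ : E3 → ℝ} (hφ : Continuous φ) (x : E3)
    {C : ℝ} (hC : ∀ z, |2 * φ x - φ (x + z) - φ (x - z)| ≤ C * (‖z‖ ^ 2 / (1 + ‖z‖ ^ 2))) :
    Integrable (fun z : E3 => (2 * φ x - φ (x + z) - φ (x - z)) / ‖z‖ ^ 4) := by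
  refine Integrable.mono' (integrable_inv_sq_mul_one_add_sq.const_mul C) ?_ ?_
  · exact (Measurable.div (by fun_prop) (by fun_prop)).aestronglyMeasurable
  · filter_upwards [ae_ne_point 0] with z hz
    have hz : 0 < ‖z‖ := norm_pos_iff.2 hz
    rw [Real.norm_eq_abs, abs_div, abs_of_pos (by positivity : 0 < ‖z‖ ^ 4),
      div_le_iff₀ (by positivity)]
    refine (hC z).trans (le_of_eq ?_)
    field_simp

theorem tendsto_pv {φ : E3 → ℝ} (hφ : Continuous φ) (hb : ∀ x, |φ x| ≤ 1) (x : E3)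
    {C : ℝ} (hC : ∀ z, |2 * φ x - φ (x + z) - φ (x - z)| ≤ C * (‖z‖ ^ 2 / (1 + ‖z‖ ^ 2))) :
    Tendsto (fun ε : ℝ => ∫ y in {y : E3 | ε < ‖x - y‖}, (φ x - φ y) / ‖x - y‖ ^ 4)
      (nhdsWithin 0 (Set.Ioi 0))
      (nhds (1 / 2 * ∫ z : E3, (2 * φ x - φ (x + z) - φ (x - z)) / ‖z‖ ^ 4)) := by
  have hint := integrable_second_difference hφ x hC
  have hm : ∀ ε : ℝ, MeasurableSet {y : E3 | ε < ‖x - y‖} := fun ε =>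
    (isOpen_lt continuous_const (by fun_prop)).measurableSet
  have hm' : ∀ ε : ℝ, MeasurableSet {z : E3 | ε < ‖z‖} := fun ε =>
    (isOpen_lt continuous_const (by fun_prop)).measurableSet
  have key : ∀ ε : ℝ, 0 < ε → ∫ y in {y : E3 | ε < ‖x - y‖}, (φ x - φ y) / ‖x - y‖ ^ 4 =
      1 / 2 * ∫ z, Set.indicator {z : E3 | ε < ‖z‖}
        (fun z => (2 * φ x - φ (x + z) - φ (x - z)) / ‖z‖ ^ 4) z := by
    intro ε hε
    have hi := (integrable_indicator_iff (hm ε)).2 (integrableOn_pv hφ hb x hε)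
    rw [← integral_indicator (hm ε)]
    set G := Set.indicator {y : E3 | ε < ‖x - y‖} (fun y => (φ x - φ y) / ‖x - y‖ ^ 4) with hG
    have e1 : ∫ z, G (x + z) = ∫ y, G y := integral_add_left_eq_self G x
    have e2 : ∫ z, G (x - z) = ∫ y, G y := integral_sub_left_eq_self G volume x
    have e3 : ∫ z, (G (x + z) + G (x - z)) = 2 * ∫ y, G y := by
      rw [integral_add (hi.comp_add_left x) (hi.comp_sub_left x), e1, e2]; ring
    have e4 : ∫ y, G y = 1 / 2 * ∫ z, (G (x + z) + G (x - z)) := by rw [e3]; ring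
    rw [e4]
    congr 1
    refine integral_congr_ae (Eventually.of_forall fun z => ?_)
    have a1 : ‖x - (x + z)‖ = ‖z‖ := by simp
    have a2 : ‖x - (x - z)‖ = ‖z‖ := by simp
    simp only [hG, Set.indicator, Set.mem_ofPred_eq, a1, a2]
    split_ifs
    · ring
    · simp
  have h2 : Tendsto (fun ε : ℝ => 1 / 2 * ∫ z, Set.indicator {z : E3 | ε < ‖z‖}
        (fun z => (2 * φ x - φ (x + z) - φ (x - z)) / ‖z‖ ^ 4) z) (nhdsWithin 0 (Set.Ioi 0))
      (nhds (1 / 2 * ∫ z : E3, (2 * φ x - φ (x + z) - φ (x - z)) / ‖z‖ ^ 4)) := by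
    refine Tendsto.const_mul _ ?_
    refine tendsto_integral_filter_of_dominated_convergence
      (fun z => ‖(2 * φ x - φ (x + z) - φ (x - z)) / ‖z‖ ^ 4‖) ?_ ?_ hint.norm ?_
    · exact Eventually.of_forall fun ε => hint.aestronglyMeasurable.indicator (hm' ε)
    · exact Eventually.of_forall fun ε => Eventually.of_forall fun z =>
        norm_indicator_le_norm_self _ _
    · filter_upwards [ae_ne_point 0] with z hz
      have hz : 0 < ‖z‖ := norm_pos_iff.2 hz
      refine tendsto_const_nhds.congr' ?_
      have : ∀ᶠ ε : ℝ in nhdsWithin 0 (Set.Ioi 0), ε < ‖z‖ :=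
        nhdsWithin_le_nhds (gt_mem_nhds hz)
      filter_upwards [this] with ε hε
      rw [Set.indicator_of_mem]
      exact hε
  refine h2.congr' ?_
  filter_upwards [self_mem_nhdsWithin] with ε hε
  exact (key ε hε).symm

/-! ### The half-Laplacian of a Gaussian -/

theorem abs_second_difference_gaussian_le {a : ℝ} (ha : 0 < a) (w z : E3) :
    |2 * exp (-(a * ‖w‖ ^ 2)) - exp (-(a * ‖w + z‖ ^ 2)) - exp (-(a * ‖w - z‖ ^ 2))| ≤
      (4 * (a + 2 * a ^ 2 * ‖w‖ ^ 2 * exp (2 * a ^ 2 * ‖w‖ ^ 2)) + 4) *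
        (‖z‖ ^ 2 / (1 + ‖z‖ ^ 2)) := by
  set q := ‖z‖ ^ 2 with hq
  have hq0 : 0 ≤ q := by positivity
  set K := 2 * a ^ 2 * ‖w‖ ^ 2 with hK
  have hK0 : 0 ≤ K := by positivity
  have hA0 : 0 ≤ a + K * exp K := by positivity
  rw [mul_div_assoc', le_div_iff₀ (by positivity)]
  rcases le_or_gt q 1 with h1 | h1
  · set b := 2 * a * inner ℝ w z with hb
    have e1 : exp (-(a * ‖w + z‖ ^ 2)) = exp (-(a * ‖w‖ ^ 2)) * (exp (-(a * q)) * exp (-b)) := by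
      rw [norm_add_sq_real, ← exp_add, ← exp_add]; congr 1; simp only [hb, hq]; ring
    have e2 : exp (-(a * ‖w - z‖ ^ 2)) = exp (-(a * ‖w‖ ^ 2)) * (exp (-(a * q)) * exp b) := by
      rw [norm_sub_sq_real, ← exp_add, ← exp_add]; congr 1; simp only [hb, hq]; ring
    have e3 : 2 * exp (-(a * ‖w‖ ^ 2)) - exp (-(a * ‖w + z‖ ^ 2)) - exp (-(a * ‖w - z‖ ^ 2)) =
        2 * exp (-(a * ‖w‖ ^ 2)) * (1 - exp (-(a * q)) * cosh b) := by
      rw [e1, e2, cosh_eq]; ring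
    have hb2 : b ^ 2 / 2 ≤ K * q := by
      have := real_inner_mul_inner_self_le w z
      rw [real_inner_self_eq_norm_sq, real_inner_self_eq_norm_sq] at this
      simp only [hb, hK, hq]
      nlinarith [mul_le_mul_of_nonneg_left this (by positivity : 0 ≤ 2 * a ^ 2)]
    have c1 : cosh b ≤ 1 + K * q * exp K := by
      have h2 := cosh_le_exp_half_sq b
      have h3 : exp (b ^ 2 / 2) ≤ exp (K * q) := exp_le_exp.2 hb2
      have h4 : exp (K * q) ≤ 1 + K * q * exp (K * q) := by
        have := add_one_le_exp (-(K * q))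
        have h5 : exp (-(K * q)) * exp (K * q) = 1 := by rw [← exp_add]; simp
        nlinarith [exp_pos (K * q)]
      have h6 : exp (K * q) ≤ exp K := exp_le_exp.2 (by nlinarith)
      have : K * q * exp (K * q) ≤ K * q * exp K := by gcongr
      linarith
    have c0 : 1 ≤ cosh b := one_le_cosh b
    have d1 : exp (-(a * q)) ≤ 1 := exp_le_one_iff.2 (by nlinarith)
    have d2 : 1 - a * q ≤ exp (-(a * q)) := by linarith [add_one_le_exp (-(a * q))]
    have d0 := exp_pos (-(a * q))
    have f1 : |1 - exp (-(a * q)) * cosh b| ≤ (a + K * exp K) * q := by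
      have p1 : 0 ≤ K * q * exp K := by positivity
      have p2 : 0 ≤ a * q := by positivity
      rw [abs_le]; constructor <;> nlinarith
    have g1 : exp (-(a * ‖w‖ ^ 2)) ≤ 1 := exp_le_one_iff.2 (by simp; positivity)
    rw [e3, abs_mul, abs_of_pos (by positivity)]
    have g2 : 2 * exp (-(a * ‖w‖ ^ 2)) * |1 - exp (-(a * q)) * cosh b| ≤
        2 * ((a + K * exp K) * q) := by
      calc _ ≤ 2 * 1 * ((a + K * exp K) * q) := by gcongr
        _ = _ := by ring
    have g3 : 0 ≤ (a + K * exp K) * q := by positivity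
    nlinarith
  · have g : ∀ y : E3, 0 ≤ exp (-(a * ‖y‖ ^ 2)) ∧ exp (-(a * ‖y‖ ^ 2)) ≤ 1 := fun y =>
      ⟨by positivity, exp_le_one_iff.2 (by simp; positivity)⟩
    have h2 : |2 * exp (-(a * ‖w‖ ^ 2)) - exp (-(a * ‖w + z‖ ^ 2)) - exp (-(a * ‖w - z‖ ^ 2))|
        ≤ 2 := by
      have h1 := g w; have h2 := g (w + z); have h3 := g (w - z)
      rw [abs_le]; constructor <;> linarith [h1.1, h1.2, h2.1, h2.2, h3.1, h3.2]
    have : 0 ≤ (a + K * exp K) * q := by positivity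
    nlinarith

theorem integral_heat_add_mul_gaussian {s t : ℝ} (hs : 0 < s) (ht : 0 < t) (w : E3) :
    ∫ z : E3, heat s (‖w + z‖ ^ 2) * exp (-(‖z‖ ^ 2 / t)) =
      π * √π * (t * √t) * heat (s + t) (‖w‖ ^ 2) := by
  have hst : 0 < s + t := by positivity
  have h1 : ∀ z : E3, heat s (‖w + z‖ ^ 2) * exp (-(‖z‖ ^ 2 / t)) =
      (s * √s)⁻¹ * exp (-(‖w‖ ^ 2 / (s + t))) *
        exp (-((s + t) / (s * t)) * ‖z + (t / (s + t)) • w‖ ^ 2) := by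
    intro z
    rw [heat, mul_assoc, mul_assoc, ← exp_add, ← exp_add, norm_add_sq_real, norm_add_sq_real,
      norm_smul, inner_smul_right, real_inner_comm z w, mul_pow, Real.norm_eq_abs, sq_abs]
    congr 2
    field_simp
    ring
  simp_rw [h1]
  rw [integral_const_mul, integral_add_right_eq_self
    (fun z : E3 => exp (-((s + t) / (s * t)) * ‖z‖ ^ 2)),
    GaussianFourier.integral_rexp_neg_mul_sq_norm (by positivity), heat]
  have h2 : ∀ r : ℝ, 0 < r → r ^ (Module.finrank ℝ E3 / 2 : ℝ) = r * √r := by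
    intro r hr
    rw [show (Module.finrank ℝ E3 / 2 : ℝ) = 1 + 1 / 2 by simp; norm_num, rpow_add hr, rpow_one,
      sqrt_eq_rpow]
  rw [h2 _ (by positivity), div_div_eq_mul_div, sqrt_div (by positivity), sqrt_mul (by positivity),
    sqrt_mul hs.le]
  have := sqrt_pos.2 hs
  have := sqrt_pos.2 hst
  field_simp

theorem integrable_heat_add_mul_gaussian {s t : ℝ} (hs : 0 < s) (ht : 0 < t) (w : E3) :
    Integrable fun z : E3 => heat s (‖w + z‖ ^ 2) * exp (-(‖z‖ ^ 2 / t)) := by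
  refine Integrable.of_integral_ne_zero ?_
  rw [integral_heat_add_mul_gaussian hs ht, heat]
  positivity

theorem integral_inv_pow_five_mul_exp {q : ℝ} (hq : 0 < q) :
    IntegrableOn (fun y : ℝ => 2 * (y ^ 5)⁻¹ * exp (-(q / y ^ 2))) (Set.Ioi 0) ∧
    ∫ y in Set.Ioi (0:ℝ), 2 * (y ^ 5)⁻¹ * exp (-(q / y ^ 2)) = (q ^ 2)⁻¹ := by
  set G : ℝ → ℝ := fun y => exp (-(q / y ^ 2)) * ((q * y ^ 2)⁻¹ + (q ^ 2)⁻¹) with hG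
  have hd : ∀ y ∈ Set.Ioi (0:ℝ),
      HasDerivAt (Function.update G 0 0) (2 * (y ^ 5)⁻¹ * exp (-(q / y ^ 2))) y := by
    intro y hy
    have hy : 0 < y := hy
    have h2 : HasDerivAt (fun y : ℝ => y ^ 2) (2 * y) y := by simpa using hasDerivAt_pow 2 y
    have h3 := ((h2.inv (by positivity)).const_mul q).neg.exp
    have h4 := ((h2.inv (by positivity)).const_mul q⁻¹).add_const (q ^ 2)⁻¹
    have h5 : HasDerivAt G (2 * (y ^ 5)⁻¹ * exp (-(q / y ^ 2))) y := by
      have h6 := (h3.mul h4).congr_of_eventuallyEq (f₁ := G) (Eventually.of_forall fun x => by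
        simp only [hG, Pi.mul_apply, Pi.inv_apply, Pi.neg_apply, div_eq_mul_inv, mul_inv])
      refine h6.congr_deriv ?_
      simp only [Pi.inv_apply, Pi.neg_apply, div_eq_mul_inv]
      field_simp
      ring
    refine h5.congr_of_eventuallyEq ?_
    filter_upwards [eventually_ne_nhds hy.ne'] with x hx
    exact Function.update_of_ne hx _ _
  have hc : ContinuousWithinAt (Function.update G 0 0) (Set.Ici 0) 0 := by
    rw [continuousWithinAt_update_same, Set.Ici_sdiff_left]
    have hb : Tendsto (fun y : ℝ => 3 * y ^ 2 * (q ^ 3)⁻¹) (nhdsWithin 0 (Set.Ioi 0))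
        (nhds 0) := by
      have : Continuous fun y : ℝ => 3 * y ^ 2 * (q ^ 3)⁻¹ := by fun_prop
      have := this.tendsto 0
      simp only [ne_eq, OfNat.ofNat_ne_zero, not_false_eq_true, zero_pow, mul_zero, zero_mul]
        at this
      exact this.mono_left nhdsWithin_le_nhds
    refine squeeze_zero' ?_ ?_ hb
    · exact Eventually.of_forall fun y => by positivity
    · filter_upwards [self_mem_nhdsWithin] with y hy
      have hy : 0 < y := hy
      have ht : 0 < q / y ^ 2 := by positivity
      have h1 := pow_mul_exp_neg_le 1 ht.le
      have h2 := pow_mul_exp_neg_le 2 ht.le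
      simp only [pow_one, Nat.factorial] at h1 h2
      norm_num at h1 h2
      have h3 : G y = (y ^ 2 * (q ^ 3)⁻¹) * ((q / y ^ 2) * ((q / y ^ 2 + 1)
          * exp (-(q / y ^ 2)))) := by
        simp only [hG]; field_simp
      rw [h3]
      calc _ ≤ (y ^ 2 * (q ^ 3)⁻¹) * 3 := by gcongr; nlinarith
        _ = _ := by ring
  have hl : Tendsto (Function.update G 0 0) atTop (nhds (q ^ 2)⁻¹) := by
    have hi : Tendsto (fun y : ℝ => (y ^ 2)⁻¹) atTop (nhds 0) :=
      tendsto_inv_atTop_zero.comp (tendsto_pow_atTop two_ne_zero)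
    have h1 : Tendsto G atTop (nhds (exp (-(q * 0)) * (q⁻¹ * 0 + (q ^ 2)⁻¹))) := by
      have := ((continuous_exp.tendsto _).comp (hi.const_mul q).neg).mul
        ((hi.const_mul q⁻¹).add_const (q ^ 2)⁻¹)
      refine this.congr fun y => ?_
      simp only [hG, Function.comp, div_eq_mul_inv, mul_inv]
    simp only [mul_zero, neg_zero, exp_zero, zero_add, one_mul] at h1
    refine h1.congr' ?_
    filter_upwards [eventually_gt_atTop 0] with y hy
    exact (Function.update_of_ne hy.ne' _ _).symm
  have hp : ∀ y ∈ Set.Ioi (0:ℝ), 0 ≤ 2 * (y ^ 5)⁻¹ * exp (-(q / y ^ 2)) := by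
    intro y hy
    have hy : 0 < y := hy
    positivity
  refine ⟨integrableOn_Ioi_deriv_of_nonneg hc hd hp hl, ?_⟩
  rw [integral_Ioi_of_hasDerivAt_of_nonneg hc hd hp hl]
  simp

theorem min_one_mul_le {s q : ℝ} (hq : 0 ≤ q) : min s 1 * (1 + q) ≤ s + q := by
  nlinarith [min_le_left s 1, min_le_right s 1]

theorem abs_heatDeriv_add_le {s q ρ : ℝ} (hs : 0 < s) (hq : 0 ≤ q) (hρ : 0 ≤ ρ) :
    |heatDeriv (s + q) ρ| ≤ 20 * (√s)⁻¹ * (min s 1 ^ 2)⁻¹ * (1 + q)⁻¹ := by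
  have hm : 0 < min s 1 := lt_min hs one_pos
  refine (abs_heatDeriv_le (by positivity : 0 < s + q) hρ).trans ?_
  rw [mul_assoc (20 * (√s)⁻¹), ← mul_inv]
  gcongr
  · linarith
  · have h1 := min_one_mul_le (s := s) hq
    calc min s 1 ^ 2 * (1 + q) ≤ min s 1 ^ 2 * (1 + q) ^ 2 := by
          gcongr; nlinarith
      _ = (min s 1 * (1 + q)) ^ 2 := by ring
      _ ≤ _ := by gcongr; linarith

theorem integrable_heatDeriv_add_sq {s ρ : ℝ} (hs : 0 < s) (hρ : 0 ≤ ρ) :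
    Integrable fun y : ℝ => heatDeriv (s + y ^ 2) ρ := by
  refine Integrable.mono' (integrable_inv_one_add_sq.const_mul
    (20 * (√s)⁻¹ * (min s 1 ^ 2)⁻¹)) ?_ ?_
  · have : Measurable fun y : ℝ => heatDeriv (s + y ^ 2) ρ :=
      measurable_heatDeriv.comp (f := fun y : ℝ => (s + y ^ 2, ρ)) (by fun_prop)
    exact this.aestronglyMeasurable
  · exact Eventually.of_forall fun y => abs_heatDeriv_add_le hs (sq_nonneg y) hρ

theorem heat_eq_const_mul_gaussian (s : ℝ) (x : E3) :
    heat s (‖x‖ ^ 2) = (s * √s)⁻¹ * exp (-(s⁻¹ * ‖x‖ ^ 2)) := by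
  rw [heat, div_eq_inv_mul]

theorem integral_second_difference_heat {s : ℝ} (hs : 0 < s) (w : E3) :
    ∫ z : E3, (2 * heat s (‖w‖ ^ 2) - heat s (‖w + z‖ ^ 2) - heat s (‖w - z‖ ^ 2)) / ‖z‖ ^ 4 =
      -(4 * (π * √π)) * ∫ y : ℝ, heatDeriv (s + y ^ 2) (‖w‖ ^ 2) := by
  set D : E3 → ℝ := fun z => 2 * heat s (‖w‖ ^ 2) - heat s (‖w + z‖ ^ 2) - heat s (‖w - z‖ ^ 2)
    with hD
  have hDm : Measurable D := by
    simp only [hD, heat]; fun_prop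
  have hDi : Integrable fun z => D z / ‖z‖ ^ 4 := by
    have h := integrable_second_difference (φ := fun x : E3 => exp (-(s⁻¹ * ‖x‖ ^ 2)))
      (by fun_prop) w (abs_second_difference_gaussian_le (inv_pos.2 hs) w)
    refine (h.const_mul (s * √s)⁻¹).congr (Eventually.of_forall fun z => ?_)
    simp only [hD, heat_eq_const_mul_gaussian]
    ring
  have hsub : ∀ z : E3, z ≠ 0 →
      IntegrableOn (fun y : ℝ => 2 * (y ^ 5)⁻¹ * exp (-(‖z‖ ^ 2 / y ^ 2))) (Set.Ioi 0) ∧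
      ∫ y in Set.Ioi (0:ℝ), 2 * (y ^ 5)⁻¹ * exp (-(‖z‖ ^ 2 / y ^ 2)) = (‖z‖ ^ 4)⁻¹ := by
    intro z hz
    have hz : 0 < ‖z‖ := norm_pos_iff.2 hz
    have := integral_inv_pow_five_mul_exp (q := ‖z‖ ^ 2) (by positivity)
    rwa [← pow_mul] at this
  set f : E3 × ℝ → ℝ := fun p => D p.1 * (2 * (p.2 ^ 5)⁻¹ * exp (-(‖p.1‖ ^ 2 / p.2 ^ 2))) with hf
  have hfm : Measurable f := by
    simp only [hf]
    exact (hDm.comp measurable_fst).mul (by fun_prop)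
  have hfi : Integrable f (volume.prod (volume.restrict (Set.Ioi (0:ℝ)))) := by
    rw [integrable_prod_iff hfm.aestronglyMeasurable]
    constructor
    · filter_upwards [ae_ne_point 0] with z hz
      exact (hsub z hz).1.const_mul (D z)
    · refine hDi.norm.congr ?_
      filter_upwards [ae_ne_point 0] with z hz
      simp only [hf, norm_mul (D z)]
      rw [integral_const_mul, div_eq_mul_inv, norm_mul, ← (hsub z hz).2]
      congr 1
      rw [Real.norm_of_nonneg]
      · refine setIntegral_congr_fun measurableSet_Ioi fun y hy => ?_
        have hy : 0 < y := hy
        rw [Real.norm_of_nonneg (by positivity)]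
      · refine setIntegral_nonneg measurableSet_Ioi fun y hy => ?_
        have hy : 0 < y := hy
        positivity
  have e1 : ∫ z : E3, D z / ‖z‖ ^ 4 = ∫ z : E3, ∫ y in Set.Ioi (0:ℝ), f (z, y) := by
    refine integral_congr_ae ?_
    filter_upwards [ae_ne_point 0] with z hz
    simp only [hf]
    rw [integral_const_mul, (hsub z hz).2, div_eq_mul_inv]
  have e2 : ∀ y ∈ Set.Ioi (0:ℝ), ∫ z : E3, f (z, y) =
      4 * (π * √π) * ((heat s (‖w‖ ^ 2) - heat (s + y ^ 2) (‖w‖ ^ 2)) * (y ^ 2)⁻¹) := by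
    intro y hy
    have hy : 0 < y := hy
    have hy2 : 0 < y ^ 2 := by positivity
    have i1 := integrable_heat_add_mul_gaussian hs hy2 w
    have i2 : Integrable fun z : E3 => heat s (‖w - z‖ ^ 2) * exp (-(‖z‖ ^ 2 / y ^ 2)) := by
      simpa [sub_eq_add_neg] using i1.comp_neg
    have v1 := integral_heat_add_mul_gaussian hs hy2 w
    have v2 : ∫ z : E3, heat s (‖w - z‖ ^ 2) * exp (-(‖z‖ ^ 2 / y ^ 2)) =
        π * √π * (y ^ 2 * √(y ^ 2)) * heat (s + y ^ 2) (‖w‖ ^ 2) := by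
      rw [← v1, ← integral_neg_eq_self]
      simp [sub_eq_add_neg]
    have i0 : Integrable fun z : E3 => exp (-(‖z‖ ^ 2 / y ^ 2)) := by
      have := GaussianFourier.integral_rexp_neg_mul_sq_norm (V := E3) (b := (y ^ 2)⁻¹)
        (by positivity)
      refine (Integrable.of_integral_ne_zero (f := fun z : E3 => exp (-(y ^ 2)⁻¹ * ‖z‖ ^ 2))
        (by rw [this]; positivity)).congr (Eventually.of_forall fun z => ?_)
      simp only [div_eq_inv_mul, neg_mul]
    have v0 : ∫ z : E3, exp (-(‖z‖ ^ 2 / y ^ 2)) = π * √π * (y ^ 2 * √(y ^ 2)) := by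
      have := GaussianFourier.integral_rexp_neg_mul_sq_norm (V := E3) (b := (y ^ 2)⁻¹)
        (by positivity)
      simp_rw [div_eq_inv_mul, ← neg_mul]
      rw [this, show (Module.finrank ℝ E3 / 2 : ℝ) = 1 + 1 / 2 by simp; norm_num,
        rpow_add (by positivity), rpow_one, ← sqrt_eq_rpow, div_inv_eq_mul,
        sqrt_mul pi_pos.le]
      ring
    have e3 : ∀ z, f (z, y) = 2 * (y ^ 5)⁻¹ *
        (2 * heat s (‖w‖ ^ 2) * exp (-(‖z‖ ^ 2 / y ^ 2)) -
          heat s (‖w + z‖ ^ 2) * exp (-(‖z‖ ^ 2 / y ^ 2)) -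
          heat s (‖w - z‖ ^ 2) * exp (-(‖z‖ ^ 2 / y ^ 2))) := by
      intro z; simp only [hf, hD]; ring
    simp_rw [e3]
    have i01 : Integrable fun z : E3 => 2 * heat s (‖w‖ ^ 2) * exp (-(‖z‖ ^ 2 / y ^ 2)) -
        heat s (‖w + z‖ ^ 2) * exp (-(‖z‖ ^ 2 / y ^ 2)) := (i0.const_mul _).sub i1
    rw [integral_const_mul, integral_sub i01 i2, integral_sub (i0.const_mul _) i1, integral_const_mul, v0, v1, v2, sqrt_sq hy.le]
    field_simp
    ring
  have hfi2 : IntegrableOn (fun y : ℝ =>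
      (heat s (‖w‖ ^ 2) - heat (s + y ^ 2) (‖w‖ ^ 2)) * (y ^ 2)⁻¹) (Set.Ioi 0) := by
    have h := hfi.integral_prod_right
    have h2 : IntegrableOn (fun y : ℝ => 4 * (π * √π) *
        ((heat s (‖w‖ ^ 2) - heat (s + y ^ 2) (‖w‖ ^ 2)) * (y ^ 2)⁻¹)) (Set.Ioi 0) :=
      IntegrableOn.congr_fun h e2 measurableSet_Ioi
    have h3 := h2.const_mul (4 * (π * √π))⁻¹
    refine IntegrableOn.congr_fun h3 (fun y _ => ?_) measurableSet_Ioi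
    have := sqrt_pos.2 pi_pos
    have := pi_pos
    field_simp
  set ρ := ‖w‖ ^ 2 with hρ
  have hρ0 : 0 ≤ ρ := by positivity
  have hu : ∀ y ∈ Set.Ioi (0:ℝ), HasDerivAt (fun y => heat s ρ - heat (s + y ^ 2) ρ)
      (-(heatDeriv (s + y ^ 2) ρ * (2 * y))) y := by
    intro y _
    have h2 : HasDerivAt (fun y : ℝ => s + y ^ 2) (2 * y) y := by
      simpa using (hasDerivAt_pow 2 y).const_add s
    have h3 := (hasDerivAt_heat (by positivity : 0 < s + y ^ 2) ρ).comp y h2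
    simpa using h3.const_sub (heat s ρ)
  have hv : ∀ y ∈ Set.Ioi (0:ℝ), HasDerivAt (fun y : ℝ => -y⁻¹) ((y ^ 2)⁻¹) y := by
    intro y hy
    have hy : 0 < y := hy
    simpa using (hasDerivAt_inv hy.ne').fun_neg
  have hg'i := integrable_heatDeriv_add_sq hs hρ0
  have hbd : ∀ y, |heat s ρ| + |heat (s + y ^ 2) ρ| ≤ 2 * (s * √s)⁻¹ := by
    intro y
    have h1 := heat_le hs hρ0
    have h2 := heat_le (by positivity : 0 < s + y ^ 2) hρ0
    have h3 : ((s + y ^ 2) * √(s + y ^ 2))⁻¹ ≤ (s * √s)⁻¹ := by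
      gcongr <;> nlinarith
    rw [abs_of_nonneg (heat_nonneg hs ρ), abs_of_nonneg (heat_nonneg (by positivity) ρ)]
    linarith
  have key := integral_Ioi_mul_deriv_eq_deriv_mul hu hv hfi2 (a' := 0) (b' := 0) ?_ ?_ ?_
  · rw [e1, integral_integral_swap hfi, setIntegral_congr_fun measurableSet_Ioi e2,
      integral_const_mul, key]
    have e5 := integral_comp_abs (f := fun y : ℝ => heatDeriv (s + y ^ 2) ρ)
    simp only [sq_abs] at e5
    rw [e5]
    have e6 : ∫ y in Set.Ioi (0:ℝ), -(heatDeriv (s + y ^ 2) ρ * (2 * y)) * -y⁻¹ =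
        ∫ y in Set.Ioi (0:ℝ), 2 * heatDeriv (s + y ^ 2) ρ := by
      refine setIntegral_congr_fun measurableSet_Ioi fun y hy => ?_
      have hy : 0 < y := hy
      field_simp
    rw [e6, integral_const_mul]
    ring
  · refine IntegrableOn.congr_fun (hg'i.const_mul 2).integrableOn (fun y hy => ?_)
      measurableSet_Ioi
    have hy : 0 < y := hy
    simp only [Pi.mul_apply]
    field_simp
  · have h2 : HasDerivAt (fun y : ℝ => s + y ^ 2) 0 0 := by
      simpa using (hasDerivAt_pow 2 (0:ℝ)).const_add s
    have h3 := (hasDerivAt_heat (by simpa using hs : 0 < s + (0:ℝ) ^ 2) ρ).comp (0:ℝ) h2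
    rw [mul_zero, hasDerivAt_iff_tendsto_slope] at h3
    have h4 := h3.mono_left (nhdsWithin_mono 0 (fun y (hy : 0 < y) => hy.ne' :
      Set.Ioi (0:ℝ) ⊆ {0}ᶜ))
    refine h4.congr fun y => ?_
    simp [slope, Pi.mul_apply]
    ring
  · have h1 : Tendsto (fun y : ℝ => 2 * (s * √s)⁻¹ * y⁻¹) atTop (nhds 0) := by
      simpa using tendsto_inv_atTop_zero.const_mul (2 * (s * √s)⁻¹)
    refine squeeze_zero_norm' ?_ h1
    filter_upwards [eventually_gt_atTop 0] with y hy
    simp only [Pi.mul_apply, Real.norm_eq_abs, abs_mul, abs_neg, abs_inv, abs_of_pos hy]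
    gcongr
    exact (abs_sub _ _).trans (hbd y)

theorem tendsto_pv_heat {s : ℝ} (hs : 0 < s) (x₀ x : E3) :
    Tendsto (fun ε : ℝ => ∫ y in {y : E3 | ε < ‖x - y‖},
        (heat s (‖x - x₀‖ ^ 2) - heat s (‖y - x₀‖ ^ 2)) / ‖x - y‖ ^ 4)
      (nhdsWithin 0 (Set.Ioi 0))
      (nhds (-(2 * (π * √π)) * ∫ y : ℝ, heatDeriv (s + y ^ 2) (‖x - x₀‖ ^ 2))) := by
  set φ : E3 → ℝ := fun y => exp (-(s⁻¹ * ‖y - x₀‖ ^ 2)) with hφ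
  have hh : ∀ y, heat s (‖y - x₀‖ ^ 2) = (s * √s)⁻¹ * φ y := fun y =>
    heat_eq_const_mul_gaussian s (y - x₀)
  have hb : ∀ y, |φ y| ≤ 1 := fun y => by
    rw [abs_of_pos (exp_pos _)]
    exact exp_le_one_iff.2 (by simp; positivity)
  have hC := fun z => abs_second_difference_gaussian_le (inv_pos.2 hs) (x - x₀) z
  simp only [sub_add_eq_add_sub, sub_right_comm x x₀] at hC
  have h := (tendsto_pv (φ := φ) (by fun_prop) hb x hC).const_mul (s * √s)⁻¹
  have h2 := integral_second_difference_heat hs (x - x₀)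
  simp only [sub_add_eq_add_sub, sub_right_comm x x₀, hh] at h2
  have h3 : (s * √s)⁻¹ * (1 / 2 * ∫ z : E3, (2 * φ x - φ (x + z) - φ (x - z)) / ‖z‖ ^ 4) =
      -(2 * (π * √π)) * ∫ y : ℝ, heatDeriv (s + y ^ 2) (‖x - x₀‖ ^ 2) := by
    have h4 : (s * √s)⁻¹ * ∫ z : E3, (2 * φ x - φ (x + z) - φ (x - z)) / ‖z‖ ^ 4 =
        -(4 * (π * √π)) * ∫ y : ℝ, heatDeriv (s + y ^ 2) (‖x - x₀‖ ^ 2) := by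
      rw [← h2, ← integral_const_mul]
      congr 1
      ext z
      ring
    linear_combination (1 / 2) * h4
  rw [h3] at h
  refine h.congr fun ε => ?_
  rw [← integral_const_mul]
  congr 1
  ext y
  rw [hh, hh]
  ring

theorem integrableOn_pv_heat {s : ℝ} (x₀ x : E3) (hs : 0 < s) {ε : ℝ} (hε : 0 < ε) :
    IntegrableOn (fun y => (heat s (‖x - x₀‖ ^ 2) - heat s (‖y - x₀‖ ^ 2)) / ‖x - y‖ ^ 4)
      {y : E3 | ε < ‖x - y‖} := by
  have h := integrableOn_pv (φ := fun y : E3 => exp (-(s⁻¹ * ‖y - x₀‖ ^ 2))) (by fun_prop)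
    (fun y => by
      rw [abs_of_pos (exp_pos _)]
      exact exp_le_one_iff.2 (by simp; positivity)) x hε
  refine (h.const_mul (s * √s)⁻¹).congr (Eventually.of_forall fun y => ?_)
  simp only [heat_eq_const_mul_gaussian]
  ring

theorem exists_schwartz_heat_sub {s t : ℝ} (hs : 0 < s) (ht : 0 < t) (x₀ : E3) :
    ∃ φ : SchwartzMap E3 ℝ, (∀ x, φ x = heat s (‖x - x₀‖ ^ 2) - heat t (‖x - x₀‖ ^ 2)) ∧
      ∀ x, halfLap φ x = -(2 / √π) *
        ∫ y : ℝ, (heatDeriv (s + y ^ 2) (‖x - x₀‖ ^ 2) - heatDeriv (t + y ^ 2) (‖x - x₀‖ ^ 2)) := by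
  refine ⟨(s * √s)⁻¹ • gaussianSchwartz (inv_pos.2 hs) x₀ -
    (t * √t)⁻¹ • gaussianSchwartz (inv_pos.2 ht) x₀, ?_, ?_⟩
  · intro x
    simp only [sub_apply, smul_apply, gaussianSchwartz_apply,
      heat_eq_const_mul_gaussian, smul_eq_mul]
  · intro x
    refine Tendsto.limUnder_eq ?_
    have h := ((tendsto_pv_heat hs x₀ x).sub (tendsto_pv_heat ht x₀ x)).const_mul (1 / π ^ 2)
    have e : 1 / π ^ 2 * (-(2 * (π * √π)) * (∫ y : ℝ, heatDeriv (s + y ^ 2) (‖x - x₀‖ ^ 2)) -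
        -(2 * (π * √π)) * ∫ y : ℝ, heatDeriv (t + y ^ 2) (‖x - x₀‖ ^ 2)) =
        -(2 / √π) * ∫ y : ℝ,
          (heatDeriv (s + y ^ 2) (‖x - x₀‖ ^ 2) - heatDeriv (t + y ^ 2) (‖x - x₀‖ ^ 2)) := by
      rw [integral_sub (integrable_heatDeriv_add_sq hs (by positivity))
        (integrable_heatDeriv_add_sq ht (by positivity))]
      have h1 := sqrt_pos.2 pi_pos
      have h2 := sq_sqrt pi_pos.le
      have h3 := pi_pos
      field_simp
      rw [h2]
      ring
    rw [e] at h
    refine h.congr' ?_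
    filter_upwards [self_mem_nhdsWithin] with ε hε
    have hε : 0 < ε := hε
    rw [← integral_sub (integrableOn_pv_heat x₀ x hs hε) (integrableOn_pv_heat x₀ x ht hε)]
    congr 2
    ext y
    simp only [sub_apply, smul_apply, gaussianSchwartz_apply,
      heat_eq_const_mul_gaussian, smul_eq_mul]
    ring

theorem exists_abs_heatDeriv_sub_le {s t : ℝ} (hs : 0 < s) (hst : s ≤ t) :
    ∃ C, 0 ≤ C ∧ ∀ q ρ : ℝ, 0 ≤ q → 0 ≤ ρ → |heatDeriv (s + q) ρ - heatDeriv (t + q) ρ| ≤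
      C * (((1 + q) * √(1 + q))⁻¹ * ((1 + ρ) ^ 2)⁻¹) := by
  set m := min s 1 with hm
  have hm0 : 0 < m := lt_min hs one_pos
  have hm1 : 0 < √m := sqrt_pos.2 hm0
  refine ⟨300 * (m * √m)⁻¹ * (m ^ 2)⁻¹ * (t - s), ?_, ?_⟩
  · have : 0 ≤ t - s := by linarith
    positivity
  intro q ρ hq hρ
  have hb : ∀ σ ∈ Set.Icc (s + q) (t + q), ‖heatDeriv2 σ ρ‖ ≤
      300 * (m * √m)⁻¹ * (m ^ 2)⁻¹ * (((1 + q) * √(1 + q))⁻¹ * ((1 + ρ) ^ 2)⁻¹) := by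
    intro σ hσ
    have hσ0 : 0 < σ := by linarith [hσ.1]
    refine (abs_heatDeriv2_le hσ0 hρ).trans ?_
    have h1 : m * (1 + q) ≤ σ := (min_one_mul_le hq).trans hσ.1
    have h2 : √m * √(1 + q) ≤ √σ := by
      rw [← sqrt_mul hm0.le]; exact sqrt_le_sqrt h1
    have h4 : m ≤ 1 := min_le_right _ _
    have h5 : m ≤ σ := by nlinarith
    have h3 : m * (1 + ρ) ≤ σ + ρ := by nlinarith
    calc 300 * (σ * √σ)⁻¹ * ((σ + ρ) ^ 2)⁻¹ ≤
        300 * ((m * (1 + q)) * (√m * √(1 + q)))⁻¹ * ((m * (1 + ρ)) ^ 2)⁻¹ := by gcongr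
      _ = _ := by field_simp
  have := (convex_Icc (s + q) (t + q)).norm_image_sub_le_of_norm_hasDerivWithin_le
    (f := fun σ => heatDeriv σ ρ) (f' := fun σ => heatDeriv2 σ ρ)
    (fun σ hσ => (hasDerivAt_heatDeriv (by linarith [hσ.1]) ρ).hasDerivWithinAt) hb
    (Set.right_mem_Icc.2 (by linarith)) (Set.left_mem_Icc.2 (by linarith))
  rw [Real.norm_eq_abs] at this
  refine this.trans (le_of_eq ?_)
  rw [Real.norm_eq_abs, abs_sub_comm, abs_of_nonneg (by linarith)]
  ring

theorem integrable_heatDeriv_sub {s t ρ : ℝ} (hs : 0 < s) (hst : s ≤ t) (hρ : 0 ≤ ρ) :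
    IntegrableOn (fun r : ℝ => r * (heatDeriv (s + r ^ 2) ρ - heatDeriv (t + r ^ 2) ρ))
      (Set.Ioi 0) := by
  obtain ⟨C, hC, h⟩ := exists_abs_heatDeriv_sub_le hs hst
  refine Integrable.mono' (integrable_inv_one_add_sq.const_mul C).integrableOn ?_ ?_
  · have h1 : Measurable fun y : ℝ => heatDeriv (s + y ^ 2) ρ :=
      measurable_heatDeriv.comp (f := fun y : ℝ => (s + y ^ 2, ρ)) (by fun_prop)
    have h2 : Measurable fun y : ℝ => heatDeriv (t + y ^ 2) ρ :=
      measurable_heatDeriv.comp (f := fun y : ℝ => (t + y ^ 2, ρ)) (by fun_prop)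
    exact (measurable_id.mul (h1.sub h2)).aestronglyMeasurable
  · refine (ae_restrict_iff' measurableSet_Ioi).2 (Eventually.of_forall fun r hr => ?_)
    have hr : 0 < r := hr
    rw [norm_mul, Real.norm_of_nonneg hr.le, Real.norm_eq_abs]
    have h1 := h (r ^ 2) ρ (by positivity) hρ
    have h2 : r ≤ √(1 + r ^ 2) := le_sqrt_of_sq_le (by linarith)
    have h3 : ((1 + ρ) ^ 2)⁻¹ ≤ 1 := inv_le_one_of_one_le₀ (by nlinarith)
    calc _ ≤ √(1 + r ^ 2) * (C * (((1 + r ^ 2) * √(1 + r ^ 2))⁻¹ * 1)) := by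
          gcongr
          exact h1.trans (by gcongr)
      _ = _ := by
        have := sqrt_pos.2 (by positivity : 0 < 1 + r ^ 2)
        field_simp

theorem tendsto_heat_add_sq {s ρ : ℝ} (hs : 0 < s) (hρ : 0 ≤ ρ) :
    Tendsto (fun r : ℝ => heat (s + r ^ 2) ρ) atTop (nhds 0) := by
  have h1 : Tendsto (fun r : ℝ => (√s)⁻¹ * (r ^ 2)⁻¹) atTop (nhds 0) := by
    simpa using (tendsto_inv_atTop_zero.comp (tendsto_pow_atTop two_ne_zero)).const_mul (√s)⁻¹
  refine squeeze_zero' (Eventually.of_forall fun r => heat_nonneg (by positivity) ρ) ?_ h1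
  filter_upwards [eventually_gt_atTop 0] with r hr
  refine (heat_le (by positivity) hρ).trans ?_
  rw [← mul_inv, mul_comm]
  have := sqrt_pos.2 hs
  gcongr <;> nlinarith

theorem integral_heatDeriv_sub_plane {s t ρ : ℝ} (hs : 0 < s) (hst : s ≤ t) (hρ : 0 ≤ ρ) :
    ∫ p : ℝ × ℝ, (heatDeriv (s + (p.1 ^ 2 + p.2 ^ 2)) ρ - heatDeriv (t + (p.1 ^ 2 + p.2 ^ 2)) ρ) =
      -(π * (heat s ρ - heat t ρ)) := by
  have ht : 0 < t := hs.trans_le hst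
  rw [← integral_comp_polarCoord_symm]
  have e : ∀ p : ℝ × ℝ, p.1 •
      (heatDeriv (s + ((polarCoord.symm p).1 ^ 2 + (polarCoord.symm p).2 ^ 2)) ρ -
        heatDeriv (t + ((polarCoord.symm p).1 ^ 2 + (polarCoord.symm p).2 ^ 2)) ρ) =
      p.1 * (heatDeriv (s + p.1 ^ 2) ρ - heatDeriv (t + p.1 ^ 2) ρ) * 1 := by
    intro p
    have : (polarCoord.symm p).1 ^ 2 + (polarCoord.symm p).2 ^ 2 = p.1 ^ 2 := by
      simp only [polarCoord_symm_apply]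
      linear_combination p.1 ^ 2 * (cos_sq_add_sin_sq p.2)
    rw [this, smul_eq_mul, mul_one]
  simp_rw [e]
  rw [polarCoord_target, Measure.volume_eq_prod, setIntegral_prod_mul
    (fun r => r * (heatDeriv (s + r ^ 2) ρ - heatDeriv (t + r ^ 2) ρ)) (fun _ => (1:ℝ))]
  have h1 : ∀ a : ℝ, 0 < a → ∀ r : ℝ, HasDerivAt (fun r : ℝ => 1 / 2 * heat (a + r ^ 2) ρ)
      (r * heatDeriv (a + r ^ 2) ρ) r := by
    intro a ha r
    have h2 : HasDerivAt (fun y : ℝ => a + y ^ 2) (2 * r) r := by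
      simpa using (hasDerivAt_pow 2 r).const_add a
    refine (((hasDerivAt_heat (by positivity : 0 < a + r ^ 2) ρ).comp r h2).const_mul
      (1 / 2)).congr_deriv ?_
    ring
  have h2 := integral_Ioi_of_hasDerivAt_of_tendsto' (a := 0)
    (f := fun r : ℝ => 1 / 2 * heat (s + r ^ 2) ρ - 1 / 2 * heat (t + r ^ 2) ρ)
    (f' := fun r => r * (heatDeriv (s + r ^ 2) ρ - heatDeriv (t + r ^ 2) ρ)) (m := 0)
    (fun r _ => ((h1 s hs r).sub (h1 t ht r)).congr_deriv (by ring))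
    (integrable_heatDeriv_sub hs hst hρ)
    (by
      simpa [-one_div] using ((tendsto_heat_add_sq hs hρ).const_mul (1 / 2)).sub
        ((tendsto_heat_add_sq ht hρ).const_mul (1 / 2)))
  rw [h2]
  simp only [integral_const, measureReal_restrict_apply_univ, volume_real_Ioo_of_le
    (by linarith [pi_pos] : -π ≤ π), smul_eq_mul]
  ring_nf

/-! ### Testing the equation against differences of heat kernels -/

/-- The integral of the heat kernel over a further line of times. -/
noncomputable def heatLine (s ρ : ℝ) : ℝ := ∫ z : ℝ, heat (s + z ^ 2) ρ

theorem one_add_norm_sq_le_shift (x a : E3) :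
    1 + ‖x‖ ^ 2 ≤ 2 * (1 + ‖a‖ ^ 2) * (1 + ‖x - a‖ ^ 2) := by
  have h : ‖x‖ ≤ ‖a‖ + ‖x - a‖ := by simpa using norm_add_le a (x - a)
  have : ‖x‖ ^ 2 ≤ (‖a‖ + ‖x - a‖) ^ 2 := by gcongr
  nlinarith [sq_nonneg (‖a‖ - ‖x - a‖), sq_nonneg (‖a‖ * ‖x - a‖)]

theorem integrable_weight_shift {U : E3 → ℝ}
    (hU : Integrable fun x => U x * ((1 + ‖x‖ ^ 2) ^ 2)⁻¹) (a : E3) :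
    Integrable fun x => U x * ((1 + ‖x - a‖ ^ 2) ^ 2)⁻¹ := by
  have h : Integrable fun x => ((1 + ‖x‖ ^ 2) ^ 2 * ((1 + ‖x - a‖ ^ 2) ^ 2)⁻¹) *
      (U x * ((1 + ‖x‖ ^ 2) ^ 2)⁻¹) := by
    refine hU.bdd_mul (c := (2 * (1 + ‖a‖ ^ 2)) ^ 2) (by fun_prop) ?_
    refine Eventually.of_forall fun x => ?_
    rw [Real.norm_of_nonneg (by positivity), ← div_eq_mul_inv, div_le_iff₀ (by positivity),
      ← mul_pow]
    gcongr
    exact one_add_norm_sq_le_shift x a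
  refine h.congr (Eventually.of_forall fun x => ?_)
  field_simp

theorem integrable_heat_add_sq {s ρ : ℝ} (hs : 0 < s) (hρ : 0 ≤ ρ) :
    Integrable fun z : ℝ => heat (s + z ^ 2) ρ := by
  have hm : 0 < min s 1 := lt_min hs one_pos
  refine Integrable.mono' (integrable_inv_one_add_sq.const_mul ((√s)⁻¹ * (min s 1)⁻¹)) ?_ ?_
  · have : Measurable fun y : ℝ => heat (s + y ^ 2) ρ :=
      measurable_heat.comp (f := fun y : ℝ => (s + y ^ 2, ρ)) (by fun_prop)
    exact this.aestronglyMeasurable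
  · refine Eventually.of_forall fun z => ?_
    rw [Real.norm_of_nonneg (heat_nonneg (by positivity) _)]
    refine (heat_le (by positivity) hρ).trans ?_
    rw [mul_assoc, ← mul_inv, ← mul_inv, mul_comm]
    have := sqrt_pos.2 hs
    have h1 := min_one_mul_le (s := s) (sq_nonneg z)
    gcongr
    nlinarith

theorem integrable_plane_weight :
    Integrable fun y : ℝ => (1 + y ^ 2) ^ (-(3 / 4) : ℝ) := by
  have := integrable_rpow_neg_one_add_norm_sq (E := ℝ) (μ := volume) (r := 3 / 2)
    (by simp; norm_num)
  refine this.congr (Eventually.of_forall fun y => ?_)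
  simp only [Real.norm_eq_abs, sq_abs]
  norm_num

theorem plane_weight_le (y z : ℝ) : ((1 + (z ^ 2 + y ^ 2)) * √(1 + (z ^ 2 + y ^ 2)))⁻¹ ≤
    (1 + z ^ 2) ^ (-(3 / 4) : ℝ) * (1 + y ^ 2) ^ (-(3 / 4) : ℝ) := by
  have h0 : 0 < 1 + (z ^ 2 + y ^ 2) := by positivity
  have h1 : (1 + (z ^ 2 + y ^ 2)) * √(1 + (z ^ 2 + y ^ 2)) =
      (1 + (z ^ 2 + y ^ 2)) ^ (3 / 4 : ℝ) * (1 + (z ^ 2 + y ^ 2)) ^ (3 / 4 : ℝ) := by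
    rw [sqrt_eq_rpow, ← rpow_add h0]
    nth_rewrite 1 [← rpow_one (1 + (z ^ 2 + y ^ 2))]
    rw [← rpow_add h0]
    norm_num
  rw [h1, rpow_neg (by positivity), rpow_neg (by positivity), ← mul_inv]
  gcongr <;> nlinarith [sq_nonneg y, sq_nonneg z]

theorem heat_identity {U f : E3 → ℝ} (hU : Integrable fun x => U x * ((1 + ‖x‖ ^ 2) ^ 2)⁻¹)
    (hUm : AEStronglyMeasurable U) (hf : Integrable f)
    (H : ∀ φ : SchwartzMap E3 ℝ, ∫ x, U x * halfLap φ x = 2 * ∫ x, f x * φ x)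
    {s t : ℝ} (hs : 0 < s) (hst : s ≤ t) (a : E3) :
    √π * ∫ x, U x * (heat s (‖x - a‖ ^ 2) - heat t (‖x - a‖ ^ 2)) =
      ∫ x, f x * (heatLine s (‖x - a‖ ^ 2) - heatLine t (‖x - a‖ ^ 2)) := by
  have ht : 0 < t := hs.trans_le hst
  obtain ⟨C, hC, hD⟩ := exists_abs_heatDeriv_sub_le hs hst
  have hUa := integrable_weight_shift hU a
  set F : ℝ → ℝ := fun y => (1 + y ^ 2) ^ (-(3 / 4) : ℝ) with hF
  have hF0 : ∀ y, 0 ≤ F y := fun y => by positivity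
  have hFi : Integrable F := integrable_plane_weight
  set D : ℝ → ℝ → E3 → ℝ := fun z y x => heatDeriv (s + (z ^ 2 + y ^ 2)) (‖x - a‖ ^ 2) -
    heatDeriv (t + (z ^ 2 + y ^ 2)) (‖x - a‖ ^ 2) with hDdef
  have hDm : Measurable fun p : E3 × ℝ × ℝ => D p.2.1 p.2.2 p.1 := by
    have h1 : ∀ b : ℝ, Measurable fun p : E3 × ℝ × ℝ =>
        heatDeriv (b + (p.2.1 ^ 2 + p.2.2 ^ 2)) (‖p.1 - a‖ ^ 2) := fun b =>
      measurable_heatDeriv.comp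
        (f := fun p : E3 × ℝ × ℝ => (b + (p.2.1 ^ 2 + p.2.2 ^ 2), ‖p.1 - a‖ ^ 2)) (by fun_prop)
    exact (h1 s).sub (h1 t)
  have hDb : ∀ z y x, |D z y x| ≤ C * (F z * F y * ((1 + ‖x - a‖ ^ 2) ^ 2)⁻¹) := by
    intro z y x
    refine (hD _ _ (by positivity) (by positivity)).trans ?_
    gcongr
    exact plane_weight_le y z
  -- integrability on the full product
  have hi : Integrable (fun p : E3 × ℝ × ℝ => U p.1 * D p.2.1 p.2.2 p.1) := by
    have h1 : Integrable fun p : E3 × ℝ × ℝ => (|U p.1 * ((1 + ‖p.1 - a‖ ^ 2) ^ 2)⁻¹|) *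
        (C * (F p.2.1 * F p.2.2)) :=
      Integrable.mul_prod hUa.abs ((hFi.mul_prod hFi).const_mul C)
    refine Integrable.mono' h1 ((hUm.comp_fst).mul hDm.aestronglyMeasurable) ?_
    refine Eventually.of_forall fun p => ?_
    rw [Real.norm_eq_abs, abs_mul, abs_mul, abs_of_pos (by positivity : 0 < ((1 + ‖p.1 - a‖ ^ 2) ^ 2)⁻¹)]
    calc _ ≤ |U p.1| * (C * (F p.2.1 * F p.2.2 * ((1 + ‖p.1 - a‖ ^ 2) ^ 2)⁻¹)) := by
          gcongr; exact hDb _ _ _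
      _ = _ := by ring
  have hiz : ∀ z : ℝ, Integrable (fun p : E3 × ℝ => U p.1 * D z p.2 p.1) := by
    intro z
    have h1 : Integrable fun p : E3 × ℝ => (|U p.1 * ((1 + ‖p.1 - a‖ ^ 2) ^ 2)⁻¹|) *
        (C * F z * F p.2) :=
      Integrable.mul_prod hUa.abs (hFi.const_mul (C * F z))
    have h2 : Measurable fun p : E3 × ℝ => D z p.2 p.1 :=
      hDm.comp (f := fun p : E3 × ℝ => (p.1, z, p.2)) (by fun_prop)
    refine Integrable.mono' h1 ((hUm.comp_fst).mul h2.aestronglyMeasurable) ?_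
    refine Eventually.of_forall fun p => ?_
    rw [Real.norm_eq_abs, abs_mul, abs_mul, abs_of_pos (by positivity : 0 < ((1 + ‖p.1 - a‖ ^ 2) ^ 2)⁻¹)]
    calc _ ≤ |U p.1| * (C * (F z * F p.2 * ((1 + ‖p.1 - a‖ ^ 2) ^ 2)⁻¹)) := by
          gcongr; exact hDb _ _ _
      _ = _ := by ring
  have hL : ∫ z : ℝ, ∫ x, U x * ∫ y : ℝ, D z y x =
      -π * ∫ x, U x * (heat s (‖x - a‖ ^ 2) - heat t (‖x - a‖ ^ 2)) := by
    have e1 : ∀ z : ℝ, ∫ x, U x * ∫ y : ℝ, D z y x = ∫ y : ℝ, ∫ x, U x * D z y x := by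
      intro z
      rw [← integral_integral_swap (f := fun x y => U x * D z y x) (hiz z)]
      simp_rw [integral_const_mul]
    simp_rw [e1]
    rw [← integral_const_mul,
      ← integral_prod (fun q : ℝ × ℝ => ∫ x, U x * D q.1 q.2 x) hi.integral_prod_right,
      ← integral_integral_swap (f := fun x (q : ℝ × ℝ) => U x * D q.1 q.2 x)
        (μ := volume) (ν := volume.prod volume) hi]
    congr 1
    ext x
    rw [integral_const_mul]
    have := integral_heatDeriv_sub_plane hs hst (sq_nonneg ‖x - a‖)
    rw [Measure.volume_eq_prod] at this
    simp only [hDdef]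
    rw [this]
    ring
  have hsz : ∀ z : ℝ, 0 < s + z ^ 2 := fun z => by positivity
  have htz : ∀ z : ℝ, 0 < t + z ^ 2 := fun z => by positivity
  have hR : ∀ z : ℝ, -(2 / √π) * ∫ x, U x * ∫ y : ℝ, D z y x =
      2 * ∫ x, f x * (heat (s + z ^ 2) (‖x - a‖ ^ 2) - heat (t + z ^ 2) (‖x - a‖ ^ 2)) := by
    intro z
    obtain ⟨φ, h1, h2⟩ := exists_schwartz_heat_sub (hsz z) (htz z) a
    have h3 := H φ
    simp only [h1, h2, add_assoc] at h3
    rw [← h3, ← integral_const_mul]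
    congr 1
    ext x
    simp only [hDdef]
    ring
  have hfi : ∀ b : ℝ, 0 < b →
      Integrable fun p : E3 × ℝ => f p.1 * heat (b + p.2 ^ 2) (‖p.1 - a‖ ^ 2) := by
    intro b hb
    have h1 : Integrable fun p : E3 × ℝ => |f p.1| * heat (b + p.2 ^ 2) 0 :=
      Integrable.mul_prod hf.abs (integrable_heat_add_sq hb le_rfl)
    have h2 : Measurable fun p : E3 × ℝ => heat (b + p.2 ^ 2) (‖p.1 - a‖ ^ 2) :=
      measurable_heat.comp (f := fun p : E3 × ℝ => (b + p.2 ^ 2, ‖p.1 - a‖ ^ 2)) (by fun_prop)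
    refine Integrable.mono' h1 ((hf.1.comp_fst).mul h2.aestronglyMeasurable) ?_
    refine Eventually.of_forall fun p => ?_
    rw [Real.norm_eq_abs, abs_mul, abs_of_nonneg (heat_nonneg (by positivity) _)]
    gcongr
    simpa [heat] using heat_le (by positivity : 0 < b + p.2 ^ 2) (sq_nonneg ‖p.1 - a‖)
  have hfs : Integrable fun p : E3 × ℝ => f p.1 * (heat (s + p.2 ^ 2) (‖p.1 - a‖ ^ 2) -
      heat (t + p.2 ^ 2) (‖p.1 - a‖ ^ 2)) := by
    simp only [mul_sub]
    exact (hfi s hs).sub (hfi t ht)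
  have hRR : ∫ z : ℝ, ∫ x, f x * (heat (s + z ^ 2) (‖x - a‖ ^ 2) - heat (t + z ^ 2) (‖x - a‖ ^ 2)) =
      ∫ x, f x * (heatLine s (‖x - a‖ ^ 2) - heatLine t (‖x - a‖ ^ 2)) := by
    rw [← integral_integral_swap (f := fun x z => f x * (heat (s + z ^ 2) (‖x - a‖ ^ 2) -
      heat (t + z ^ 2) (‖x - a‖ ^ 2))) hfs]
    congr 1
    ext x
    rw [integral_const_mul, integral_sub (integrable_heat_add_sq hs (by positivity))
      (integrable_heat_add_sq ht (by positivity)), heatLine, heatLine]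
  have h3 : ∫ z : ℝ, -(2 / √π) * ∫ x, U x * ∫ y : ℝ, D z y x = ∫ z : ℝ,
      2 * ∫ x, f x * (heat (s + z ^ 2) (‖x - a‖ ^ 2) - heat (t + z ^ 2) (‖x - a‖ ^ 2)) := by
    congr 1
    ext z
    exact hR z
  rw [integral_const_mul, integral_const_mul, hL, hRR] at h3
  have h4 := sqrt_pos.2 pi_pos
  have h5 := mul_self_sqrt pi_pos.le
  have h6 : 2 / √π * π = 2 * √π := by
    nth_rewrite 2 [← h5]
    field_simp
  linear_combination (1 / 2) * h3 - (1 / 2) * (∫ x, U x * (heat s (‖x - a‖ ^ 2) - heat t (‖x - a‖ ^ 2))) * h6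

/-! ### The Laplacian as a Riesz potential -/

theorem heat_le_weight {s ρ : ℝ} (hs : 0 < s) (hρ : 0 ≤ ρ) :
    heat s ρ ≤ 5 * √s * ((s + ρ) ^ 2)⁻¹ := by
  have ht : 0 ≤ ρ / s := by positivity
  have e0 := pow_mul_exp_neg_le 0 ht
  have e1 := pow_mul_exp_neg_le 1 ht
  have e2 := pow_mul_exp_neg_le 2 ht
  norm_num [Nat.factorial] at e0 e1 e2
  have h : exp (-(ρ / s)) ≤ 5 * ((1 + ρ / s) ^ 2)⁻¹ := by
    rw [← div_eq_mul_inv, le_div_iff₀ (by positivity)]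
    have : exp (-(ρ / s)) ≤ 1 := exp_le_one_iff.2 (by linarith)
    nlinarith
  have hs' := sqrt_pos.2 hs
  calc heat s ρ ≤ (s * √s)⁻¹ * (5 * ((1 + ρ / s) ^ 2)⁻¹) := by unfold heat; gcongr
    _ = 5 * √s * ((s + ρ) ^ 2)⁻¹ := by
      have := mul_self_sqrt hs.le
      have h2 : (1 + ρ / s) = (s + ρ) / s := by field_simp
      rw [h2]
      field_simp
      nlinarith

theorem measurable_heatLine (s : ℝ) : Measurable (heatLine s) := by
  have h2 : Measurable fun p : ℝ × ℝ => heat (s + p.2 ^ 2) p.1 :=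
    measurable_heat.comp (f := fun p : ℝ × ℝ => (s + p.2 ^ 2, p.1)) (by fun_prop)
  exact (h2.stronglyMeasurable.integral_prod_right').measurable

theorem heatLine_nonneg {s : ℝ} (hs : 0 < s) (ρ : ℝ) : 0 ≤ heatLine s ρ :=
  integral_nonneg fun z => heat_nonneg (by positivity) ρ

theorem heatLine_le {s ρ : ℝ} (hs : 0 < s) (hρ : 0 ≤ ρ) :
    heatLine s ρ ≤ (√s)⁻¹ * (min s 1)⁻¹ * π := by
  have hm : 0 < min s 1 := lt_min hs one_pos
  rw [← integral_univ_inv_one_add_sq, ← integral_const_mul]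
  refine integral_mono (integrable_heat_add_sq hs hρ) (integrable_inv_one_add_sq.const_mul _) ?_
  intro z
  refine (heat_le (by positivity) hρ).trans ?_
  simp only
  rw [mul_assoc, ← mul_inv, ← mul_inv, mul_comm]
  have := sqrt_pos.2 hs
  have h1 := min_one_mul_le (s := s) (sq_nonneg z)
  gcongr
  nlinarith

theorem integral_inv_add_sq {ρ : ℝ} (hρ : 0 < ρ) :
    Integrable (fun z : ℝ => (z ^ 2 + ρ)⁻¹) ∧ ∫ z : ℝ, (z ^ 2 + ρ)⁻¹ = π / √ρ := by
  have h := sqrt_pos.2 hρ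
  have e : ∀ z : ℝ, (z ^ 2 + ρ)⁻¹ = ρ⁻¹ * (1 + (z / √ρ) ^ 2)⁻¹ := by
    intro z
    rw [div_pow, sq_sqrt hρ.le]
    field_simp
    ring
  simp_rw [e]
  refine ⟨(integrable_inv_one_add_sq.comp_div h.ne').const_mul _, ?_⟩
  rw [integral_const_mul, Measure.integral_comp_div (fun z : ℝ => (1 + z ^ 2)⁻¹),
    integral_univ_inv_one_add_sq, abs_of_pos h, smul_eq_mul]
  nth_rewrite 1 [← mul_self_sqrt hρ.le]
  field_simp

theorem heat_add_sq_le {s ρ : ℝ} (hs : 0 < s) (hρ : 0 < ρ) (z : ℝ) :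
    heat (s + z ^ 2) ρ ≤ 5 * (√ρ)⁻¹ * (z ^ 2 + ρ)⁻¹ := by
  have hσ : 0 < s + z ^ 2 := by positivity
  refine (heat_le_weight hσ hρ.le).trans ?_
  set σ := s + z ^ 2
  have h1 : z ^ 2 + ρ ≤ σ + ρ := by simp only [σ]; linarith
  have h2 : √σ ≤ √(σ + ρ) := sqrt_le_sqrt (by linarith)
  have h3 : √ρ ≤ √(σ + ρ) := sqrt_le_sqrt (by linarith)
  have h4 := sqrt_pos.2 hρ
  have h5 : 0 < √(σ + ρ) := h4.trans_le h3
  calc 5 * √σ * ((σ + ρ) ^ 2)⁻¹ ≤ 5 * √(σ + ρ) * ((σ + ρ) ^ 2)⁻¹ := by gcongr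
    _ = 5 * (√(σ + ρ))⁻¹ * (σ + ρ)⁻¹ := by
      have := mul_self_sqrt (by positivity : 0 ≤ σ + ρ)
      field_simp
      nlinarith
    _ ≤ _ := by gcongr

theorem heatLine_le_div {s ρ : ℝ} (hs : 0 < s) (hρ : 0 < ρ) : heatLine s ρ ≤ 5 * π * ρ⁻¹ := by
  have h1 := integral_mono (integrable_heat_add_sq hs hρ.le)
    ((integral_inv_add_sq hρ).1.const_mul (5 * (√ρ)⁻¹)) (heat_add_sq_le hs hρ)
  rw [integral_const_mul, (integral_inv_add_sq hρ).2] at h1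
  refine h1.trans (le_of_eq ?_)
  rw [← mul_self_sqrt hρ.le]
  have := sqrt_pos.2 hρ
  rw [sqrt_mul_self this.le]
  field_simp

theorem integral_heat_sq {ρ : ℝ} (hρ : 0 < ρ) : ∫ z : ℝ, heat (z ^ 2) ρ = ρ⁻¹ := by
  have h0 := integral_comp_abs (f := fun z : ℝ => heat (z ^ 2) ρ)
  simp only [sq_abs] at h0
  rw [h0]
  set G : ℝ → ℝ := fun z => exp (-(ρ / z ^ 2)) * (2 * ρ)⁻¹ with hG
  have hd : ∀ y ∈ Set.Ioi (0:ℝ), HasDerivAt (Function.update G 0 0) (heat (y ^ 2) ρ) y := by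
    intro y hy
    have hy : 0 < y := hy
    have h2 : HasDerivAt (fun y : ℝ => y ^ 2) (2 * y) y := by simpa using hasDerivAt_pow 2 y
    have h3 := ((h2.inv (by positivity)).const_mul ρ).neg.exp.mul_const (2 * ρ)⁻¹
    have h5 : HasDerivAt G (heat (y ^ 2) ρ) y := by
      have h6 := h3.congr_of_eventuallyEq (f₁ := G) (Eventually.of_forall fun x => by
        simp only [hG, Pi.inv_apply, Pi.neg_apply, div_eq_mul_inv])
      refine h6.congr_deriv ?_
      simp only [Pi.inv_apply, Pi.neg_apply, heat, sqrt_sq hy.le, div_eq_mul_inv]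
      field_simp
    refine h5.congr_of_eventuallyEq ?_
    filter_upwards [eventually_ne_nhds hy.ne'] with x hx
    exact Function.update_of_ne hx _ _
  have hc : ContinuousWithinAt (Function.update G 0 0) (Set.Ici 0) 0 := by
    rw [continuousWithinAt_update_same, Set.Ici_sdiff_left]
    have hb : Tendsto (fun y : ℝ => y ^ 2 * (2 * ρ ^ 2)⁻¹) (nhdsWithin 0 (Set.Ioi 0))
        (nhds 0) := by
      have : Continuous fun y : ℝ => y ^ 2 * (2 * ρ ^ 2)⁻¹ := by fun_prop
      have := this.tendsto 0
      simp only [ne_eq, OfNat.ofNat_ne_zero, not_false_eq_true, zero_pow, zero_mul] at this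
      exact this.mono_left nhdsWithin_le_nhds
    refine squeeze_zero' ?_ ?_ hb
    · exact Eventually.of_forall fun y => by positivity
    · filter_upwards [self_mem_nhdsWithin] with y hy
      have hy : 0 < y := hy
      have ht : 0 < ρ / y ^ 2 := by positivity
      have h1 := pow_mul_exp_neg_le 1 ht.le
      norm_num at h1
      have h3 : G y = (y ^ 2 * (2 * ρ ^ 2)⁻¹) * ((ρ / y ^ 2) * exp (-(ρ / y ^ 2))) := by
        simp only [hG]; field_simp
      rw [h3]
      exact mul_le_of_le_one_right (by positivity) h1
  have hl : Tendsto (Function.update G 0 0) atTop (nhds (2 * ρ)⁻¹) := by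
    have hi : Tendsto (fun y : ℝ => (y ^ 2)⁻¹) atTop (nhds 0) :=
      tendsto_inv_atTop_zero.comp (tendsto_pow_atTop two_ne_zero)
    have h1 : Tendsto G atTop (nhds (exp (-(ρ * 0)) * (2 * ρ)⁻¹)) := by
      have := ((continuous_exp.tendsto _).comp (hi.const_mul ρ).neg).mul_const (2 * ρ)⁻¹
      refine this.congr fun y => ?_
      simp only [hG, Function.comp, div_eq_mul_inv]
    simp only [mul_zero, neg_zero, exp_zero, one_mul] at h1
    refine h1.congr' ?_
    filter_upwards [eventually_gt_atTop 0] with y hy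
    exact (Function.update_of_ne hy.ne' _ _).symm
  have hp : ∀ y ∈ Set.Ioi (0:ℝ), 0 ≤ heat (y ^ 2) ρ := by
    intro y hy
    have hy : 0 < y := hy
    exact heat_nonneg (by positivity) _
  rw [integral_Ioi_of_hasDerivAt_of_nonneg hc hd hp hl, Function.update_self]
  field_simp
  simp

theorem tendsto_heatLine {ρ : ℝ} (hρ : 0 < ρ) :
    Tendsto (fun c : ℝ => heatLine (c ^ 2)⁻¹ ρ) atTop (nhds ρ⁻¹) := by
  rw [← integral_heat_sq hρ]
  refine tendsto_integral_filter_of_dominated_convergence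
    (fun z => 5 * (√ρ)⁻¹ * (z ^ 2 + ρ)⁻¹) ?_ ?_ ((integral_inv_add_sq hρ).1.const_mul _) ?_
  · filter_upwards [eventually_gt_atTop 0] with c hc
    exact (integrable_heat_add_sq (by positivity) hρ.le).aestronglyMeasurable
  · filter_upwards [eventually_gt_atTop 0] with c hc
    refine Eventually.of_forall fun z => ?_
    have : 0 < (c ^ 2)⁻¹ := by positivity
    rw [Real.norm_of_nonneg (heat_nonneg (by positivity) _)]
    exact heat_add_sq_le this hρ z
  · have : ∀ᵐ z : ℝ, z ≠ 0 := by simp [ae_iff, measure_singleton]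
    filter_upwards [this] with z hz
    have hz2 : 0 < z ^ 2 := by positivity
    have hi : Tendsto (fun c : ℝ => (c ^ 2)⁻¹ + z ^ 2) atTop (nhds (z ^ 2)) := by
      simpa using (tendsto_inv_atTop_zero.comp (tendsto_pow_atTop two_ne_zero)).add_const (z ^ 2)
    exact (hasDerivAt_heat hz2 ρ).continuousAt.tendsto.comp hi

theorem abs_heat_sub_le {T : ℝ} (hT : 1 ≤ T) (x a b : E3) :
    |heat T (‖x - a‖ ^ 2) - heat T (‖x - b‖ ^ 2)| ≤
      32 * ‖a - b‖ * (((1 + ‖x - a‖ ^ 2) ^ 2)⁻¹ + ((1 + ‖x - b‖ ^ 2) ^ 2)⁻¹) := by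
  have hT0 : 0 < T := by linarith
  have hqT := sqrt_pos.2 hT0
  have hd : ∀ r : ℝ, HasDerivAt (fun r : ℝ => heat T (r ^ 2))
      (-((T * √T)⁻¹ * (exp (-(r ^ 2 / T)) * (2 * r / T)))) r := by
    intro r
    have h2 : HasDerivAt (fun y : ℝ => -(y ^ 2 / T)) (-(2 * r / T)) r := by
      simpa using ((hasDerivAt_pow 2 r).div_const T).fun_neg
    exact (h2.exp.const_mul (T * √T)⁻¹).congr_deriv (by ring)
  have hb : ∀ r : ℝ, 0 ≤ r → ‖-((T * √T)⁻¹ * (exp (-(r ^ 2 / T)) * (2 * r / T)))‖ ≤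
      32 * ((1 + r ^ 2) ^ 2)⁻¹ := by
    intro r hr
    rw [norm_neg, Real.norm_of_nonneg (by positivity)]
    have ht : 0 ≤ r ^ 2 / T := by positivity
    have e1 := pow_mul_exp_neg_le 1 ht
    have e2 := pow_mul_exp_neg_le 2 ht
    have e3 := pow_mul_exp_neg_le 3 ht
    norm_num [Nat.factorial] at e1 e2 e3
    have e0 : exp (-(r ^ 2 / T)) ≤ 1 := exp_le_one_iff.2 (by linarith)
    set t := r ^ 2 / T with htdef
    have h1 : r / √T ≤ 1 + t := by
      have : t = (r / √T) ^ 2 := by rw [div_pow, sq_sqrt hT0.le]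
      rw [this]; nlinarith [sq_nonneg (r / √T - 1)]
    have h2 : exp (-t) * (1 + t) ^ 3 ≤ 16 := by nlinarith
    have h3 : exp (-t) * (1 + t) ≤ 16 * ((1 + t) ^ 2)⁻¹ := by
      rw [← div_eq_mul_inv, le_div_iff₀ (by positivity)]; nlinarith
    calc (T * √T)⁻¹ * (exp (-t) * (2 * r / T)) = 2 * (T ^ 2)⁻¹ * (exp (-t) * (r / √T)) := by
          field_simp
      _ ≤ 2 * (T ^ 2)⁻¹ * (exp (-t) * (1 + t)) := by gcongr
      _ ≤ 2 * (T ^ 2)⁻¹ * (16 * ((1 + t) ^ 2)⁻¹) := by gcongr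
      _ = 32 * ((T + r ^ 2) ^ 2)⁻¹ := by
        have : T + r ^ 2 = T * (1 + t) := by simp only [htdef]; field_simp
        rw [this]; field_simp; norm_num
      _ ≤ _ := by gcongr
  set r := ‖x - a‖
  set r' := ‖x - b‖
  have hr : 0 ≤ r := norm_nonneg _
  have hr' : 0 ≤ r' := norm_nonneg _
  have hrr : |r - r'| ≤ ‖a - b‖ := by
    refine (abs_norm_sub_norm_le (x - a) (x - b)).trans (le_of_eq ?_)
    rw [sub_sub_sub_cancel_left, norm_sub_rev]
  have hb' : ∀ ξ ∈ Set.uIcc r' r, ‖-((T * √T)⁻¹ * (exp (-(ξ ^ 2 / T)) * (2 * ξ / T)))‖ ≤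
      32 * (((1 + r ^ 2) ^ 2)⁻¹ + ((1 + r' ^ 2) ^ 2)⁻¹) := by
    intro ξ hξ
    rw [Set.mem_uIcc] at hξ
    have hξ0 : 0 ≤ ξ := by rcases hξ with h | h <;> linarith [h.1]
    refine (hb ξ hξ0).trans ?_
    gcongr
    rcases hξ with h | h
    · have : ((1 + ξ ^ 2) ^ 2)⁻¹ ≤ ((1 + r' ^ 2) ^ 2)⁻¹ := by gcongr; exact h.1
      have : 0 ≤ ((1 + r ^ 2) ^ 2)⁻¹ := by positivity
      linarith
    · have : ((1 + ξ ^ 2) ^ 2)⁻¹ ≤ ((1 + r ^ 2) ^ 2)⁻¹ := by gcongr; exact h.1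
      have : 0 ≤ ((1 + r' ^ 2) ^ 2)⁻¹ := by positivity
      linarith
  have key := (convex_uIcc r' r).norm_image_sub_le_of_norm_hasDerivWithin_le
    (fun ξ _ => (hd ξ).hasDerivWithinAt) hb' Set.left_mem_uIcc Set.right_mem_uIcc
  rw [Real.norm_eq_abs, Real.norm_eq_abs] at key
  refine key.trans ?_
  calc _ ≤ 32 * (((1 + r ^ 2) ^ 2)⁻¹ + ((1 + r' ^ 2) ^ 2)⁻¹) * ‖a - b‖ := by gcongr
    _ = _ := by ring

theorem integrable_mul_heat {U : E3 → ℝ} (hU : Integrable fun x => U x * ((1 + ‖x‖ ^ 2) ^ 2)⁻¹)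
    {s : ℝ} (hs : 0 < s) (a : E3) : Integrable fun x => U x * heat s (‖x - a‖ ^ 2) := by
  have hm : 0 < min s 1 := lt_min hs one_pos
  have hm1 : min s 1 ≤ 1 := min_le_right _ _
  have h : Integrable fun x => ((1 + ‖x - a‖ ^ 2) ^ 2 * heat s (‖x - a‖ ^ 2)) *
      (U x * ((1 + ‖x - a‖ ^ 2) ^ 2)⁻¹) := by
    refine (integrable_weight_shift hU a).bdd_mul (c := 5 * √s * (min s 1 ^ 2)⁻¹) ?_ ?_
    · have : Measurable fun x : E3 => (1 + ‖x - a‖ ^ 2) ^ 2 * heat s (‖x - a‖ ^ 2) := by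
        unfold heat; fun_prop
      exact this.aestronglyMeasurable
    · refine Eventually.of_forall fun x => ?_
      have hh := heat_nonneg hs (‖x - a‖ ^ 2)
      rw [Real.norm_of_nonneg (by positivity)]
      have h1 := heat_le_weight hs (sq_nonneg ‖x - a‖)
      have h2 := min_one_mul_le (s := s) (sq_nonneg ‖x - a‖)
      calc _ ≤ (1 + ‖x - a‖ ^ 2) ^ 2 * (5 * √s * ((min s 1 * (1 + ‖x - a‖ ^ 2)) ^ 2)⁻¹) := by
            gcongr
            exact h1.trans (by gcongr)
        _ = _ := by field_simp
  refine h.congr (Eventually.of_forall fun x => ?_)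
  field_simp

theorem integrable_mul_heatLine {f : E3 → ℝ} (hf : Integrable f) {s : ℝ} (hs : 0 < s) (a : E3) :
    Integrable fun x => f x * heatLine s (‖x - a‖ ^ 2) := by
  refine hf.mul_bdd (c := (√s)⁻¹ * (min s 1)⁻¹ * π) ?_ ?_
  · exact ((measurable_heatLine s).comp (by fun_prop :
      Measurable fun x : E3 => ‖x - a‖ ^ 2)).aestronglyMeasurable
  · refine Eventually.of_forall fun x => ?_
    rw [Real.norm_of_nonneg (heatLine_nonneg hs _)]
    exact heatLine_le hs (by positivity)

theorem heat_identity_translate {U f : E3 → ℝ}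
    (hU : Integrable fun x => U x * ((1 + ‖x‖ ^ 2) ^ 2)⁻¹)
    (hUm : AEStronglyMeasurable U) (hf : Integrable f)
    (H : ∀ φ : SchwartzMap E3 ℝ, ∫ x, U x * halfLap φ x = 2 * ∫ x, f x * φ x)
    {s : ℝ} (hs : 0 < s) (a b : E3) :
    √π * (∫ x, U x * heat s (‖x - a‖ ^ 2)) - ∫ x, f x * heatLine s (‖x - a‖ ^ 2) =
    √π * (∫ x, U x * heat s (‖x - b‖ ^ 2)) - ∫ x, f x * heatLine s (‖x - b‖ ^ 2) := by
  have hst : ∀ t : ℝ, s ≤ t → ∀ a : E3,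
      √π * (∫ x, U x * heat s (‖x - a‖ ^ 2)) - ∫ x, f x * heatLine s (‖x - a‖ ^ 2) =
      √π * (∫ x, U x * heat t (‖x - a‖ ^ 2)) - ∫ x, f x * heatLine t (‖x - a‖ ^ 2) := by
    intro t ht a
    have ht0 : 0 < t := hs.trans_le ht
    have h := heat_identity hU hUm hf H hs ht a
    simp only [mul_sub] at h
    rw [integral_sub (integrable_mul_heat hU hs a) (integrable_mul_heat hU ht0 a),
      integral_sub (integrable_mul_heatLine hf hs a) (integrable_mul_heatLine hf ht0 a)] at h
    linarith
  have h1 : Tendsto (fun t : ℝ => ∫ x, U x * (heat t (‖x - a‖ ^ 2) - heat t (‖x - b‖ ^ 2)))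
      atTop (nhds 0) := by
    have h0 : (0:ℝ) = ∫ x : E3, (0:ℝ) := by simp
    rw [h0]
    refine tendsto_integral_filter_of_dominated_convergence (fun x => 32 * ‖a - b‖ *
      (‖U x * ((1 + ‖x - a‖ ^ 2) ^ 2)⁻¹‖ + ‖U x * ((1 + ‖x - b‖ ^ 2) ^ 2)⁻¹‖)) ?_ ?_ ?_ ?_
    · filter_upwards [eventually_gt_atTop 0] with t ht
      simp only [mul_sub]
      exact ((integrable_mul_heat hU ht a).sub (integrable_mul_heat hU ht b)).aestronglyMeasurable
    · filter_upwards [eventually_ge_atTop 1] with t ht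
      refine Eventually.of_forall fun x => ?_
      rw [norm_mul, norm_mul, norm_mul, Real.norm_of_nonneg
        (by positivity : 0 ≤ ((1 + ‖x - a‖ ^ 2) ^ 2)⁻¹), Real.norm_of_nonneg
        (by positivity : 0 ≤ ((1 + ‖x - b‖ ^ 2) ^ 2)⁻¹), Real.norm_eq_abs (heat _ _ - _)]
      calc _ ≤ ‖U x‖ * _ := mul_le_mul_of_nonneg_left (abs_heat_sub_le ht x a b) (norm_nonneg _)
        _ = _ := by ring
    · exact ((integrable_weight_shift hU a).norm.add (integrable_weight_shift hU b).norm).const_mul _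
    · refine Eventually.of_forall fun x => ?_
      have hz : ∀ a : E3, Tendsto (fun t : ℝ => heat t (‖x - a‖ ^ 2)) atTop (nhds 0) := by
        intro a
        have hi : Tendsto (fun t : ℝ => t⁻¹) atTop (nhds 0) := tendsto_inv_atTop_zero
        refine squeeze_zero' ?_ ?_ hi
        · filter_upwards [eventually_gt_atTop 0] with t ht
          exact heat_nonneg ht _
        · filter_upwards [eventually_ge_atTop 1] with t ht
          refine (heat_le (by linarith) (by positivity)).trans ?_
          have : 1 ≤ √t := by rw [one_le_sqrt]; exact ht
          gcongr
          nlinarith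
      simpa using ((hz a).sub (hz b)).const_mul (U x)
  have h2 : ∀ a : E3, Tendsto (fun t : ℝ => ∫ x, f x * heatLine t (‖x - a‖ ^ 2))
      atTop (nhds 0) := by
    intro a
    have h0 : Tendsto (fun t : ℝ => (√t)⁻¹ * π * ∫ x, ‖f x‖) atTop (nhds 0) := by
      simpa using ((tendsto_inv_atTop_zero.comp tendsto_sqrt_atTop).mul_const π).mul_const
        (∫ x, ‖f x‖)
    refine squeeze_zero_norm' ?_ h0
    filter_upwards [eventually_ge_atTop 1] with t ht
    have ht0 : 0 < t := by linarith
    rw [← integral_const_mul]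
    refine norm_integral_le_of_norm_le (hf.norm.const_mul _) (Eventually.of_forall fun x => ?_)
    have h3 := heatLine_le ht0 (sq_nonneg ‖x - a‖)
    rw [min_eq_right ht, inv_one, mul_one] at h3
    rw [norm_mul, Real.norm_of_nonneg (heatLine_nonneg ht0 _), mul_comm]
    gcongr
  have h3 := ((h1.const_mul √π).sub (h2 a)).add (h2 b)
  simp only [mul_zero, sub_zero, add_zero] at h3
  have h4 : ∀ᶠ t in atTop,
      √π * (∫ x, U x * (heat t (‖x - a‖ ^ 2) - heat t (‖x - b‖ ^ 2))) -
        (∫ x, f x * heatLine t (‖x - a‖ ^ 2)) + ∫ x, f x * heatLine t (‖x - b‖ ^ 2) =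
      √π * (∫ x, U x * heat s (‖x - a‖ ^ 2)) - (∫ x, f x * heatLine s (‖x - a‖ ^ 2)) -
      (√π * (∫ x, U x * heat s (‖x - b‖ ^ 2)) - ∫ x, f x * heatLine s (‖x - b‖ ^ 2)) := by
    filter_upwards [eventually_ge_atTop s] with t ht
    have ht0 : 0 < t := hs.trans_le ht
    rw [hst t ht a, hst t ht b]
    simp only [mul_sub]
    rw [integral_sub (integrable_mul_heat hU ht0 a) (integrable_mul_heat hU ht0 b)]
    ring
  have h5 := tendsto_nhds_unique (tendsto_const_nhds.congr' (EventuallyEq.symm h4)) h3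
  linarith

theorem integrable_mul_inv_norm_sub_sq {f : E3 → ℝ} (hfc : Continuous f) (hf : Integrable f)
    (a : E3) : Integrable fun x => f x * (‖x - a‖ ^ 2)⁻¹ := by
  obtain ⟨M, hM⟩ := (isCompact_closedBall a 1).exists_bound_of_continuousOn hfc.continuousOn
  have hM0 : 0 ≤ M := (norm_nonneg _).trans (hM a (by simp))
  have h1 := ((integrable_inv_sq_mul_one_add_sq.comp_sub_right a).const_mul (2 * M)).add hf.norm
  refine h1.mono' ?_ ?_
  · exact (hfc.measurable.mul (by fun_prop)).aestronglyMeasurable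
  · refine Eventually.of_forall fun x => ?_
    simp only [Pi.add_apply]
    rw [norm_mul, Real.norm_of_nonneg (by positivity : 0 ≤ (‖x - a‖ ^ 2)⁻¹)]
    by_cases hx : ‖x - a‖ ≤ 1
    · have h2 := hM x (by simpa [dist_eq_norm] using hx)
      have h3 : 0 ≤ ‖f x‖ := norm_nonneg _
      have h4 : (‖x - a‖ ^ 2)⁻¹ ≤ 2 * (‖x - a‖ ^ 2 * (1 + ‖x - a‖ ^ 2))⁻¹ := by
        rw [mul_inv]
        have h5 : (1:ℝ) ≤ 2 * (1 + ‖x - a‖ ^ 2)⁻¹ := by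
          rw [← div_eq_mul_inv, le_div_iff₀ (by positivity)]
          nlinarith [norm_nonneg (x - a)]
        have h6 : 0 ≤ (‖x - a‖ ^ 2)⁻¹ := by positivity
        nlinarith
      calc ‖f x‖ * (‖x - a‖ ^ 2)⁻¹ ≤ M * (2 * (‖x - a‖ ^ 2 * (1 + ‖x - a‖ ^ 2))⁻¹) := by gcongr
        _ ≤ _ := by linarith
    · have h2 : (‖x - a‖ ^ 2)⁻¹ ≤ 1 := inv_le_one_of_one_le₀ (by nlinarith)
      have h3 : 0 ≤ 2 * M * (‖x - a‖ ^ 2 * (1 + ‖x - a‖ ^ 2))⁻¹ := by positivity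
      have h4 : 0 ≤ ‖f x‖ := norm_nonneg _
      nlinarith

theorem heat_inv_sq {c : ℝ} (hc : 0 < c) (ρ : ℝ) :
    heat (c ^ 2)⁻¹ ρ = c ^ 3 * exp (-(c ^ 2 * ρ)) := by
  rw [heat, sqrt_inv, sqrt_sq hc.le]
  congr 1
  · field_simp
  · congr 1; field_simp

theorem integral_gaussian_E3 : ∫ x : E3, exp (-‖x‖ ^ 2) = π * √π := by
  have := GaussianFourier.integral_rexp_neg_mul_sq_norm (V := E3) (b := 1) one_pos
  rw [show (Module.finrank ℝ E3 / 2 : ℝ) = 1 + 1 / 2 by simp; norm_num, div_one,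
    rpow_add pi_pos, rpow_one, ← sqrt_eq_rpow] at this
  rw [← this]
  simp

theorem tendsto_integral_heat_of_integrable {g : E3 → ℝ} (hg : Integrable g) {a : E3}
    (hga : ContinuousAt g a) :
    Tendsto (fun c : ℝ => ∫ x, g x * heat (c ^ 2)⁻¹ (‖x - a‖ ^ 2)) atTop
      (nhds (π * √π * g a)) := by
  have hp : 0 < π * √π := by positivity
  have key := tendsto_integral_comp_smul_smul_of_integrable' (μ := (volume : Measure E3))
    (φ := fun x : E3 => (π * √π)⁻¹ * exp (-‖x‖ ^ 2)) (fun x => by positivity)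
    (by rw [integral_const_mul, integral_gaussian_E3]; field_simp) ?_ hg hga
  · refine (key.const_mul (π * √π)).congr' ?_
    filter_upwards [eventually_gt_atTop 0] with c hc
    rw [← integral_const_mul]
    refine integral_congr_ae (Eventually.of_forall fun x => ?_)
    simp only [finrank_euclideanSpace, Fintype.card_fin, smul_eq_mul]
    rw [heat_inv_sq hc, norm_smul, mul_pow, norm_sub_rev a x, Real.norm_of_nonneg hc.le]
    field_simp
  · have h1 : Tendsto (fun r : ℝ => (π * √π)⁻¹ * (r ^ 3 * exp (-r))) atTop (nhds 0) := by
      simpa using (tendsto_pow_mul_exp_neg_atTop_nhds_zero 3).const_mul (π * √π)⁻¹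
    refine squeeze_zero' (Eventually.of_forall fun x => by positivity) ?_
      (h1.comp tendsto_norm_cobounded_atTop)
    filter_upwards [tendsto_norm_cobounded_atTop.eventually_ge_atTop 1] with x hx
    simp only [finrank_euclideanSpace, Fintype.card_fin, Function.comp]
    calc _ = (π * √π)⁻¹ * (‖x‖ ^ 3 * exp (-‖x‖ ^ 2)) := by ring
      _ ≤ _ := by gcongr; nlinarith

theorem tendsto_integral_heat {U : E3 → ℝ} (hUc : Continuous U)
    (hU : Integrable fun x => U x * ((1 + ‖x‖ ^ 2) ^ 2)⁻¹) (a : E3) :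
    Tendsto (fun c : ℝ => ∫ x, U x * heat (c ^ 2)⁻¹ (‖x - a‖ ^ 2)) atTop
      (nhds (π * √π * U a)) := by
  set B := Metric.ball a 1
  have hB : MeasurableSet B := Metric.isOpen_ball.measurableSet
  have hg : Integrable (B.indicator U) := by
    rw [integrable_indicator_iff hB]
    exact (hUc.continuousOn.integrableOn_compact (isCompact_closedBall a 1)).mono_set
      Metric.ball_subset_closedBall
  have hga : ContinuousAt (B.indicator U) a := by
    refine hUc.continuousAt.congr ?_
    filter_upwards [Metric.isOpen_ball.mem_nhds (Metric.mem_ball_self one_pos)] with x hx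
    exact (Set.indicator_of_mem hx U).symm
  have h1 := tendsto_integral_heat_of_integrable hg hga
  rw [Set.indicator_of_mem (Metric.mem_ball_self one_pos)] at h1
  have h2 : Tendsto (fun c : ℝ => ∫ x, Bᶜ.indicator U x * heat (c ^ 2)⁻¹ (‖x - a‖ ^ 2)) atTop
      (nhds 0) := by
    have h0 : Tendsto (fun c : ℝ => 20 * c⁻¹ * ∫ x, ‖U x * ((1 + ‖x - a‖ ^ 2) ^ 2)⁻¹‖) atTop
        (nhds 0) := by
      have := (tendsto_inv_atTop_zero.const_mul (20:ℝ)).mul_const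
        (∫ x, ‖U x * ((1 + ‖x - a‖ ^ 2) ^ 2)⁻¹‖)
      rwa [mul_zero, zero_mul] at this
    refine squeeze_zero_norm' ?_ h0
    filter_upwards [eventually_gt_atTop 0] with c hc
    rw [← integral_const_mul]
    refine norm_integral_le_of_norm_le ((integrable_weight_shift hU a).norm.const_mul _)
      (Eventually.of_forall fun x => ?_)
    by_cases hx : x ∈ B
    · have : x ∉ Bᶜ := fun h => h hx
      rw [Set.indicator_of_notMem this, zero_mul, norm_zero]
      positivity
    · rw [Set.indicator_of_mem (show x ∈ Bᶜ from hx)]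
      have hr : 1 ≤ ‖x - a‖ := by simpa [B, dist_eq_norm] using hx
      have hs : 0 < (c ^ 2)⁻¹ := by positivity
      have hh := heat_le_weight hs (sq_nonneg ‖x - a‖)
      rw [sqrt_inv, sqrt_sq hc.le] at hh
      rw [norm_mul, norm_mul, Real.norm_of_nonneg (heat_nonneg hs _),
        Real.norm_of_nonneg (by positivity : 0 ≤ ((1 + ‖x - a‖ ^ 2) ^ 2)⁻¹)]
      have h3 : (((c ^ 2)⁻¹ + ‖x - a‖ ^ 2) ^ 2)⁻¹ ≤ 4 * ((1 + ‖x - a‖ ^ 2) ^ 2)⁻¹ := by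
        rw [← div_eq_mul_inv, ← one_div, div_le_div_iff₀ (by positivity) (by positivity)]
        have : (1 + ‖x - a‖ ^ 2) ^ 2 ≤ (2 * ((c ^ 2)⁻¹ + ‖x - a‖ ^ 2)) ^ 2 := by
          gcongr; nlinarith
        nlinarith
      calc ‖U x‖ * heat (c ^ 2)⁻¹ (‖x - a‖ ^ 2)
          ≤ ‖U x‖ * (5 * c⁻¹ * (4 * ((1 + ‖x - a‖ ^ 2) ^ 2)⁻¹)) := by
            gcongr
            exact hh.trans (by gcongr)
        _ = _ := by ring
  have h3 := h1.add h2
  rw [add_zero] at h3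
  refine h3.congr' ?_
  filter_upwards [eventually_gt_atTop 0] with c hc
  have hs : 0 < (c ^ 2)⁻¹ := by positivity
  have hi := integrable_mul_heat hU hs a
  have e1 : ∀ S : Set E3, (fun x => S.indicator U x * heat (c ^ 2)⁻¹ (‖x - a‖ ^ 2)) =
      S.indicator fun x => U x * heat (c ^ 2)⁻¹ (‖x - a‖ ^ 2) := by
    intro S
    funext x
    by_cases hx : x ∈ S <;> simp [hx]
  rw [e1, e1, integral_indicator hB, integral_indicator hB.compl, integral_add_compl hB hi]

theorem tendsto_integral_heatLine {f : E3 → ℝ} (hfc : Continuous f) (hf : Integrable f) (a : E3) :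
    Tendsto (fun c : ℝ => ∫ x, f x * heatLine (c ^ 2)⁻¹ (‖x - a‖ ^ 2)) atTop
      (nhds (∫ x, f x * (‖x - a‖ ^ 2)⁻¹)) := by
  refine tendsto_integral_filter_of_dominated_convergence
    (fun x => 5 * π * ‖f x * (‖x - a‖ ^ 2)⁻¹‖) ?_ ?_ ?_ ?_
  · filter_upwards [eventually_gt_atTop 0] with c hc
    exact (integrable_mul_heatLine hf (by positivity) a).aestronglyMeasurable
  · filter_upwards [eventually_gt_atTop 0] with c hc
    filter_upwards [ae_ne_point a] with x hx
    have hs : 0 < (c ^ 2)⁻¹ := by positivity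
    have hr : 0 < ‖x - a‖ := norm_pos_iff.2 (sub_ne_zero.2 hx)
    rw [norm_mul, norm_mul, Real.norm_of_nonneg (heatLine_nonneg hs _),
      Real.norm_of_nonneg (by positivity : 0 ≤ (‖x - a‖ ^ 2)⁻¹)]
    calc _ ≤ ‖f x‖ * (5 * π * (‖x - a‖ ^ 2)⁻¹) := by
          gcongr; exact heatLine_le_div hs (by positivity)
      _ = _ := by ring
  · exact (integrable_mul_inv_norm_sub_sq hfc hf a).norm.const_mul _
  · filter_upwards [ae_ne_point a] with x hx
    have hr : 0 < ‖x - a‖ := norm_pos_iff.2 (sub_ne_zero.2 hx)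
    exact (tendsto_heatLine (by positivity)).const_mul _

theorem exists_potential_add_const {U f : E3 → ℝ} (hUc : Continuous U)
    (hU : Integrable fun x => U x * ((1 + ‖x‖ ^ 2) ^ 2)⁻¹) (hfc : Continuous f)
    (hf : Integrable f)
    (H : ∀ φ : SchwartzMap E3 ℝ, ∫ x, U x * halfLap φ x = 2 * ∫ x, f x * φ x) :
    ∃ c : ℝ, ∀ a, U a = 1 / π ^ 2 * (∫ x, f x * (‖x - a‖ ^ 2)⁻¹) + c := by
  have key : ∀ a b : E3, √π * (π * √π * U a) - ∫ x, f x * (‖x - a‖ ^ 2)⁻¹ =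
      √π * (π * √π * U b) - ∫ x, f x * (‖x - b‖ ^ 2)⁻¹ := by
    intro a b
    have ha := ((tendsto_integral_heat hUc hU a).const_mul √π).sub
      (tendsto_integral_heatLine hfc hf a)
    have hb := ((tendsto_integral_heat hUc hU b).const_mul √π).sub
      (tendsto_integral_heatLine hfc hf b)
    refine tendsto_nhds_unique ha (hb.congr' ?_)
    filter_upwards [eventually_gt_atTop 0] with c hc
    exact heat_identity_translate hU hUc.aestronglyMeasurable hf H (by positivity) b a
  refine ⟨U 0 - 1 / π ^ 2 * ∫ x, f x * (‖x - 0‖ ^ 2)⁻¹, fun a => ?_⟩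
  have h := key a 0
  have hs : ∀ w : ℝ, √π * (π * √π * w) = π ^ 2 * w := by
    intro w
    have := mul_self_sqrt pi_pos.le
    linear_combination π * w * this
  rw [hs, hs] at h
  have hp : π ^ 2 ≠ 0 := by positivity
  generalize ∫ x, f x * (‖x - a‖ ^ 2)⁻¹ = I at h ⊢
  generalize ∫ x, f x * (‖x - 0‖ ^ 2)⁻¹ = J at h ⊢
  field_simp
  linarith

/-! ### Solid means -/

/-- The radial kernel `(1 - |z|²)₊`. -/
noncomputable def cap (z : E3) : ℝ := max 0 (1 - ‖z‖ ^ 2)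

/-- The radial kernel `(1 - |z|²)₊² / 4`, whose gradient is `-cap z • z`. -/
noncomputable def capSq (z : E3) : ℝ := (cap z) ^ 2 / 4

theorem continuous_cap : Continuous cap := by unfold cap; fun_prop

theorem continuous_capSq : Continuous capSq := by
  have := continuous_cap
  unfold capSq; fun_prop

theorem cap_nonneg (z : E3) : 0 ≤ cap z := le_max_left _ _

theorem capSq_nonneg (z : E3) : 0 ≤ capSq z := by unfold capSq; positivity

theorem cap_eq_zero {z : E3} (hz : z ∉ Metric.closedBall (0 : E3) 1) : cap z = 0 := by
  have : 1 < ‖z‖ := by simpa using hz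
  exact max_eq_left (by nlinarith)

theorem capSq_eq_zero {z : E3} (hz : z ∉ Metric.closedBall (0 : E3) 1) : capSq z = 0 := by
  simp [capSq, cap_eq_zero hz]

theorem hasCompactSupport_cap : HasCompactSupport cap :=
  HasCompactSupport.intro (isCompact_closedBall 0 1) fun _ hz => cap_eq_zero hz

theorem hasCompactSupport_capSq : HasCompactSupport capSq :=
  HasCompactSupport.intro (isCompact_closedBall 0 1) fun _ hz => capSq_eq_zero hz

theorem integrable_cap_mul {g : E3 → ℝ} (hg : Continuous g) : Integrable fun z => cap z * g z :=
  (continuous_cap.mul hg).integrable_of_hasCompactSupport (hasCompactSupport_cap.mul_right)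

theorem integrable_capSq_mul {g : E3 → ℝ} (hg : Continuous g) :
    Integrable fun z => capSq z * g z :=
  (continuous_capSq.mul hg).integrable_of_hasCompactSupport (hasCompactSupport_capSq.mul_right)

theorem hasDerivAt_max_zero_sq (t : ℝ) :
    HasDerivAt (fun t : ℝ => (max 0 t) ^ 2) (2 * max 0 t) t := by
  rcases lt_trichotomy t 0 with h | rfl | h
  · rw [max_eq_left h.le, mul_zero]
    refine (hasDerivAt_const t (0:ℝ)).congr_of_eventuallyEq ?_
    filter_upwards [eventually_lt_nhds h] with s hs
    rw [max_eq_left hs.le]; norm_num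
  · rw [max_self, mul_zero, hasDerivAt_iff_isLittleO_nhds_zero]
    have h1 : (fun h : ℝ => h ^ 2) =o[nhds 0] fun h => h := by
      simpa using Asymptotics.isLittleO_pow_id (𝕜 := ℝ) one_lt_two
    refine Asymptotics.IsBigO.trans_isLittleO ?_ h1
    refine Asymptotics.IsBigO.of_bound 1 (Eventually.of_forall fun s => ?_)
    rw [Real.norm_eq_abs, Real.norm_of_nonneg (sq_nonneg s)]
    simp only [zero_add, max_self, smul_zero, sub_zero, ne_eq, OfNat.ofNat_ne_zero,
      not_false_eq_true, zero_pow, one_mul]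
    rcases le_total 0 s with h | h
    · rw [max_eq_right h, abs_of_nonneg (sq_nonneg s)]
    · rw [max_eq_left h]; simp; positivity
  · rw [max_eq_right h.le]
    have h2 : HasDerivAt (fun t : ℝ => t ^ 2) (2 * t) t := by simpa using hasDerivAt_pow 2 t
    refine h2.congr_of_eventuallyEq ?_
    filter_upwards [eventually_gt_nhds h] with s hs
    rw [max_eq_right hs.le]

theorem hasFDerivAt_capSq (z : E3) :
    HasFDerivAt capSq (-(cap z) • innerSL ℝ z) z := by
  have h1 : HasFDerivAt (fun z : E3 => 1 - ‖z‖ ^ 2) (-(2 • innerSL ℝ z)) z := by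
    have := ((hasStrictFDerivAt_norm_sq z).hasFDerivAt).const_sub 1
    simpa using this
  have h2 := (hasDerivAt_max_zero_sq (1 - ‖z‖ ^ 2)).comp_hasFDerivAt z h1
  have h3 := h2.mul_const (1 / 4 : ℝ)
  refine (h3.congr_fderiv ?_).congr_of_eventuallyEq (Eventually.of_forall fun w => ?_)
  · ext w
    simp only [cap, smul_apply, neg_apply, smul_eq_mul,
      innerSL_apply_apply, nsmul_eq_mul, Nat.cast_ofNat]
    ring
  · simp [capSq, cap]; ring

theorem integral_cap_mul_fderiv {F : E3 → ℝ} (hF : ContDiff ℝ 2 F) (x : E3) (ρ : ℝ) :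
    ∫ z, cap z * fderiv ℝ F (x + ρ • z) z = ρ * ∫ z, capSq z * lap F (x + ρ • z) := by
  have hF1 : ContDiff ℝ 1 (fun y => fderiv ℝ F y) := hF.fderiv_right (by norm_num)
  have hd : ∀ i, ContDiff ℝ 1 fun y => fderiv ℝ F y (EuclideanSpace.single i (1:ℝ)) := fun i =>
    hF1.clm_apply contDiff_const
  have hdd : ∀ i, Continuous fun y => fderiv ℝ (fun y => fderiv ℝ F y
      (EuclideanSpace.single i (1:ℝ))) y (EuclideanSpace.single i (1:ℝ)) := fun i =>
    ((hd i).continuous_fderiv (by norm_num)).clm_apply continuous_const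
  have hA : Continuous fun z : E3 => x + ρ • z := by fun_prop
  have step : ∀ i, ∫ z, cap z * (z i * fderiv ℝ F (x + ρ • z) (EuclideanSpace.single i (1:ℝ))) =
      ∫ z, ρ * (capSq z * fderiv ℝ (fun y => fderiv ℝ F y (EuclideanSpace.single i (1:ℝ)))
        (x + ρ • z) (EuclideanSpace.single i (1:ℝ))) := by
    intro i
    set e : E3 := EuclideanSpace.single i (1:ℝ)
    set g : E3 → ℝ := fun z => fderiv ℝ F (x + ρ • z) e
    have hg : ∀ z, HasFDerivAt g (ρ • fderiv ℝ (fun y => fderiv ℝ F y e) (x + ρ • z)) z := by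
      intro z
      have h1 : HasFDerivAt (fun z : E3 => x + ρ • z) (ρ • ContinuousLinearMap.id ℝ E3) z :=
        ((hasFDerivAt_id z).const_smul ρ).const_add x
      have h2 := (((hd i).differentiable (by norm_num)) (x + ρ • z)).hasFDerivAt.comp z h1
      refine h2.congr_fderiv ?_
      ext w; simp [e]
    have hgc : Continuous g := (hd i).continuous.comp hA
    have hgd : ∀ z, fderiv ℝ g z e = ρ * fderiv ℝ (fun y => fderiv ℝ F y e) (x + ρ • z) e := by
      intro z; rw [(hg z).fderiv]; simp
    have hψd : ∀ z, fderiv ℝ capSq z e = -(cap z * z i) := by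
      intro z
      rw [(hasFDerivAt_capSq z).fderiv]
      simp [e, PiLp.inner_apply]
    have key := integral_mul_fderiv_eq_neg_fderiv_mul_of_integrable (μ := (volume : Measure E3))
      (f := capSq) (g := g) (v := e) ?_ ?_ (integrable_capSq_mul hgc)
      (fun z _ => (hasFDerivAt_capSq z).differentiableAt) (fun z _ => (hg z).differentiableAt)
    · simp only [hgd, hψd] at key
      calc _ = -∫ z, -(cap z * z i) * g z := by
            rw [← integral_neg]; congr 1; funext z; ring
        _ = _ := by rw [← key]; congr 1; funext z; ring
    · simp only [hψd]
      refine (integrable_cap_mul (g := fun z => -(z i * g z)) (by fun_prop)).congr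
        (Eventually.of_forall fun z => ?_)
      simp only; ring
    · simp only [hgd]
      exact integrable_capSq_mul (by have := (hdd i).comp hA; fun_prop)
  have e1 : ∀ z : E3, cap z * fderiv ℝ F (x + ρ • z) z =
      ∑ i, cap z * (z i * fderiv ℝ F (x + ρ • z) (EuclideanSpace.single i (1:ℝ))) := by
    intro z
    rw [← Finset.mul_sum]
    congr 1
    generalize fderiv ℝ F (x + ρ • z) = L
    conv_lhs => rw [← (EuclideanSpace.basisFun (Fin 3) ℝ).sum_repr z, map_sum]
    simp
  simp only [e1]
  rw [integral_finsetSum]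
  · simp only [step]
    rw [← integral_finsetSum]
    · rw [← integral_const_mul]
      congr 1; funext z
      rw [lap, Finset.mul_sum, Finset.mul_sum]
    · intro i _
      exact (integrable_capSq_mul ((hdd i).comp hA)).const_mul ρ
  · intro i _
    have := (hd i).continuous.comp hA
    exact integrable_cap_mul (g := fun z => z i * _) (by fun_prop)

theorem continuous_lap {F : E3 → ℝ} (hF : ContDiff ℝ 2 F) : Continuous (lap F) := by
  have hF1 : ContDiff ℝ 1 (fun y => fderiv ℝ F y) := hF.fderiv_right (by norm_num)
  unfold lap
  refine continuous_finsetSum _ fun i _ => ?_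
  exact ((hF1.clm_apply contDiff_const).continuous_fderiv (by norm_num)).clm_apply
    continuous_const

theorem continuous_integral_capSq_mul {g : E3 → ℝ} (hg : Continuous g) (x : E3) :
    Continuous fun ρ : ℝ => ∫ z, capSq z * g (x + ρ • z) := by
  rw [← continuousOn_univ]
  refine continuousOn_integral_of_compact_support (isCompact_closedBall (0 : E3) 1) ?_ ?_
  · have := continuous_capSq
    refine Continuous.continuousOn ?_
    change Continuous fun p : ℝ × E3 => capSq p.2 * g (x + p.1 • p.2)
    fun_prop
  · intro p z _ hz
    rw [capSq_eq_zero hz, zero_mul]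

theorem hasDerivAt_integral_cap_mul {F : E3 → ℝ} (hF : ContDiff ℝ 2 F) (x : E3) (ρ : ℝ) :
    HasDerivAt (fun ρ : ℝ => ∫ z, cap z * F (x + ρ • z))
      (ρ * ∫ z, capSq z * lap F (x + ρ • z)) ρ := by
  rw [← integral_cap_mul_fderiv hF x ρ]
  have hF1 : ContDiff ℝ 1 (fun y => fderiv ℝ F y) := hF.fderiv_right (by norm_num)
  have hF2 := hF1.continuous
  obtain ⟨M, hM⟩ := (isCompact_closedBall x (|ρ| + 1)).exists_bound_of_continuousOn
    hF2.continuousOn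
  have hc : ∀ ρ : ℝ, Continuous fun z : E3 => F (x + ρ • z) := fun ρ =>
    hF.continuous.comp (by fun_prop)
  have hc' : Continuous fun z : E3 => fderiv ℝ F (x + ρ • z) z :=
    (hF2.comp (by fun_prop)).clm_apply continuous_id
  refine (hasDerivAt_integral_of_dominated_loc_of_deriv_le (μ := (volume : Measure E3))
    (F := fun (ρ : ℝ) z => cap z * F (x + ρ • z))
    (F' := fun (ρ : ℝ) z => cap z * fderiv ℝ F (x + ρ • z) z)
    (bound := fun z => cap z * M) (Metric.ball_mem_nhds ρ one_pos) ?_ ?_ ?_ ?_ ?_ ?_).2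
  · exact Eventually.of_forall fun r => (integrable_cap_mul (hc r)).aestronglyMeasurable
  · exact integrable_cap_mul (hc ρ)
  · exact (integrable_cap_mul hc').aestronglyMeasurable
  · refine Eventually.of_forall fun z r hr => ?_
    by_cases hz : z ∈ Metric.closedBall (0 : E3) 1
    · have hz1 : ‖z‖ ≤ 1 := by simpa using hz
      have hr1 : |r| ≤ |ρ| + 1 := by
        have h1 : |r - ρ| < 1 := by simpa [Real.dist_eq] using hr
        have h2 := abs_add_le (r - ρ) ρ
        rw [sub_add_cancel] at h2
        linarith
      have hm := hM (x + r • z) (by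
        simp only [Metric.mem_closedBall, dist_self_add_left, norm_smul, Real.norm_eq_abs]
        nlinarith [abs_nonneg r, norm_nonneg z])
      rw [norm_mul, Real.norm_of_nonneg (cap_nonneg z)]
      have h3 := (fderiv ℝ F (x + r • z)).le_opNorm z
      have h4 : 0 ≤ ‖fderiv ℝ F (x + r • z)‖ := norm_nonneg _
      gcongr
      · exact cap_nonneg z
      · nlinarith [norm_nonneg z]
    · simp [cap_eq_zero hz]
  · exact integrable_cap_mul continuous_const
  · refine Eventually.of_forall fun z r _ => ?_
    have h1 : HasDerivAt (fun r : ℝ => x + r • z) z r := by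
      simpa using ((hasDerivAt_id r).smul_const z).const_add x
    exact (((hF.differentiable (by norm_num)) (x + r • z)).hasFDerivAt.comp_hasDerivAt r
      h1).const_mul (cap z)

theorem integral_cap_mul_sub {F : E3 → ℝ} (hF : ContDiff ℝ 2 F) (x : E3) (R : ℝ) :
    (∫ z, cap z * F (x + R • z)) - (∫ z, cap z) * F x =
      ∫ ρ in (0:ℝ)..R, ρ * ∫ z, capSq z * lap F (x + ρ • z) := by
  rw [intervalIntegral.integral_eq_sub_of_hasDerivAt
    (fun ρ _ => hasDerivAt_integral_cap_mul hF x ρ)]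
  · simp [integral_mul_const]
  · exact (continuous_id.mul (continuous_integral_capSq_mul (continuous_lap hF)
      x)).intervalIntegrable _ _

/-! ### Solid means of the logarithmic potential -/

/-- The regularised logarithm `½ log (ε² + |b|²)`. -/
noncomputable def logReg (ε : ℝ) (b : E3) : ℝ := 1 / 2 * log (ε ^ 2 + ‖b‖ ^ 2)

/-- The Laplacian of `logReg ε`. -/
noncomputable def lapLogReg (ε : ℝ) (b : E3) : ℝ :=
  (3 * ε ^ 2 + ‖b‖ ^ 2) / (ε ^ 2 + ‖b‖ ^ 2) ^ 2

theorem contDiff_logReg_sub {ε : ℝ} (hε : 0 < ε) (y : E3) :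
    ContDiff ℝ 2 fun x => logReg ε (x - y) := by
  unfold logReg
  refine contDiff_const.mul (ContDiff.log ?_ fun x => by positivity)
  exact contDiff_const.add ((contDiff_id.sub contDiff_const).norm_sq ℝ)

theorem lap_logReg_sub {ε : ℝ} (hε : 0 < ε) (y x : E3) :
    lap (fun x => logReg ε (x - y)) x = lapLogReg ε (x - y) := by
  have hD : ∀ x : E3, 0 < ε ^ 2 + ‖x - y‖ ^ 2 := fun x => by positivity
  have hd0 : ∀ x, HasFDerivAt (fun x : E3 => ε ^ 2 + ‖x - y‖ ^ 2) (2 • innerSL ℝ (x - y)) x := by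
    intro x
    have h1 : HasFDerivAt (fun x : E3 => x - y) (ContinuousLinearMap.id ℝ E3) x :=
      (hasFDerivAt_id x).sub_const y
    have h2 := (hasStrictFDerivAt_norm_sq (x - y)).hasFDerivAt.comp x h1
    exact (h2.const_add (ε ^ 2)).congr_fderiv (by ext; simp)
  have hd1 : ∀ x, HasFDerivAt (fun x => logReg ε (x - y))
      ((ε ^ 2 + ‖x - y‖ ^ 2)⁻¹ • innerSL ℝ (x - y)) x := by
    intro x
    have h := ((hd0 x).log (hD x).ne').const_mul (1 / 2 : ℝ)
    refine h.congr_fderiv ?_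
    ext w
    simp only [smul_apply, smul_eq_mul, nsmul_eq_mul]
    push_cast
    ring
  have hd2 : ∀ i : Fin 3, fderiv ℝ (fun x => fderiv ℝ (fun x => logReg ε (x - y)) x
      (EuclideanSpace.single i 1)) x (EuclideanSpace.single i 1) =
      (ε ^ 2 + ‖x - y‖ ^ 2)⁻¹ - 2 * (x i - y i) ^ 2 / (ε ^ 2 + ‖x - y‖ ^ 2) ^ 2 := by
    intro i
    have e1 : (fun x => fderiv ℝ (fun x => logReg ε (x - y)) x (EuclideanSpace.single i (1:ℝ))) =
        fun x => (ε ^ 2 + ‖x - y‖ ^ 2)⁻¹ * (x i - y i) := by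
      funext x
      rw [(hd1 x).fderiv]
      simp [PiLp.inner_apply]
    rw [e1]
    have h1 : HasFDerivAt (fun x : E3 => x i - y i) (EuclideanSpace.proj i : E3 →L[ℝ] ℝ) x :=
      (EuclideanSpace.proj i : E3 →L[ℝ] ℝ).hasFDerivAt.sub_const (y i)
    have h2 := ((hasDerivAt_inv (hD x).ne').comp_hasFDerivAt x (hd0 x)).mul h1
    have h3 : HasFDerivAt (fun x => (ε ^ 2 + ‖x - y‖ ^ 2)⁻¹ * (x i - y i)) _ x := h2
    rw [h3.fderiv]
    simp [PiLp.inner_apply]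
    ring
  rw [lap]
  simp only [hd2]
  rw [Finset.sum_sub_distrib, ← Finset.sum_div, ← Finset.mul_sum]
  have h3 : ∑ i, (x i - y i) ^ 2 = ‖x - y‖ ^ 2 := by
    rw [EuclideanSpace.real_norm_sq_eq]; simp
  rw [h3, lapLogReg]
  have := (hD x).ne'
  simp only [Finset.sum_const, Finset.card_univ, Fintype.card_fin, nsmul_eq_mul]
  field_simp
  push_cast
  ring

theorem lapLogReg_nonneg (ε : ℝ) (b : E3) : 0 ≤ lapLogReg ε b := by
  unfold lapLogReg; positivity

theorem lapLogReg_le (ε : ℝ) {b : E3} (hb : b ≠ 0) : lapLogReg ε b ≤ 3 * (‖b‖ ^ 2)⁻¹ := by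
  have hb' : 0 < ‖b‖ := norm_pos_iff.2 hb
  rw [lapLogReg, ← div_eq_mul_inv, div_le_div_iff₀ (by positivity) (by positivity)]
  nlinarith [mul_nonneg (sq_nonneg ε) (sq_nonneg ‖b‖), sq_nonneg (ε ^ 2), sq_nonneg (‖b‖ ^ 2)]

theorem lapLogReg_le_const {ε : ℝ} (hε : 0 < ε) (b : E3) : lapLogReg ε b ≤ 3 * (ε ^ 2)⁻¹ := by
  rw [lapLogReg, ← div_eq_mul_inv, div_le_div_iff₀ (by positivity) (by positivity)]
  nlinarith [mul_nonneg (sq_nonneg ε) (sq_nonneg ‖b‖), sq_nonneg (ε ^ 2), sq_nonneg (‖b‖ ^ 2)]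

theorem continuous_lapLogReg {ε : ℝ} (hε : 0 < ε) : Continuous (lapLogReg ε) := by
  unfold lapLogReg
  exact Continuous.div (by fun_prop) (by fun_prop) fun b => by positivity

theorem continuous_logReg {ε : ℝ} (hε : 0 < ε) : Continuous (logReg ε) := by
  unfold logReg
  exact continuous_const.mul (Continuous.log (by fun_prop) fun b => by positivity)

theorem tendsto_lapLogReg {b : E3} (hb : b ≠ 0) :
    Tendsto (fun ε => lapLogReg ε b) (nhdsWithin 0 (Set.Ioi 0)) (nhds (‖b‖ ^ 2)⁻¹) := by
  have hb' : 0 < ‖b‖ := norm_pos_iff.2 hb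
  have h : ContinuousAt (fun ε => lapLogReg ε b) 0 := by
    unfold lapLogReg
    exact ContinuousAt.div (by fun_prop) (by fun_prop) (by positivity)
  have h2 : lapLogReg 0 b = (‖b‖ ^ 2)⁻¹ := by rw [lapLogReg]; field_simp; simp; ring
  rw [← h2]
  exact h.tendsto.mono_left nhdsWithin_le_nhds

theorem tendsto_logReg {b : E3} (hb : b ≠ 0) :
    Tendsto (fun ε => logReg ε b) (nhdsWithin 0 (Set.Ioi 0)) (nhds (log ‖b‖)) := by
  have hb' : 0 < ‖b‖ := norm_pos_iff.2 hb
  have h : ContinuousAt (fun ε => logReg ε b) 0 := by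
    unfold logReg
    exact continuousAt_const.mul (ContinuousAt.log (by fun_prop) (by positivity))
  have h2 : logReg 0 b = log ‖b‖ := by simp [logReg]
  rw [← h2]
  exact h.tendsto.mono_left nhdsWithin_le_nhds

theorem log_norm_le_logReg (ε : ℝ) {b : E3} (hb : b ≠ 0) : log ‖b‖ ≤ logReg ε b := by
  have hb' : 0 < ‖b‖ := norm_pos_iff.2 hb
  have : log (‖b‖ ^ 2) ≤ log (ε ^ 2 + ‖b‖ ^ 2) :=
    log_le_log (by positivity) (by nlinarith [sq_nonneg ε])
  rw [log_pow] at this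
  push_cast at this
  rw [logReg]; linarith

theorem logReg_le_logReg_one {ε : ℝ} (hε : 0 < ε) (hε1 : ε ≤ 1) (b : E3) :
    logReg ε b ≤ logReg 1 b := by
  unfold logReg
  gcongr

theorem logReg_one_sub_logReg_le {ε : ℝ} (hε : 0 < ε) (hε1 : ε ≤ 1) (b : E3) :
    logReg 1 b - logReg ε b ≤ -log ε := by
  have h : log (ε ^ 2 * (1 ^ 2 + ‖b‖ ^ 2)) ≤ log (ε ^ 2 + ‖b‖ ^ 2) := by
    refine log_le_log (by positivity) ?_
    have : ε ^ 2 ≤ 1 := by nlinarith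
    nlinarith [sq_nonneg ‖b‖]
  rw [log_mul (by positivity) (by positivity), log_pow] at h
  push_cast at h
  unfold logReg
  generalize log (1 ^ 2 + ‖b‖ ^ 2) = A at h ⊢
  generalize log (ε ^ 2 + ‖b‖ ^ 2) = B at h ⊢
  linarith

theorem logReg_one_le {b : E3} (hb : b ≠ 0) : logReg 1 b ≤ log ‖b‖ + 1 / 2 * (‖b‖ ^ 2)⁻¹ := by
  have hb' : 0 < ‖b‖ := norm_pos_iff.2 hb
  have h : log (1 ^ 2 + ‖b‖ ^ 2) = log (‖b‖ ^ 2) + log (1 + (‖b‖ ^ 2)⁻¹) := by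
    rw [← log_mul (by positivity) (by positivity)]
    congr 1; field_simp; ring
  have h2 : log (1 + (‖b‖ ^ 2)⁻¹) ≤ (‖b‖ ^ 2)⁻¹ := by
    have := log_le_sub_one_of_pos (by positivity : 0 < 1 + (‖b‖ ^ 2)⁻¹)
    linarith
  rw [log_pow] at h
  push_cast at h
  unfold logReg; linarith

theorem abs_log_norm_sub_logReg_one_le (x : E3) {y : E3} (hy : y ≠ 0) :
    |log ‖y‖ - logReg 1 (x - y)| ≤
      1 / 2 * log (2 * (1 + ‖x‖ ^ 2)) + 1 / 2 * (‖y‖ ^ 2)⁻¹ := by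
  have h1 : logReg 1 y ≤ 1 / 2 * log (2 * (1 + ‖x‖ ^ 2)) + logReg 1 (x - y) := by
    unfold logReg
    rw [← mul_add, ← log_mul (by positivity) (by positivity)]
    gcongr
    have := one_add_norm_sq_le_shift y x
    rw [norm_sub_rev y x] at this
    simpa using this
  have h2 : logReg 1 (x - y) ≤ 1 / 2 * log (2 * (1 + ‖x‖ ^ 2)) + logReg 1 y := by
    unfold logReg
    rw [← mul_add, ← log_mul (by positivity) (by positivity)]
    gcongr
    have := one_add_norm_sq_le_shift (x - y) x
    simpa using this
  have h3 := logReg_one_le hy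
  have h4 := log_norm_le_logReg 1 hy
  have h5 : 0 ≤ (‖y‖ ^ 2)⁻¹ := by positivity
  rw [abs_le]; constructor <;> linarith

theorem integral_cap_mul_logReg {ε : ℝ} (hε : 0 < ε) (k : ℝ) (y x : E3) (R : ℝ) :
    (∫ z, cap z * (k - logReg ε (x + R • z - y))) - (∫ z, cap z) * (k - logReg ε (x - y)) =
      -∫ ρ in (0:ℝ)..R, ρ * ∫ z, capSq z * lapLogReg ε (x + ρ • z - y) := by
  have h := integral_cap_mul_sub (contDiff_logReg_sub hε y) x R
  simp only [lap_logReg_sub hε] at h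
  rw [← h]
  have hc : Continuous fun z : E3 => logReg ε (x + R • z - y) :=
    (continuous_logReg hε).comp (by fun_prop)
  simp only [mul_sub]
  rw [integral_sub (integrable_cap_mul continuous_const) (integrable_cap_mul hc),
    integral_mul_const]
  ring

/-- `∫ log (|y| / |x - y|) f(y) dy`. -/
noncomputable def logPot (f : E3 → ℝ) (x : E3) : ℝ := ∫ y, log (‖y‖ / ‖x - y‖) * f y

/-- `∫ f(y) / |y - x|² dy`. -/
noncomputable def sqPot (f : E3 → ℝ) (x : E3) : ℝ := ∫ y, f y * (‖y - x‖ ^ 2)⁻¹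

/-- The regularisation of `logPot` by means of `logReg`. -/
noncomputable def logPotReg (f : E3 → ℝ) (ε : ℝ) (x : E3) : ℝ :=
  ∫ y, f y * (log ‖y‖ - logReg ε (x - y))

/-- The regularisation of `sqPot` by means of `lapLogReg`. -/
noncomputable def sqPotReg (f : E3 → ℝ) (ε : ℝ) (x : E3) : ℝ :=
  ∫ y, f y * lapLogReg ε (x - y)

theorem measurable_logReg_kernel {ε : ℝ} (hε : 0 < ε) :
    Measurable fun p : E3 × E3 => log ‖p.2‖ - logReg ε (p.1 - p.2) :=
  (measurable_snd.norm.log).sub ((continuous_logReg hε).measurable.comp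
    (measurable_fst.sub measurable_snd))

theorem measurable_lapLogReg_kernel {ε : ℝ} (hε : 0 < ε) :
    Measurable fun p : E3 × E3 => lapLogReg ε (p.1 - p.2) :=
  (continuous_lapLogReg hε).measurable.comp (measurable_fst.sub measurable_snd)

theorem measurable_logPotReg {f : E3 → ℝ} (hfc : Continuous f) {ε : ℝ} (hε : 0 < ε) :
    Measurable (logPotReg f ε) := by
  have h : Measurable fun p : E3 × E3 => f p.2 * (log ‖p.2‖ - logReg ε (p.1 - p.2)) :=
    (hfc.measurable.comp measurable_snd).mul (measurable_logReg_kernel hε)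
  exact h.stronglyMeasurable.integral_prod_right'.measurable

theorem measurable_sqPotReg {f : E3 → ℝ} (hfc : Continuous f) {ε : ℝ} (hε : 0 < ε) :
    Measurable (sqPotReg f ε) := by
  have h : Measurable fun p : E3 × E3 => f p.2 * lapLogReg ε (p.1 - p.2) :=
    (hfc.measurable.comp measurable_snd).mul (measurable_lapLogReg_kernel hε)
  exact h.stronglyMeasurable.integral_prod_right'.measurable

theorem measurable_logPot {f : E3 → ℝ} (hfc : Continuous f) : Measurable (logPot f) := by
  have h : Measurable fun p : E3 × E3 => log (‖p.2‖ / ‖p.1 - p.2‖) * f p.2 :=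
    ((measurable_snd.norm.div (measurable_fst.sub measurable_snd).norm).log).mul
      (hfc.measurable.comp measurable_snd)
  exact h.stronglyMeasurable.integral_prod_right'.measurable

theorem integrable_mul_inv_norm_sq {f : E3 → ℝ} (hfc : Continuous f) (hf : Integrable f) :
    Integrable fun y => f y * (‖y‖ ^ 2)⁻¹ := by
  simpa using integrable_mul_inv_norm_sub_sq hfc hf 0

theorem abs_logReg_kernel_le {ε : ℝ} (hε : 0 < ε) (hε1 : ε ≤ 1) (x : E3) {y : E3} (hy : y ≠ 0) :
    |log ‖y‖ - logReg ε (x - y)| ≤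
      1 / 2 * log (2 * (1 + ‖x‖ ^ 2)) + 1 / 2 * (‖y‖ ^ 2)⁻¹ - log ε := by
  have h1 := abs_log_norm_sub_logReg_one_le x hy
  have h2 := logReg_one_sub_logReg_le hε hε1 (x - y)
  have h3 := logReg_le_logReg_one hε hε1 (x - y)
  rw [abs_le] at h1 ⊢
  constructor <;> linarith

theorem abs_logReg_kernel_le' {ε : ℝ} (hε : 0 < ε) (hε1 : ε ≤ 1) {x y : E3} (hy : y ≠ 0)
    (hxy : y ≠ x) : |log ‖y‖ - logReg ε (x - y)| ≤
      1 / 2 * log (2 * (1 + ‖x‖ ^ 2)) + 1 / 2 * (‖y‖ ^ 2)⁻¹ + 1 / 2 * (‖y - x‖ ^ 2)⁻¹ := by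
  have h1 := abs_log_norm_sub_logReg_one_le x hy
  have h0 : x - y ≠ 0 := sub_ne_zero.2 hxy.symm
  have h2 := logReg_one_le h0
  have h3 := logReg_le_logReg_one hε hε1 (x - y)
  have h4 := log_norm_le_logReg ε h0
  rw [norm_sub_rev x y] at h2 h4
  rw [abs_le] at h1 ⊢
  constructor <;> linarith

theorem integrable_logReg_bound {f : E3 → ℝ} (hfc : Continuous f) (hf : Integrable f) (k : ℝ) :
    Integrable fun y => f y * (k + 1 / 2 * (‖y‖ ^ 2)⁻¹) := by
  refine ((hf.mul_const k).add ((integrable_mul_inv_norm_sq hfc hf).mul_const (1 / 2))).congr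
    (Eventually.of_forall fun y => ?_)
  simp only [Pi.add_apply]; ring

theorem integrable_logReg_bound' {f : E3 → ℝ} (hfc : Continuous f) (hf : Integrable f) (k : ℝ)
    (x : E3) :
    Integrable fun y => f y * (k + 1 / 2 * (‖y‖ ^ 2)⁻¹ + 1 / 2 * (‖y - x‖ ^ 2)⁻¹) := by
  refine ((integrable_logReg_bound hfc hf k).add
    ((integrable_mul_inv_norm_sub_sq hfc hf x).mul_const (1 / 2))).congr
    (Eventually.of_forall fun y => ?_)
  simp only [Pi.add_apply]; ring

theorem integrable_logReg_kernel {f : E3 → ℝ} (hfc : Continuous f) (hf : Integrable f)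
    (hf0 : ∀ y, 0 ≤ f y) {ε : ℝ} (hε : 0 < ε) (hε1 : ε ≤ 1) (x : E3) :
    Integrable fun y => f y * (log ‖y‖ - logReg ε (x - y)) := by
  refine (integrable_logReg_bound' hfc hf (1 / 2 * log (2 * (1 + ‖x‖ ^ 2))) x).mono' ?_ ?_
  · exact (hfc.measurable.mul ((measurable_logReg_kernel hε).comp
      (f := fun y => (x, y)) (by fun_prop))).aestronglyMeasurable
  · filter_upwards [ae_ne_point 0, ae_ne_point x] with y hy hyx
    rw [norm_mul, Real.norm_of_nonneg (hf0 y), Real.norm_eq_abs]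
    exact mul_le_mul_of_nonneg_left (abs_logReg_kernel_le' hε hε1 hy hyx) (hf0 y)

theorem integral_cap_mul_logPotReg {f : E3 → ℝ} (hfc : Continuous f) (hf : Integrable f)
    (hf0 : ∀ y, 0 ≤ f y) {ε : ℝ} (hε : 0 < ε) (hε1 : ε ≤ 1) (x : E3) {R : ℝ} (hR : 0 ≤ R) :
    (∫ z, cap z * logPotReg f ε (x + R • z)) - (∫ z, cap z) * logPotReg f ε x =
      -∫ ρ in (0:ℝ)..R, ρ * ∫ z, capSq z * sqPotReg f ε (x + ρ • z) := by
  have hcapm := continuous_cap.measurable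
  have hcapSqm := continuous_capSq.measurable
  have hicap : Integrable cap := continuous_cap.integrable_of_hasCompactSupport hasCompactSupport_cap
  have hicapSq : Integrable capSq :=
    continuous_capSq.integrable_of_hasCompactSupport hasCompactSupport_capSq
  have i1 : Integrable (Function.uncurry fun (z y : E3) =>
      cap z * (f y * (log ‖y‖ - logReg ε (x + R • z - y)))) (volume.prod volume) := by
    have hb := hicap.mul_prod (integrable_logReg_bound hfc hf
      (1 / 2 * log (2 * (1 + (‖x‖ + R) ^ 2)) - log ε))
    refine hb.mono' ?_ ?_
    · refine Measurable.aestronglyMeasurable ?_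
      exact (hcapm.comp measurable_fst).mul ((hfc.measurable.comp measurable_snd).mul
        ((measurable_logReg_kernel hε).comp (f := fun p : E3 × E3 => (x + R • p.1, p.2))
          (by fun_prop)))
    · have : ∀ᵐ p : E3 × E3 ∂(volume.prod volume), p.2 ≠ 0 :=
        Measure.quasiMeasurePreserving_snd.ae (ae_ne_point 0)
      filter_upwards [this] with p hp
      simp only [Function.uncurry]
      rw [norm_mul, norm_mul, Real.norm_of_nonneg (hf0 _), Real.norm_of_nonneg (cap_nonneg _),
        Real.norm_eq_abs]
      by_cases hz : p.1 ∈ Metric.closedBall (0 : E3) 1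
      · have hz1 : ‖p.1‖ ≤ 1 := by simpa using hz
        refine mul_le_mul_of_nonneg_left (mul_le_mul_of_nonneg_left ?_ (hf0 _)) (cap_nonneg _)
        have h1 := abs_logReg_kernel_le hε hε1 (x + R • p.1) hp
        have h2 : ‖x + R • p.1‖ ≤ ‖x‖ + R := by
          refine (norm_add_le _ _).trans ?_
          rw [norm_smul, Real.norm_of_nonneg hR]
          nlinarith
        have h3 : log (2 * (1 + ‖x + R • p.1‖ ^ 2)) ≤ log (2 * (1 + (‖x‖ + R) ^ 2)) := by gcongr
        linarith
      · simp [cap_eq_zero hz]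
  have i2 : ∀ ρ : ℝ, Integrable (Function.uncurry fun (z y : E3) =>
      capSq z * (f y * lapLogReg ε (x + ρ • z - y))) (volume.prod volume) := by
    intro ρ
    have hb := hicapSq.mul_prod hf
    refine (hb.mul_bdd (c := 3 * (ε ^ 2)⁻¹)
      (g := fun p : E3 × E3 => lapLogReg ε (x + ρ • p.1 - p.2)) ?_ ?_).congr
      (Eventually.of_forall fun p => ?_)
    · exact ((measurable_lapLogReg_kernel hε).comp (f := fun p : E3 × E3 => (x + ρ • p.1, p.2))
          (by fun_prop)).aestronglyMeasurable
    · refine Eventually.of_forall fun p => ?_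
      rw [Real.norm_of_nonneg (lapLogReg_nonneg _ _)]
      exact lapLogReg_le_const hε _
    · simp only [Function.uncurry]; ring
  have e1 : (∫ z, cap z * logPotReg f ε (x + R • z)) =
      ∫ y, f y * ∫ z, cap z * (log ‖y‖ - logReg ε (x + R • z - y)) := by
    simp only [logPotReg, ← integral_const_mul]
    rw [integral_integral_swap i1]
    congr 1; funext y; congr 1; funext z; ring
  have i3 : Integrable fun y => f y * ∫ z, cap z * (log ‖y‖ - logReg ε (x + R • z - y)) := by
    refine i1.integral_prod_right.congr (Eventually.of_forall fun y => ?_)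
    simp only [← integral_const_mul, Function.uncurry]
    congr 1; funext z; ring
  have e2 : ∀ ρ : ℝ, (∫ z, capSq z * sqPotReg f ε (x + ρ • z)) =
      ∫ y, f y * ∫ z, capSq z * lapLogReg ε (x + ρ • z - y) := by
    intro ρ
    simp only [sqPotReg, ← integral_const_mul]
    rw [integral_integral_swap (i2 ρ)]
    congr 1; funext y; congr 1; funext z; ring
  have i4 : Integrable (Function.uncurry fun (ρ : ℝ) (y : E3) =>
      ρ * (f y * ∫ z, capSq z * lapLogReg ε (x + ρ • z - y)))
      ((volume.restrict (Set.Ioc 0 R)).prod volume) := by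
    have hρ : Integrable (fun ρ : ℝ => ρ) (volume.restrict (Set.Ioc 0 R)) :=
      (continuous_id.integrableOn_Icc (a := 0) (b := R)).mono_set Set.Ioc_subset_Icc_self
    refine ((hρ.mul_prod hf).mul_bdd (c := (∫ z, capSq z) * (3 * (ε ^ 2)⁻¹))
      (g := fun p : ℝ × E3 => ∫ z, capSq z * lapLogReg ε (x + p.1 • z - p.2)) ?_ ?_).congr
      (Eventually.of_forall fun p => ?_)
    · have : Measurable fun q : (ℝ × E3) × E3 =>
          capSq q.2 * lapLogReg ε (x + q.1.1 • q.2 - q.1.2) :=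
        (hcapSqm.comp measurable_snd).mul ((measurable_lapLogReg_kernel hε).comp
          (f := fun q : (ℝ × E3) × E3 => (x + q.1.1 • q.2, q.1.2)) (by fun_prop))
      exact this.stronglyMeasurable.integral_prod_right'.aestronglyMeasurable
    · refine Eventually.of_forall fun p => ?_
      rw [← integral_mul_const]
      refine norm_integral_le_of_norm_le (hicapSq.mul_const _) (Eventually.of_forall fun z => ?_)
      rw [norm_mul, Real.norm_of_nonneg (capSq_nonneg _), Real.norm_of_nonneg (lapLogReg_nonneg _ _)]
      exact mul_le_mul_of_nonneg_left (lapLogReg_le_const hε _) (capSq_nonneg _)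
    · simp only [Function.uncurry]; ring
  have e3 : (∫ ρ in (0:ℝ)..R, ρ * ∫ z, capSq z * sqPotReg f ε (x + ρ • z)) =
      ∫ y, f y * ∫ ρ in (0:ℝ)..R, ρ * ∫ z, capSq z * lapLogReg ε (x + ρ • z - y) := by
    simp only [e2, intervalIntegral.integral_of_le hR]
    simp only [← integral_const_mul (_ : ℝ) (fun y => f y * _)]
    rw [integral_integral_swap i4]
    congr 1; funext y
    rw [← integral_const_mul]
    congr 1; funext ρ; ring
  have i5 : Integrable fun y => (∫ z, cap z) * (f y * (log ‖y‖ - logReg ε (x - y))) :=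
    (integrable_logReg_kernel hfc hf hf0 hε hε1 x).const_mul _
  rw [e1, e3, logPotReg, ← integral_const_mul, ← integral_sub i3 i5, ← integral_neg]
  congr 1; funext y
  have := integral_cap_mul_logReg hε (log ‖y‖) y x R
  linear_combination f y * this

theorem sqPotReg_nonneg {f : E3 → ℝ} (hf0 : ∀ y, 0 ≤ f y) (ε : ℝ) (x : E3) :
    0 ≤ sqPotReg f ε x :=
  integral_nonneg fun y => mul_nonneg (hf0 y) (lapLogReg_nonneg _ _)

theorem mul_lapLogReg_le {f : E3 → ℝ} (hf0 : ∀ y, 0 ≤ f y) (ε : ℝ) {x y : E3} (hxy : y ≠ x) :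
    f y * lapLogReg ε (x - y) ≤ 3 * (f y * (‖y - x‖ ^ 2)⁻¹) := by
  have := lapLogReg_le ε (sub_ne_zero.2 hxy.symm)
  rw [norm_sub_rev x y] at this
  nlinarith [hf0 y]

theorem norm_mul_lapLogReg_le {f : E3 → ℝ} (hf0 : ∀ y, 0 ≤ f y) (ε : ℝ) (x : E3) :
    ∀ᵐ y, ‖f y * lapLogReg ε (x - y)‖ ≤ 3 * (f y * (‖y - x‖ ^ 2)⁻¹) := by
  filter_upwards [ae_ne_point x] with y hy
  rw [Real.norm_of_nonneg (mul_nonneg (hf0 y) (lapLogReg_nonneg _ _))]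
  exact mul_lapLogReg_le hf0 ε hy

theorem sqPotReg_le {f : E3 → ℝ} (hfc : Continuous f) (hf : Integrable f)
    (hf0 : ∀ y, 0 ≤ f y) (ε : ℝ) (x : E3) : sqPotReg f ε x ≤ 3 * sqPot f x := by
  rw [sqPot, ← integral_const_mul]
  exact (le_abs_self _).trans (norm_integral_le_of_norm_le
    ((integrable_mul_inv_norm_sub_sq hfc hf x).const_mul 3) (norm_mul_lapLogReg_le hf0 ε x))

theorem tendsto_sqPotReg {f : E3 → ℝ} (hfc : Continuous f) (hf : Integrable f)
    (hf0 : ∀ y, 0 ≤ f y) (x : E3) :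
    Tendsto (fun ε => sqPotReg f ε x) (nhdsWithin 0 (Set.Ioi 0)) (nhds (sqPot f x)) := by
  refine tendsto_integral_filter_of_dominated_convergence
    (fun y => 3 * (f y * (‖y - x‖ ^ 2)⁻¹)) ?_ (Eventually.of_forall fun ε =>
      norm_mul_lapLogReg_le hf0 ε x) ((integrable_mul_inv_norm_sub_sq hfc hf x).const_mul 3) ?_
  · filter_upwards [self_mem_nhdsWithin] with ε hε
    exact (hfc.measurable.mul ((measurable_lapLogReg_kernel hε).comp
      (f := fun y => (x, y)) (by fun_prop))).aestronglyMeasurable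
  · filter_upwards [ae_ne_point x] with y hy
    have := (tendsto_lapLogReg (sub_ne_zero.2 hy.symm)).const_mul (f y)
    rwa [norm_sub_rev x y] at this

theorem norm_logReg_kernel_le {f : E3 → ℝ} (hf0 : ∀ y, 0 ≤ f y) {ε : ℝ} (hε : 0 < ε)
    (hε1 : ε ≤ 1) (x : E3) : ∀ᵐ y, ‖f y * (log ‖y‖ - logReg ε (x - y))‖ ≤
      f y * (1 / 2 * log (2 * (1 + ‖x‖ ^ 2)) + 1 / 2 * (‖y‖ ^ 2)⁻¹ +
        1 / 2 * (‖y - x‖ ^ 2)⁻¹) := by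
  filter_upwards [ae_ne_point 0, ae_ne_point x] with y hy hyx
  rw [norm_mul, Real.norm_of_nonneg (hf0 y), Real.norm_eq_abs]
  exact mul_le_mul_of_nonneg_left (abs_logReg_kernel_le' hε hε1 hy hyx) (hf0 y)

theorem tendsto_logPotReg {f : E3 → ℝ} (hfc : Continuous f) (hf : Integrable f)
    (hf0 : ∀ y, 0 ≤ f y) (x : E3) :
    Tendsto (fun ε => logPotReg f ε x) (nhdsWithin 0 (Set.Ioi 0)) (nhds (logPot f x)) := by
  refine tendsto_integral_filter_of_dominated_convergence
    (fun y => f y * (1 / 2 * log (2 * (1 + ‖x‖ ^ 2)) + 1 / 2 * (‖y‖ ^ 2)⁻¹ +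
      1 / 2 * (‖y - x‖ ^ 2)⁻¹)) ?_ ?_ (integrable_logReg_bound' hfc hf _ x) ?_
  · filter_upwards [Ioc_mem_nhdsGT one_pos] with ε hε
    exact (integrable_logReg_kernel hfc hf hf0 hε.1 hε.2 x).aestronglyMeasurable
  · filter_upwards [Ioc_mem_nhdsGT one_pos] with ε hε
    exact norm_logReg_kernel_le hf0 hε.1 hε.2 x
  · filter_upwards [ae_ne_point 0, ae_ne_point x] with y hy hyx
    have h0 : x - y ≠ 0 := sub_ne_zero.2 hyx.symm
    rw [log_div (norm_ne_zero_iff.2 hy) (norm_ne_zero_iff.2 h0), mul_comm]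
    exact ((tendsto_logReg h0).const_sub _).const_mul (f y)

/-- A majorant for `logPotReg f ε`, uniform in `ε`. -/
noncomputable def logPotBound (f : E3 → ℝ) (x : E3) : ℝ :=
  1 / 2 * log (2 * (1 + ‖x‖ ^ 2)) * (∫ y, f y) + 1 / 2 * (∫ y, f y * (‖y‖ ^ 2)⁻¹) +
    1 / 2 * sqPot f x

theorem continuous_logPotBound {f : E3 → ℝ} (hZ : Continuous (sqPot f)) :
    Continuous (logPotBound f) := by
  unfold logPotBound
  have : Continuous fun x : E3 => log (2 * (1 + ‖x‖ ^ 2)) :=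
    Continuous.log (by fun_prop) fun x => by positivity
  fun_prop

theorem abs_logPotReg_le {f : E3 → ℝ} (hfc : Continuous f) (hf : Integrable f)
    (hf0 : ∀ y, 0 ≤ f y) {ε : ℝ} (hε : 0 < ε) (hε1 : ε ≤ 1) (x : E3) :
    |logPotReg f ε x| ≤ logPotBound f x := by
  refine (norm_integral_le_of_norm_le (integrable_logReg_bound' hfc hf _ x)
    (norm_logReg_kernel_le hf0 hε hε1 x)).trans (le_of_eq ?_)
  have i1 := hf.mul_const (1 / 2 * log (2 * (1 + ‖x‖ ^ 2)))
  have i2 := (integrable_mul_inv_norm_sq hfc hf).mul_const (1 / 2)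
  have i3 := (integrable_mul_inv_norm_sub_sq hfc hf x).mul_const (1 / 2)
  have i12 : Integrable fun y => f y * (1 / 2 * log (2 * (1 + ‖x‖ ^ 2))) +
      f y * (‖y‖ ^ 2)⁻¹ * (1 / 2) := i1.add i2
  calc _ = ∫ y, (f y * (1 / 2 * log (2 * (1 + ‖x‖ ^ 2))) + f y * (‖y‖ ^ 2)⁻¹ * (1 / 2)) +
        f y * (‖y - x‖ ^ 2)⁻¹ * (1 / 2) := by congr 1; funext y; ring
    _ = _ := by
      rw [integral_add i12 i3, integral_add i1 i2, integral_mul_const, integral_mul_const,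
        integral_mul_const, logPotBound, sqPot]
      ring

theorem abs_logPot_le {f : E3 → ℝ} (hfc : Continuous f) (hf : Integrable f)
    (hf0 : ∀ y, 0 ≤ f y) (x : E3) : |logPot f x| ≤ logPotBound f x := by
  refine le_of_tendsto (tendsto_logPotReg hfc hf hf0 x).abs ?_
  filter_upwards [Ioc_mem_nhdsGT one_pos] with ε hε
  exact abs_logPotReg_le hfc hf hf0 hε.1 hε.2 x

/-- The logarithmic potential of a positive density decreases at most logarithmically. -/
theorem neg_le_logPot {f : E3 → ℝ} (hfc : Continuous f) (hf : Integrable f)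
    (hf0 : ∀ y, 0 ≤ f y) (x : E3) :
    -(1 / 2 * log (2 * (1 + ‖x‖ ^ 2)) * (∫ y, f y) + 1 / 2 * (∫ y, f y * (‖y‖ ^ 2)⁻¹)) ≤
      logPot f x := by
  have h1 : -(1 / 2 * log (2 * (1 + ‖x‖ ^ 2)) * (∫ y, f y) +
      1 / 2 * (∫ y, f y * (‖y‖ ^ 2)⁻¹)) ≤ logPotReg f 1 x := by
    have i1 := hf.mul_const (1 / 2 * log (2 * (1 + ‖x‖ ^ 2)))
    have i2 := (integrable_mul_inv_norm_sq hfc hf).mul_const (1 / 2)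
    have := norm_integral_le_of_norm_le (integrable_logReg_bound hfc hf
      (1 / 2 * log (2 * (1 + ‖x‖ ^ 2)))) (f := fun y => f y * (log ‖y‖ - logReg 1 (x - y))) (by
        filter_upwards [ae_ne_point 0] with y hy
        rw [norm_mul, Real.norm_of_nonneg (hf0 y), Real.norm_eq_abs]
        exact mul_le_mul_of_nonneg_left (abs_log_norm_sub_logReg_one_le x hy) (hf0 y))
    have e : ∫ y, f y * (1 / 2 * log (2 * (1 + ‖x‖ ^ 2)) + 1 / 2 * (‖y‖ ^ 2)⁻¹) =
        1 / 2 * log (2 * (1 + ‖x‖ ^ 2)) * (∫ y, f y) + 1 / 2 * (∫ y, f y * (‖y‖ ^ 2)⁻¹) := by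
      calc _ = ∫ y, f y * (1 / 2 * log (2 * (1 + ‖x‖ ^ 2))) + f y * (‖y‖ ^ 2)⁻¹ * (1 / 2) := by
            congr 1; funext y; ring
        _ = _ := by
          rw [integral_add i1 i2, integral_mul_const, integral_mul_const]; ring
    rw [e] at this
    exact (abs_le.1 this).1
  refine h1.trans (ge_of_tendsto (tendsto_logPotReg hfc hf hf0 x) ?_)
  filter_upwards [Ioc_mem_nhdsGT one_pos] with ε hε
  refine integral_mono (integrable_logReg_kernel hfc hf hf0 one_pos le_rfl x)
    (integrable_logReg_kernel hfc hf hf0 hε.1 hε.2 x) fun y => ?_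
  have := logReg_le_logReg_one hε.1 hε.2 (x - y)
  exact mul_le_mul_of_nonneg_left (by linarith) (hf0 y)

theorem integrable_cap_mul_logPot {f : E3 → ℝ} (hfc : Continuous f) (hf : Integrable f)
    (hf0 : ∀ y, 0 ≤ f y) (hZ : Continuous (sqPot f)) (x : E3) (R : ℝ) :
    Integrable fun z => cap z * logPot f (x + R • z) := by
  refine (integrable_cap_mul ((continuous_logPotBound hZ).comp
    (by fun_prop : Continuous fun z : E3 => x + R • z))).mono' ?_ ?_
  · exact (continuous_cap.measurable.mul ((measurable_logPot hfc).comp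
      (f := fun z : E3 => x + R • z) (by fun_prop))).aestronglyMeasurable
  · refine Eventually.of_forall fun z => ?_
    rw [norm_mul, Real.norm_of_nonneg (cap_nonneg z)]
    exact mul_le_mul_of_nonneg_left (abs_logPot_le hfc hf hf0 _) (cap_nonneg z)

theorem integral_cap_mul_logPot {f : E3 → ℝ} (hfc : Continuous f) (hf : Integrable f)
    (hf0 : ∀ y, 0 ≤ f y) (hZ : Continuous (sqPot f)) (x : E3) {R : ℝ} (hR : 0 ≤ R) :
    (∫ z, cap z * logPot f (x + R • z)) - (∫ z, cap z) * logPot f x =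
      -∫ ρ in (0:ℝ)..R, ρ * ∫ z, capSq z * sqPot f (x + ρ • z) := by
  have hA : ∀ ρ : ℝ, Continuous fun z : E3 => x + ρ • z := fun ρ => by fun_prop
  have t1 : Tendsto (fun ε => ∫ z, cap z * logPotReg f ε (x + R • z))
      (nhdsWithin 0 (Set.Ioi 0)) (nhds (∫ z, cap z * logPot f (x + R • z))) := by
    refine tendsto_integral_filter_of_dominated_convergence
      (fun z => cap z * logPotBound f (x + R • z)) ?_ ?_
      (integrable_cap_mul ((continuous_logPotBound hZ).comp (hA R))) ?_
    · filter_upwards [self_mem_nhdsWithin] with ε hε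
      exact (continuous_cap.measurable.mul ((measurable_logPotReg hfc hε).comp
        (hA R).measurable)).aestronglyMeasurable
    · filter_upwards [Ioc_mem_nhdsGT one_pos] with ε hε
      refine Eventually.of_forall fun z => ?_
      rw [norm_mul, Real.norm_of_nonneg (cap_nonneg z)]
      exact mul_le_mul_of_nonneg_left (abs_logPotReg_le hfc hf hf0 hε.1 hε.2 _) (cap_nonneg z)
    · exact Eventually.of_forall fun z => (tendsto_logPotReg hfc hf hf0 _).const_mul _
  have hb : ∀ (ρ ε : ℝ) (z : E3), ‖capSq z * sqPotReg f ε (x + ρ • z)‖ ≤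
      capSq z * (3 * sqPot f (x + ρ • z)) := by
    intro ρ ε z
    rw [norm_mul, Real.norm_of_nonneg (capSq_nonneg z), Real.norm_of_nonneg (sqPotReg_nonneg hf0 _ _)]
    exact mul_le_mul_of_nonneg_left (sqPotReg_le hfc hf hf0 _ _) (capSq_nonneg z)
  have hZ3 : Continuous fun x => 3 * sqPot f x := continuous_const.mul hZ
  have t2 : ∀ ρ : ℝ, Tendsto (fun ε => ∫ z, capSq z * sqPotReg f ε (x + ρ • z))
      (nhdsWithin 0 (Set.Ioi 0)) (nhds (∫ z, capSq z * sqPot f (x + ρ • z))) := by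
    intro ρ
    refine tendsto_integral_filter_of_dominated_convergence
      (fun z => capSq z * (3 * sqPot f (x + ρ • z))) ?_
      (Eventually.of_forall fun ε => Eventually.of_forall fun z => hb ρ ε z)
      (integrable_capSq_mul (hZ3.comp (hA ρ))) ?_
    · filter_upwards [self_mem_nhdsWithin] with ε hε
      exact (continuous_capSq.measurable.mul ((measurable_sqPotReg hfc hε).comp
        (hA ρ).measurable)).aestronglyMeasurable
    · exact Eventually.of_forall fun z => (tendsto_sqPotReg hfc hf hf0 _).const_mul _
  have t3 : Tendsto (fun ε => ∫ ρ in (0:ℝ)..R, ρ * ∫ z, capSq z * sqPotReg f ε (x + ρ • z))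
      (nhdsWithin 0 (Set.Ioi 0))
      (nhds (∫ ρ in (0:ℝ)..R, ρ * ∫ z, capSq z * sqPot f (x + ρ • z))) := by
    refine intervalIntegral.tendsto_integral_filter_of_dominated_convergence
      (fun ρ => |ρ| * ∫ z, capSq z * (3 * sqPot f (x + ρ • z))) ?_ ?_ ?_ ?_
    · filter_upwards [self_mem_nhdsWithin] with ε hε
      have hm : Measurable fun p : ℝ × E3 => capSq p.2 * sqPotReg f ε (x + p.1 • p.2) :=
        (continuous_capSq.measurable.comp measurable_snd).mul ((measurable_sqPotReg hfc hε).comp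
          (f := fun p : ℝ × E3 => x + p.1 • p.2) (by fun_prop))
      exact (measurable_id.mul
        hm.stronglyMeasurable.integral_prod_right'.measurable).aestronglyMeasurable
    · refine Eventually.of_forall fun ε => Eventually.of_forall fun ρ _ => ?_
      rw [norm_mul, Real.norm_eq_abs]
      gcongr
      exact norm_integral_le_of_norm_le (integrable_capSq_mul (hZ3.comp (hA ρ)))
        (Eventually.of_forall (hb ρ ε))
    · exact (continuous_abs.mul (continuous_integral_capSq_mul hZ3 x)).intervalIntegrable _ _
    · exact Eventually.of_forall fun ρ _ => (t2 ρ).const_mul ρ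
  refine tendsto_nhds_unique (t1.sub ((tendsto_logPotReg hfc hf hf0 x).const_mul _))
    (t3.neg.congr' ?_)
  filter_upwards [Ioc_mem_nhdsGT one_pos] with ε hε
  exact (integral_cap_mul_logPotReg hfc hf hf0 hε.1 hε.2 x hR).symm

/-! ### The polynomial part of a solution -/

theorem lap_const_mul_norm_sq (c : ℝ) (x : E3) : lap (fun x => c * ‖x‖ ^ 2) x = 6 * c := by
  have h1 : ∀ x : E3, HasFDerivAt (fun x : E3 => c * ‖x‖ ^ 2) (c • (2 • innerSL ℝ x)) x :=
    fun x => (hasStrictFDerivAt_norm_sq x).hasFDerivAt.const_mul c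
  have h2 : ∀ i : Fin 3, fderiv ℝ (fun x => fderiv ℝ (fun x : E3 => c * ‖x‖ ^ 2) x
      (EuclideanSpace.single i 1)) x (EuclideanSpace.single i 1) = 2 * c := by
    intro i
    have e1 : (fun x => fderiv ℝ (fun x : E3 => c * ‖x‖ ^ 2) x
        (EuclideanSpace.single i (1:ℝ))) = fun x => (2 * c) * x i := by
      funext x
      rw [(h1 x).fderiv]
      simp [PiLp.inner_apply]; ring
    rw [e1]
    have h3 : HasFDerivAt (fun x : E3 => (2 * c) * x i)
        ((2 * c) • (EuclideanSpace.proj i : E3 →L[ℝ] ℝ)) x :=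
      (EuclideanSpace.proj i : E3 →L[ℝ] ℝ).hasFDerivAt.const_mul (2 * c)
    rw [h3.fderiv]
    simp
  simp only [lap, h2]
  simp; ring

theorem lap_add {F G : E3 → ℝ} (hF : ContDiff ℝ 2 F) (hG : ContDiff ℝ 2 G) (x : E3) :
    lap (fun x => F x + G x) x = lap F x + lap G x := by
  have hF1 : ContDiff ℝ 1 (fun y => fderiv ℝ F y) := hF.fderiv_right (by norm_num)
  have hG1 : ContDiff ℝ 1 (fun y => fderiv ℝ G y) := hG.fderiv_right (by norm_num)
  simp only [lap]
  rw [← Finset.sum_add_distrib]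
  refine Finset.sum_congr rfl fun i _ => ?_
  have e : (fun y => fderiv ℝ (fun x => F x + G x) y (EuclideanSpace.single i (1:ℝ))) =
      fun y => fderiv ℝ F y (EuclideanSpace.single i 1) +
        fderiv ℝ G y (EuclideanSpace.single i 1) := by
    funext y
    rw [fderiv_fun_add (hF.differentiable (by norm_num) y) (hG.differentiable (by norm_num) y)]
    rfl
  rw [e, fderiv_fun_add]
  · rfl
  · exact (hF1.clm_apply contDiff_const).differentiable (by norm_num) x
  · exact (hG1.clm_apply contDiff_const).differentiable (by norm_num) x

theorem integrable_cap : Integrable cap :=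
  continuous_cap.integrable_of_hasCompactSupport hasCompactSupport_cap

theorem cap_le_one (z : E3) : cap z ≤ 1 :=
  max_le zero_le_one (by nlinarith [sq_nonneg ‖z‖])

theorem integral_cap_pos : 0 < ∫ z, cap z := by
  refine continuous_cap.integral_pos_of_hasCompactSupport_nonneg_nonzero hasCompactSupport_cap
    cap_nonneg (x := 0) ?_
  simp [cap]

namespace IsSolution

variable {u : E3 → ℝ}

theorem continuous_density (hu : IsSolution u) : Continuous fun x => exp (3 * u x) := by
  have := hu.1.continuous
  fun_prop

theorem exists_lap_eq (hu : IsSolution u) : ∃ c : ℝ, ∀ x,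
    lap u x + c = -(1 / π ^ 2 * sqPot (fun y => exp (3 * u y)) x) := by
  have hu2 : ContDiff ℝ 2 u := contDiff_infty.1 hu.1 2
  have hc : Continuous fun x => -lap u x := (continuous_lap hu2).neg
  have hU : Integrable fun x => -lap u x * ((1 + ‖x‖ ^ 2) ^ 2)⁻¹ := by
    refine hu.2.1.2.mono' ?_ (Eventually.of_forall fun x => ?_)
    · exact (hc.mul (Continuous.inv₀ (by fun_prop) fun x => by positivity)).aestronglyMeasurable
    · rw [norm_mul, norm_neg, Real.norm_of_nonneg (by positivity : 0 ≤ ((1 + ‖x‖ ^ 2) ^ 2)⁻¹),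
        Real.norm_eq_abs, div_eq_mul_inv]
      gcongr
      nlinarith [sq_nonneg ‖x‖]
  obtain ⟨c, hc⟩ := exists_potential_add_const hc hU hu.continuous_density hu.2.2.1 hu.2.2.2
  refine ⟨c, fun x => ?_⟩
  have := hc x
  rw [sqPot]
  linarith

theorem solV_eq (u : E3 → ℝ) : solV u = fun x => 1 / π ^ 2 * logPot (fun y => exp (3 * u y)) x :=
  rfl

theorem exists_meanValue (hu : IsSolution u) : ∃ c : ℝ,
    (∀ (x : E3) (R : ℝ), Integrable fun z => cap z * solV u (x + R • z)) ∧
    ∀ (x : E3) (R : ℝ), 0 ≤ R →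
      ∫ z, cap z * (u (x + R • z) - solV u (x + R • z) + c * ‖x + R • z‖ ^ 2) =
        (∫ z, cap z) * (u x - solV u x + c * ‖x‖ ^ 2) := by
  obtain ⟨c, hc⟩ := hu.exists_lap_eq
  have hu2 : ContDiff ℝ 2 u := contDiff_infty.1 hu.1 2
  set f : E3 → ℝ := fun y => exp (3 * u y) with hfdef
  have hfc : Continuous f := hu.continuous_density
  have hf : Integrable f := hu.2.2.1
  have hf0 : ∀ y, 0 ≤ f y := fun y => (exp_pos _).le
  have hp : π ^ 2 ≠ 0 := by positivity
  have hZe : sqPot f = fun x => -(π ^ 2 * (lap u x + c)) := by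
    funext x; rw [hc x]; field_simp
  have hZ : Continuous (sqPot f) := by
    rw [hZe]
    exact (continuous_const.mul ((continuous_lap hu2).add continuous_const)).neg
  have hi : ∀ (x : E3) (R : ℝ), Integrable fun z => cap z * solV u (x + R • z) := by
    intro x R
    rw [solV_eq]
    refine ((integrable_cap_mul_logPot hfc hf hf0 hZ x R).const_mul (1 / π ^ 2)).congr
      (Eventually.of_forall fun z => ?_)
    simp only; ring
  refine ⟨c / 6, hi, fun x R hR => ?_⟩
  have hN : ContDiff ℝ 2 fun x : E3 => c / 6 * ‖x‖ ^ 2 :=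
    contDiff_const.mul (contDiff_id.norm_sq ℝ)
  have hq : ContDiff ℝ 2 fun x => u x + c / 6 * ‖x‖ ^ 2 := hu2.add hN
  have h1 := integral_cap_mul_sub hq x R
  have h2 := integral_cap_mul_logPot hfc hf hf0 hZ x hR
  have hl : ∀ x, lap (fun x => u x + c / 6 * ‖x‖ ^ 2) x = -(1 / π ^ 2) * sqPot f x := by
    intro x
    rw [lap_add hu2 hN, lap_const_mul_norm_sq, ← neg_mul_eq_neg_mul, ← hc x]
    ring
  simp only [hl] at h1
  have e1 : (∫ ρ in (0:ℝ)..R, ρ * ∫ z, capSq z * (-(1 / π ^ 2) * sqPot f (x + ρ • z))) =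
      -(1 / π ^ 2) * ∫ ρ in (0:ℝ)..R, ρ * ∫ z, capSq z * sqPot f (x + ρ • z) := by
    have e : ∀ ρ : ℝ, (∫ z, capSq z * (-(1 / π ^ 2) * sqPot f (x + ρ • z))) =
        -(1 / π ^ 2) * ∫ z, capSq z * sqPot f (x + ρ • z) := by
      intro ρ
      rw [← integral_const_mul]
      congr 1; funext z; ring
    rw [← intervalIntegral.integral_const_mul]
    congr 1; funext ρ
    rw [e]; ring
  rw [e1] at h1
  have e2 : ∫ z, cap z * (u (x + R • z) - solV u (x + R • z) + c / 6 * ‖x + R • z‖ ^ 2) =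
      (∫ z, cap z * (u (x + R • z) + c / 6 * ‖x + R • z‖ ^ 2)) -
        1 / π ^ 2 * ∫ z, cap z * logPot f (x + R • z) := by
    rw [← integral_const_mul, ← integral_sub]
    · congr 1; funext z; rw [solV_eq]; ring
    · exact integrable_cap_mul (hq.continuous.comp (by fun_prop))
    · exact (integrable_cap_mul_logPot hfc hf hf0 hZ x R).const_mul _
  rw [e2, solV_eq]
  change _ = _ * (u x - 1 / π ^ 2 * logPot f x + c / 6 * ‖x‖ ^ 2)
  linear_combination h1 - 1 / π ^ 2 * h2

theorem exists_neg_solV_le (hu : IsSolution u) :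
    ∃ C : ℝ, 0 ≤ C ∧ ∀ x, -solV u x ≤ C * (1 + log (2 * (1 + ‖x‖ ^ 2))) := by
  set f : E3 → ℝ := fun y => exp (3 * u y) with hfdef
  have hfc : Continuous f := hu.continuous_density
  have hf : Integrable f := hu.2.2.1
  have hf0 : ∀ y, 0 ≤ f y := fun y => (exp_pos _).le
  have hA : 0 ≤ ∫ y, f y := integral_nonneg hf0
  have hB : 0 ≤ ∫ y, f y * (‖y‖ ^ 2)⁻¹ :=
    integral_nonneg fun y => mul_nonneg (hf0 y) (by positivity)
  refine ⟨1 / π ^ 2 * ((∫ y, f y) + ∫ y, f y * (‖y‖ ^ 2)⁻¹), by positivity, fun x => ?_⟩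
  have h := neg_le_logPot hfc hf hf0 x
  have hl : 0 ≤ log (2 * (1 + ‖x‖ ^ 2)) := log_nonneg (by nlinarith [sq_nonneg ‖x‖])
  rw [solV_eq]
  change -(1 / π ^ 2 * logPot f x) ≤ _
  have hp : 0 < 1 / π ^ 2 := by positivity
  rw [mul_assoc, ← mul_neg]
  refine mul_le_mul_of_nonneg_left ?_ hp.le
  nlinarith [mul_nonneg hA hl, mul_nonneg hB hl]

theorem exists_le_log (hu : IsSolution u) :
    ∃ C : ℝ, 0 ≤ C ∧ ∀ x, u x - solV u x ≤ C * (1 + log (1 + ‖x‖ ^ 2)) := by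
  obtain ⟨c, hi, hmean⟩ := hu.exists_meanValue
  obtain ⟨C, hC, hV⟩ := hu.exists_neg_solV_le
  have hm := integral_cap_pos
  have huc := hu.1.continuous
  have hN : ContDiff ℝ 2 fun x : E3 => c * ‖x‖ ^ 2 := contDiff_const.mul (contDiff_id.norm_sq ℝ)
  have hA : ∀ x : E3, Continuous fun z : E3 => x + (1:ℝ) • z := fun x => by fun_prop
  set I := ∫ y, exp (3 * u y)
  set k := ∫ ρ in (0:ℝ)..1, ρ * ∫ z, capSq z * (6 * c)
  set m := ∫ z, cap z
  have key : ∀ x, m * (u x - solV u x) ≤ (1 / 3 * I + |k|) + m * (C * (6 + log (1 + ‖x‖ ^ 2))) := by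
    intro x
    have h1 := hmean x 1 zero_le_one
    have h2 := integral_cap_mul_sub hN x 1
    simp only [lap_const_mul_norm_sq] at h2
    have i1 : Integrable fun z => cap z * (u (x + (1:ℝ) • z) - solV u (x + (1:ℝ) • z)) := by
      refine ((integrable_cap_mul (huc.comp (hA x))).sub (hi x 1)).congr
        (Eventually.of_forall fun z => ?_)
      simp only [Pi.sub_apply, Function.comp]; ring
    have i2 : Integrable fun z => cap z * (c * ‖x + (1:ℝ) • z‖ ^ 2) :=
      integrable_cap_mul (by fun_prop)
    simp only [mul_add] at h1
    have h1' : (∫ z, cap z * (u (x + (1:ℝ) • z) - solV u (x + (1:ℝ) • z)) +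
        cap z * (c * ‖x + (1:ℝ) • z‖ ^ 2)) = m * (u x - solV u x) + m * (c * ‖x‖ ^ 2) := h1
    rw [integral_add i1 i2] at h1'
    have h3 : m * (u x - solV u x) =
        (∫ z, cap z * (u (x + (1:ℝ) • z) - solV u (x + (1:ℝ) • z))) + k := by
      linarith
    have iE : Integrable fun z : E3 => exp (3 * u (x + (1:ℝ) • z)) := by
      simpa using hu.2.2.1.comp_add_left x
    have iE2 : ∫ z : E3, exp (3 * u (x + (1:ℝ) • z)) = I := by
      simp only [one_smul]
      exact integral_add_left_eq_self (fun y => exp (3 * u y)) x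
    have h4 : (∫ z, cap z * (u (x + (1:ℝ) • z) - solV u (x + (1:ℝ) • z))) ≤
        ∫ z, 1 / 3 * exp (3 * u (x + (1:ℝ) • z)) + cap z * (C * (6 + log (1 + ‖x‖ ^ 2))) := by
      refine integral_mono i1 ((iE.const_mul _).add (integrable_cap.mul_const _)) fun z => ?_
      simp only
      by_cases hz : z ∈ Metric.closedBall (0 : E3) 1
      · have hz1 : ‖z‖ ≤ 1 := by simpa using hz
        have hv := hV (x + (1:ℝ) • z)
        have hl : log (2 * (1 + ‖x + (1:ℝ) • z‖ ^ 2)) ≤ 5 + log (1 + ‖x‖ ^ 2) := by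
          have hn : ‖x + (1:ℝ) • z‖ ≤ ‖x‖ + 1 := by
            refine (norm_add_le _ _).trans ?_
            simpa using hz1
          have hn2 : ‖x + (1:ℝ) • z‖ ^ 2 ≤ (‖x‖ + 1) ^ 2 := by gcongr
          have : 2 * (1 + ‖x + (1:ℝ) • z‖ ^ 2) ≤ 6 * (1 + ‖x‖ ^ 2) := by
            nlinarith [sq_nonneg (‖x‖ - 1)]
          refine (log_le_log (by positivity) this).trans ?_
          rw [log_mul (by norm_num) (by positivity)]
          have := log_le_sub_one_of_pos (show (0:ℝ) < 6 by norm_num)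
          linarith
        have hv2 : -solV u (x + (1:ℝ) • z) ≤ C * (6 + log (1 + ‖x‖ ^ 2)) :=
          hv.trans (mul_le_mul_of_nonneg_left (by linarith) hC)
        have hue : u (x + (1:ℝ) • z) ≤ 1 / 3 * exp (3 * u (x + (1:ℝ) • z)) := by
          have := add_one_le_exp (3 * u (x + (1:ℝ) • z))
          linarith
        have h0 := cap_nonneg z
        have h1 := cap_le_one z
        have he := exp_pos (3 * u (x + (1:ℝ) • z))
        nlinarith
      · rw [cap_eq_zero hz]
        have he := exp_pos (3 * u (x + (1:ℝ) • z))
        linarith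
    rw [integral_add (iE.const_mul _) (integrable_cap.mul_const _), integral_const_mul,
      integral_mul_const, iE2] at h4
    have := le_abs_self k
    linarith
  have hI : 0 ≤ I := integral_nonneg fun y => (exp_pos _).le
  refine ⟨(1 / 3 * I + |k|) / m + 6 * C, by positivity, fun x => ?_⟩
  have h := key x
  have hl : 0 ≤ log (1 + ‖x‖ ^ 2) := log_nonneg (by nlinarith [sq_nonneg ‖x‖])
  have h5 : u x - solV u x ≤ (1 / 3 * I + |k|) / m + C * (6 + log (1 + ‖x‖ ^ 2)) := by
    rw [← sub_le_iff_le_add, le_div_iff₀ hm]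
    linarith
  have h6 : 0 ≤ (1 / 3 * I + |k|) / m := by positivity
  nlinarith [mul_nonneg h6 hl, mul_nonneg hC hl]

end IsSolution

/-! ### A Liouville theorem -/

/-- The solid mean value property with respect to the kernel `cap`. -/
structure HasMeanValue (P : E3 → ℝ) : Prop where
  integrable : ∀ (x : E3) (R : ℝ), Integrable fun z => cap z * P (x + R • z)
  integral_eq : ∀ (x : E3) (R : ℝ), 0 ≤ R →
    ∫ z, cap z * P (x + R • z) = (∫ z, cap z) * P x

theorem abs_cap_sub_le {a b : E3} (ha : ‖a‖ ≤ 3) (hb : ‖b‖ ≤ 3) :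
    |cap a - cap b| ≤ 6 * ‖a - b‖ := by
  have h1 : |cap a - cap b| ≤ |(1 - ‖a‖ ^ 2) - (1 - ‖b‖ ^ 2)| := by
    unfold cap
    rw [max_comm 0, max_comm 0]
    exact abs_max_sub_max_le_abs (1 - ‖a‖ ^ 2) (1 - ‖b‖ ^ 2) 0
  have h2 := abs_norm_sub_norm_le a b
  have h3 : (1 - ‖a‖ ^ 2) - (1 - ‖b‖ ^ 2) = -((‖a‖ - ‖b‖) * (‖a‖ + ‖b‖)) := by ring
  rw [h3, abs_neg, abs_mul, abs_of_nonneg (by positivity : 0 ≤ ‖a‖ + ‖b‖)] at h1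
  nlinarith [norm_nonneg a, norm_nonneg b, norm_nonneg (a - b), abs_nonneg (‖a‖ - ‖b‖)]

namespace HasMeanValue

theorem sub_shift {P : E3 → ℝ} (hP : HasMeanValue P) (h : E3) :
    HasMeanValue fun x => P (x + h) - P x := by
  have e : ∀ (x : E3) (R : ℝ) (z : E3), cap z * (P (x + R • z + h) - P (x + R • z)) =
      cap z * P (x + h + R • z) - cap z * P (x + R • z) := by
    intro x R z
    rw [mul_sub, add_right_comm]
  refine ⟨fun x R => ?_, fun x R hR => ?_⟩
  · simp only [e]
    exact (hP.integrable (x + h) R).sub (hP.integrable x R)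
  · simp only [e]
    rw [integral_sub (hP.integrable (x + h) R) (hP.integrable x R), hP.integral_eq _ _ hR,
      hP.integral_eq _ _ hR, mul_sub]

theorem const_sub {P : E3 → ℝ} (hP : HasMeanValue P) (K : ℝ) :
    HasMeanValue fun x => K - P x := by
  refine ⟨fun x R => ?_, fun x R hR => ?_⟩
  · simp only [mul_sub]
    exact (integrable_cap.mul_const K).sub (hP.integrable x R)
  · simp only [mul_sub]
    rw [integral_sub (integrable_cap.mul_const K) (hP.integrable x R), hP.integral_eq _ _ hR,
      integral_mul_const]

/-- A Harnack inequality at the origin. -/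
theorem le_of_nonneg {Q : E3 → ℝ} (hQ : HasMeanValue Q) {R : ℝ} (hR : 0 < R)
    (h0 : ∀ y, ‖y‖ ≤ 3 * R → 0 ≤ Q y) {x : E3} (hx : ‖x‖ ≤ R) : Q x ≤ 54 * Q 0 := by
  have h1 := hQ.integral_eq x R hR.le
  have h2 := hQ.integral_eq 0 (3 * R) (by positivity)
  have i2 := hQ.integrable 0 (3 * R)
  simp only [zero_add] at h2 i2
  set G : E3 → ℝ := fun w => cap w * Q ((3 * R) • w) with hG
  have hpt : ∀ z : E3, (3 * R) • ((3:ℝ)⁻¹ • (R⁻¹ • x + z)) = x + R • z := by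
    intro z
    rw [smul_smul, smul_add, smul_smul]
    congr 2
    · rw [show 3 * R * 3⁻¹ * R⁻¹ = 1 by field_simp, one_smul]
    · ring
  have hint : ∫ z, G ((3:ℝ)⁻¹ • (R⁻¹ • x + z)) = 27 * ∫ w, G w := by
    rw [integral_add_left_eq_self (fun z => G ((3:ℝ)⁻¹ • z)) (R⁻¹ • x),
      Measure.integral_comp_smul]
    simp; norm_num
  have iG : Integrable fun z => G ((3:ℝ)⁻¹ • (R⁻¹ • x + z)) := by
    have : Integrable fun z => G ((3:ℝ)⁻¹ • z) := i2.comp_smul (by norm_num)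
    exact this.comp_add_left (R⁻¹ • x)
  have hle : ∫ z, cap z * Q (x + R • z) ≤ ∫ z, 2 * G ((3:ℝ)⁻¹ • (R⁻¹ • x + z)) := by
    refine integral_mono (hQ.integrable x R) (iG.const_mul 2) fun z => ?_
    simp only [hG, hpt]
    have hc := cap_nonneg ((3:ℝ)⁻¹ • (R⁻¹ • x + z))
    by_cases hw : (3:ℝ)⁻¹ • (R⁻¹ • x + z) ∈ Metric.closedBall (0:E3) 1
    · have hq : 0 ≤ Q (x + R • z) := by
        refine h0 _ ?_
        rw [← hpt, norm_smul, Real.norm_of_nonneg (by positivity)]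
        have : ‖(3:ℝ)⁻¹ • (R⁻¹ • x + z)‖ ≤ 1 := by simpa using hw
        nlinarith
      have hcc : cap z ≤ 2 * cap ((3:ℝ)⁻¹ • (R⁻¹ • x + z)) := by
        by_cases hz : z ∈ Metric.closedBall (0:E3) 1
        · have hz1 : ‖z‖ ≤ 1 := by simpa using hz
          have hn : ‖(3:ℝ)⁻¹ • (R⁻¹ • x + z)‖ ≤ 2 / 3 := by
            rw [norm_smul, Real.norm_of_nonneg (by norm_num)]
            have h5 : ‖R⁻¹ • x‖ ≤ 1 := by
              rw [norm_smul, Real.norm_of_nonneg (by positivity), inv_mul_le_iff₀ hR]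
              linarith
            have := norm_add_le (R⁻¹ • x) z
            linarith
          have h6 : 1 - ‖(3:ℝ)⁻¹ • (R⁻¹ • x + z)‖ ^ 2 ≤ cap ((3:ℝ)⁻¹ • (R⁻¹ • x + z)) :=
            le_max_right _ _
          have := cap_le_one z
          nlinarith [norm_nonneg ((3:ℝ)⁻¹ • (R⁻¹ • x + z))]
        · rw [cap_eq_zero hz]; linarith
      nlinarith
    · have hz : z ∉ Metric.closedBall (0:E3) 1 := by
        intro hz
        apply hw
        have hz1 : ‖z‖ ≤ 1 := by simpa using hz
        have h5 : ‖R⁻¹ • x‖ ≤ 1 := by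
          rw [norm_smul, Real.norm_of_nonneg (by positivity), inv_mul_le_iff₀ hR]
          linarith
        rw [mem_closedBall_zero_iff, norm_smul, Real.norm_of_nonneg (by norm_num)]
        have := norm_add_le (R⁻¹ • x) z
        linarith
      rw [cap_eq_zero hz, cap_eq_zero hw]
      simp
  rw [integral_const_mul, hint, h2, h1] at hle
  have hm := integral_cap_pos
  refine le_of_mul_le_mul_left ?_ hm
  linarith

theorem exists_abs_le {P : E3 → ℝ} (hP : HasMeanValue P) {C : ℝ} (hC : 0 ≤ C)
    (h : ∀ x, P x ≤ C * (1 + ‖x‖ ^ 2)) :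
    ∃ A : ℝ, 0 ≤ A ∧ ∀ x, |P x| ≤ A * (1 + ‖x‖) ^ 2 := by
  refine ⟨540 * C + 54 * |P 0|, by positivity, fun x => ?_⟩
  have hx := norm_nonneg x
  have hR : 1 ≤ (1 + ‖x‖) ^ 2 := by nlinarith
  have hH := (hP.const_sub (C * (1 + (3 * (1 + ‖x‖)) ^ 2))).le_of_nonneg (R := 1 + ‖x‖)
    (by positivity) (fun y hy => ?_) (x := x) (by linarith)
  · have h1 := h x
    have h2 := neg_abs_le (P 0)
    have h3 := abs_nonneg (P 0)
    have h4 : P x ≤ C * (1 + ‖x‖) ^ 2 := by nlinarith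
    have h5 : 0 ≤ C * (1 + ‖x‖) ^ 2 := by positivity
    have h6 : C ≤ C * (1 + ‖x‖) ^ 2 := le_mul_of_one_le_right hC hR
    have h7 : |P 0| ≤ |P 0| * (1 + ‖x‖) ^ 2 := le_mul_of_one_le_right h3 hR
    rw [abs_le]
    constructor
    · nlinarith
    · nlinarith
  · have h1 := h y
    have : ‖y‖ ^ 2 ≤ (3 * (1 + ‖x‖)) ^ 2 := by gcongr
    nlinarith

theorem abs_sub_le {F : E3 → ℝ} (hF : HasMeanValue F) {x h : E3} {R M : ℝ} (hR : 0 < R)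
    (hh : ‖h‖ ≤ R) (hM : ∀ y, ‖y - x‖ ≤ 2 * R → |F y| ≤ M) :
    (∫ z, cap z) * |F (x + h) - F x| ≤
      6 * (‖h‖ / R) * M * volume.real (Metric.closedBall (0:E3) 2) := by
  have e1 : ∀ z : E3, cap (-(R⁻¹ • h) + z) * F (x + R • z) =
      (fun z => cap z * F ((x + h) + R • z)) (-(R⁻¹ • h) + z) := by
    intro z
    simp only
    congr 2
    rw [smul_add, smul_neg, smul_smul, mul_inv_cancel₀ hR.ne', one_smul]
    abel
  have i1 : Integrable fun z => cap (-(R⁻¹ • h) + z) * F (x + R • z) := by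
    simp only [e1]
    exact (hF.integrable (x + h) R).comp_add_left _
  have h1 : ∫ z, cap (-(R⁻¹ • h) + z) * F (x + R • z) = (∫ z, cap z) * F (x + h) := by
    simp only [e1]
    rw [integral_add_left_eq_self (fun z => cap z * F ((x + h) + R • z)), hF.integral_eq _ _ hR.le]
  have hhR : ‖R⁻¹ • h‖ = ‖h‖ / R := by
    rw [norm_smul, Real.norm_of_nonneg (by positivity), inv_mul_eq_div]
  have hh1 : ‖h‖ / R ≤ 1 := by rw [div_le_one hR]; exact hh
  have hM0 : 0 ≤ M := (abs_nonneg _).trans (hM x (by simp; positivity))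
  have h2 : (∫ z, cap z) * (F (x + h) - F x) =
      ∫ z, (cap (-(R⁻¹ • h) + z) * F (x + R • z) - cap z * F (x + R • z)) := by
    rw [integral_sub i1 (hF.integrable x R), h1, hF.integral_eq _ _ hR.le, mul_sub]
  have h3 : ‖∫ z, (cap (-(R⁻¹ • h) + z) * F (x + R • z) - cap z * F (x + R • z))‖ ≤
      ∫ z, (Metric.closedBall (0:E3) 2).indicator (fun _ => 6 * (‖h‖ / R) * M) z := by
    refine norm_integral_le_of_norm_le ?_ (Eventually.of_forall fun z => ?_)
    · rw [integrable_indicator_iff measurableSet_closedBall]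
      exact integrableOn_const (measure_closedBall_lt_top.ne)
    · rw [← sub_mul, norm_mul, Real.norm_eq_abs, Real.norm_eq_abs]
      have hd : ‖-(R⁻¹ • h) + z - z‖ = ‖h‖ / R := by rw [add_sub_cancel_right, norm_neg, hhR]
      by_cases hz : z ∈ Metric.closedBall (0:E3) 2
      · rw [Set.indicator_of_mem hz]
        have hz1 : ‖z‖ ≤ 2 := by simpa using hz
        have hw : ‖-(R⁻¹ • h) + z‖ ≤ 3 := by
          refine (norm_add_le _ _).trans ?_
          rw [norm_neg, hhR]; linarith
        have hc := abs_cap_sub_le hw (hz1.trans (by norm_num))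
        rw [hd] at hc
        refine mul_le_mul hc (hM _ ?_) (abs_nonneg _) (by positivity)
        rw [add_sub_cancel_left, norm_smul, Real.norm_of_nonneg hR.le]
        nlinarith
      · rw [Set.indicator_of_notMem hz]
        have hz1 : 2 < ‖z‖ := by simpa using hz
        have hw : 1 < ‖-(R⁻¹ • h) + z‖ := by
          have := norm_sub_norm_le z (R⁻¹ • h)
          rw [hhR] at this
          rw [neg_add_eq_sub]; linarith
        rw [cap_eq_zero (by simpa using hw), cap_eq_zero (by simp; linarith)]
        simp
  rw [integral_indicator measurableSet_closedBall, setIntegral_const, ← h2, Real.norm_eq_abs,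
    abs_mul, abs_of_pos integral_cap_pos] at h3
  rwa [mul_comm _ (volume.real _)]

theorem exists_abs_sub_le {F : E3 → ℝ} (hF : HasMeanValue F) {A : ℝ} {k : ℕ}
    (h : ∀ x, |F x| ≤ A * (1 + ‖x‖) ^ (k + 1)) (y : E3) :
    ∃ A' : ℝ, ∀ x, |F (x + y) - F x| ≤ A' * (1 + ‖x‖) ^ k := by
  have hm := integral_cap_pos
  set m := ∫ z, cap z
  set V := volume.real (Metric.closedBall (0:E3) 2)
  have hA : 0 ≤ A := by
    have := (abs_nonneg _).trans (h 0)
    simpa using this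
  have hV : 0 ≤ V := measureReal_nonneg
  refine ⟨6 * ‖y‖ * A * 3 ^ (k + 1) * V / m * (1 + ‖y‖) ^ k, fun x => ?_⟩
  set R := 1 + ‖x‖ + ‖y‖ with hRdef
  have hx := norm_nonneg x
  have hy := norm_nonneg y
  have hR : 0 < R := by positivity
  have h1 := hF.abs_sub_le (x := x) (h := y) (R := R) (M := A * (3 * R) ^ (k + 1)) hR
    (by linarith) (fun z hz => (h z).trans ?_)
  · have h2 : 6 * (‖y‖ / R) * (A * (3 * R) ^ (k + 1)) * V =
        6 * ‖y‖ * A * 3 ^ (k + 1) * V * R ^ k := by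
      rw [mul_pow, pow_succ R]; field_simp
    have h3 : R ^ k ≤ ((1 + ‖y‖) * (1 + ‖x‖)) ^ k := by
      gcongr
      nlinarith [mul_nonneg hx hy]
    rw [h2] at h1
    have h4 : m * |F (x + y) - F x| ≤
        6 * ‖y‖ * A * 3 ^ (k + 1) * V * ((1 + ‖y‖) * (1 + ‖x‖)) ^ k := by
      refine h1.trans ?_
      gcongr
    rw [mul_comm, ← le_div_iff₀ hm] at h4
    refine h4.trans_eq ?_
    rw [mul_pow]; field_simp
  · gcongr
    have := norm_sub_norm_le z x
    linarith

theorem add_eq_of_bounded {F : E3 → ℝ} (hF : HasMeanValue F) {M : ℝ} (h : ∀ x, |F x| ≤ M)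
    (x y : E3) : F (x + y) = F x := by
  have hm := integral_cap_pos
  set m := ∫ z, cap z
  set V := volume.real (Metric.closedBall (0:E3) 2)
  by_contra hne
  have hd : 0 < m * |F (x + y) - F x| := mul_pos hm (abs_pos.2 (sub_ne_zero.2 hne))
  set d := m * |F (x + y) - F x|
  have hM : 0 ≤ M := (abs_nonneg _).trans (h 0)
  have hV : 0 ≤ V := measureReal_nonneg
  set R := ‖y‖ + 1 + 6 * ‖y‖ * M * V / d with hR
  have hy := norm_nonneg y
  have h5 : 0 ≤ 6 * ‖y‖ * M * V / d := by positivity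
  have hR0 : 0 < R := by positivity
  have h1 : d ≤ 6 * (‖y‖ / R) * M * V :=
    hF.abs_sub_le (x := x) (h := y) (R := R) hR0 (by linarith) (fun z _ => h z)
  have h2 : 6 * (‖y‖ / R) * M * V = (6 * ‖y‖ * M * V) / R := by ring
  rw [h2, le_div_iff₀ hR0] at h1
  have h3 : 6 * ‖y‖ * M * V / d < R := by linarith
  rw [div_lt_iff₀ hd] at h3
  linarith

theorem continuous {F : E3 → ℝ} (hF : HasMeanValue F) {A : ℝ} {k : ℕ}
    (h : ∀ x, |F x| ≤ A * (1 + ‖x‖) ^ k) : Continuous F := by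
  have hm := integral_cap_pos
  refine continuous_iff_continuousAt.2 fun x => ?_
  have hA : 0 ≤ A := by
    have := (abs_nonneg _).trans (h 0)
    simpa using this
  have h1 : ∀ y : E3, ‖y‖ ≤ 1 → |F (x + y) - F x| ≤ 6 * (A * (3 + ‖x‖) ^ k) *
      volume.real (Metric.closedBall (0:E3) 2) / (∫ z, cap z) * ‖y‖ := by
    intro y hy
    have h2 := hF.abs_sub_le (x := x) (h := y) (R := 1) (M := A * (3 + ‖x‖) ^ k) one_pos hy
      (fun z hz => (h z).trans ?_)
    · rw [mul_comm, ← le_div_iff₀ hm] at h2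
      refine h2.trans_eq ?_
      ring
    · gcongr ?_ * ?_ ^ k
      have := norm_sub_norm_le z x
      linarith
  generalize 6 * (A * (3 + ‖x‖) ^ k) *
      volume.real (Metric.closedBall (0:E3) 2) / (∫ z, cap z) = K at h1
  rw [ContinuousAt, tendsto_iff_norm_sub_tendsto_zero]
  have h2 : Tendsto (fun z => K * ‖z - x‖) (nhds x) (nhds 0) := by
    have : Continuous fun z => K * ‖z - x‖ := by fun_prop
    simpa using this.tendsto x
  refine squeeze_zero' (Eventually.of_forall fun z => norm_nonneg _) ?_ h2
  filter_upwards [Metric.closedBall_mem_nhds x one_pos] with z hz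
  have := h1 (z - x) (by simpa [dist_eq_norm] using hz)
  simpa using this

theorem third_difference {P : E3 → ℝ} (hP : HasMeanValue P) {A : ℝ}
    (h : ∀ x, |P x| ≤ A * (1 + ‖x‖) ^ 2) (a b x : E3) :
    P (x + a + b) - P (x + a) - P (x + b) + P x = P (a + b) - P a - P b + P 0 := by
  obtain ⟨A1, h1⟩ := hP.exists_abs_sub_le (k := 1) h b
  have hP1 := hP.sub_shift b
  obtain ⟨A2, h2⟩ := hP1.exists_abs_sub_le (k := 0) h1 a
  have h3 := (hP1.sub_shift a).add_eq_of_bounded (by simpa using h2) 0 x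
  simp only [zero_add] at h3
  linarith

end HasMeanValue

theorem exists_inner_eq_of_additive {f : E3 → ℝ} (hc : Continuous f)
    (hf : ∀ x y, f (x + y) = f x + f y) : ∃ b : E3, ∀ x, f x = inner ℝ b x := by
  let L : E3 →L[ℝ] ℝ := (AddMonoidHom.mk' f hf).toRealLinearMap hc
  refine ⟨(InnerProductSpace.toDual ℝ E3).symm L, fun x => ?_⟩
  rw [InnerProductSpace.toDual_symm_apply]
  rfl

theorem exists_quadratic {P : E3 → ℝ} (hc : Continuous P)
    (h : ∀ a b x, P (x + a + b) - P (x + a) - P (x + b) + P x = P (a + b) - P a - P b + P 0) :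
    ∃ (b : E3) (T : E3 →ₗ[ℝ] E3), T.IsSymmetric ∧
      ∀ x, P x = P 0 + inner ℝ b x + inner ℝ (T x) x := by
  let B : E3 → E3 → ℝ := fun a b => P (a + b) - P a - P b + P 0
  have hBs : ∀ a b, B a b = B b a := by
    intro a b
    simp only [B]; rw [add_comm a b]; ring
  have hBa : ∀ a x y, B a (x + y) = B a x + B a y := by
    intro a x y
    have := h a y x
    simp only [B]
    rw [← add_assoc, add_comm a x]
    linarith
  have hBc : ∀ a, Continuous (B a) := by
    intro a
    simp only [B]; fun_prop
  choose g hg using fun a => exists_inner_eq_of_additive (hBc a) (hBa a)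
  have hg1 : ∀ a x, inner ℝ (g a) x = inner ℝ (g x) a := by
    intro a x
    rw [← hg, ← hg, hBs]
  let T : E3 →ₗ[ℝ] E3 :=
    { toFun := fun a => (1 / 2 : ℝ) • g a
      map_add' := fun x y => by
        rw [← smul_add]
        congr 1
        refine ext_inner_right ℝ fun z => ?_
        rw [inner_add_left, hg1, hg1 x, hg1 y, inner_add_right]
      map_smul' := fun c x => by
        rw [RingHom.id_apply, smul_comm]
        congr 1
        refine ext_inner_right ℝ fun z => ?_
        rw [real_inner_smul_left, hg1, hg1 x, real_inner_smul_right] }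
  have hT : ∀ a x, inner ℝ (T a) x = 1 / 2 * B a x := by
    intro a x
    rw [hg]
    exact real_inner_smul_left _ _ _
  obtain ⟨b, hb⟩ := exists_inner_eq_of_additive (f := fun x => P x - P 0 - 1 / 2 * B x x)
    (by simp only [B]; fun_prop) (fun x y => by
      have e : B (x + y) (x + y) = B x x + 2 * B x y + B y y := by
        rw [hBa, hBs _ x, hBs _ y, hBa, hBa, hBs y x]; ring
      rw [e]
      simp only [B]; ring)
  refine ⟨b, T, fun x y => ?_, fun x => ?_⟩
  · rw [hT, real_inner_comm, hT, hBs]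
  · rw [← hb, hT]; ring

/-! ### Quadratic polynomials bounded by a logarithm -/

theorem nonpos_of_forall_mul_le {d K : ℝ} (h : ∀ s : ℝ, 2 ≤ s → s * d ≤ K) : d ≤ 0 := by
  by_contra! hd
  have h1 := h (2 + |K| / d) (by have : 0 ≤ |K| / d := by positivity
                                 linarith)
  have h2 : (2 + |K| / d) * d = 2 * d + |K| := by field_simp
  have := le_abs_self K
  linarith

theorem le_zero_of_le_log {a b q C : ℝ} (hC : 0 ≤ C)
    (h : ∀ t : ℝ, a + t * b + t ^ 2 * q ≤ C * (1 + log (1 + t ^ 2))) :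
    q ≤ 0 ∧ (q = 0 → b = 0) := by
  have hlog : ∀ s : ℝ, 2 ≤ s → C * (1 + log (1 + (s ^ 2 - 1) ^ 2)) - a ≤ (5 * C + |a|) * s := by
    intro s hs
    have h1 : log (1 + (s ^ 2 - 1) ^ 2) ≤ log (s ^ 4) :=
      log_le_log (by positivity) (by nlinarith)
    have h2 := log_le_sub_one_of_pos (show 0 < s by linarith)
    rw [log_pow] at h1
    push_cast at h1
    have h3 : C * (1 + log (1 + (s ^ 2 - 1) ^ 2)) ≤ C * (5 * s) :=
      mul_le_mul_of_nonneg_left (by linarith) hC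
    have h4 := neg_abs_le a
    have h5 := abs_nonneg a
    nlinarith
  refine ⟨nonpos_of_forall_mul_le (K := 5 * C + |a|) fun s hs => ?_, fun hq => ?_⟩
  · by_cases hq : q ≤ 0
    · have : 0 ≤ 5 * C + |a| := by positivity
      nlinarith
    · push Not at hq
      have h1 := h (s ^ 2 - 1)
      have h2 := h (-(s ^ 2 - 1))
      rw [neg_sq] at h2
      have h3 := hlog s hs
      have h4 : s ^ 2 * q ≤ (s ^ 2 - 1) ^ 2 * q :=
        mul_le_mul_of_nonneg_right (by gcongr; nlinarith) hq.le
      have h5 : s * (s * q) ≤ s * (5 * C + |a|) := by nlinarith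
      exact le_of_mul_le_mul_left h5 (by linarith)
  · subst hq
    have key : ∀ ε : ℝ, ε = b ∨ ε = -b → ε ≤ 0 := by
      intro ε hε
      refine nonpos_of_forall_mul_le (K := 2 * (5 * C + |a|)) fun s hs => ?_
      have h0 : 0 ≤ 5 * C + |a| := by positivity
      by_cases hε0 : ε ≤ 0
      · nlinarith
      · push Not at hε0
        have h1 : (s ^ 2 - 1) * ε ≤ (5 * C + |a|) * s := by
          refine le_trans ?_ (hlog s hs)
          rcases hε with rfl | rfl
          · have := h (s ^ 2 - 1); linarith
          · have := h (-(s ^ 2 - 1)); rw [neg_sq] at this; linarith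
        have h4 : s ^ 2 * ε ≤ 2 * (s ^ 2 - 1) * ε :=
          mul_le_mul_of_nonneg_right (by nlinarith) hε0.le
        have h5 : s * (s * ε) ≤ s * (2 * (5 * C + |a|)) := by nlinarith
        exact le_of_mul_le_mul_left h5 (by linarith)
    have h1 := key b (Or.inl rfl)
    have h2 := key (-b) (Or.inr rfl)
    linarith

section Quadratic

open scoped InnerProductSpace

theorem bddAbove_quadratic {a : ℝ} {b : E3} {S : E3 →ₗ[ℝ] E3} (hS : S.IsSymmetric)
    (h : ∀ e : E3, ‖e‖ = 1 → ⟪S e, e⟫_ℝ ≤ 0 ∧ (⟪S e, e⟫_ℝ = 0 → ⟪b, e⟫_ℝ = 0)) :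
    BddAbove (Set.range fun x : E3 => a + ⟪b, x⟫_ℝ + ⟪S x, x⟫_ℝ) := by
  have hn : Module.finrank ℝ E3 = 3 := by simp
  let e := hS.eigenvectorBasis hn
  let l := hS.eigenvalues hn
  have he : ∀ i, ⟪S (e i), e i⟫_ℝ = l i := by
    intro i
    rw [hS.apply_eigenvectorBasis, real_inner_smul_left, real_inner_self_eq_norm_sq,
      e.orthonormal.1 i]
    simp [l]
  have hb : ∀ x, ⟪b, x⟫_ℝ = ∑ i, ⟪b, e i⟫_ℝ * ⟪e i, x⟫_ℝ := fun x =>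
    (e.sum_inner_mul_inner b x).symm
  have hq : ∀ x, ⟪S x, x⟫_ℝ = ∑ i, l i * ⟪e i, x⟫_ℝ ^ 2 := by
    intro x
    rw [← e.sum_inner_mul_inner]
    refine Finset.sum_congr rfl fun i _ => ?_
    rw [hS, hS.apply_eigenvectorBasis, real_inner_smul_right, real_inner_comm]
    simp only [l, RCLike.ofReal_real_eq_id, id]
    ring
  refine ⟨a + ∑ i, -(⟪b, e i⟫_ℝ ^ 2 / (4 * l i)), ?_⟩
  rintro _ ⟨x, rfl⟩
  simp only
  rw [hb, hq, add_assoc, ← Finset.sum_add_distrib]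
  refine add_le_add le_rfl (Finset.sum_le_sum fun i _ => ?_)
  obtain ⟨h1, h2⟩ := h (e i) (e.orthonormal.1 i)
  rw [he] at h1 h2
  rcases h1.lt_or_eq with h3 | h3
  · have : ⟪b, e i⟫_ℝ * ⟪e i, x⟫_ℝ + l i * ⟪e i, x⟫_ℝ ^ 2 + ⟪b, e i⟫_ℝ ^ 2 / (4 * l i) =
        l i * (⟪e i, x⟫_ℝ + ⟪b, e i⟫_ℝ / (2 * l i)) ^ 2 := by
      have h4 : l i ≠ 0 := h3.ne
      generalize l i = t at h4
      field_simp; ring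
    nlinarith [mul_nonneg (neg_nonneg.2 h3.le) (sq_nonneg (⟪e i, x⟫_ℝ + ⟪b, e i⟫_ℝ / (2 * l i)))]
  · rw [h2 h3, h3]; simp

theorem lap_quadratic (a : ℝ) (b : E3) {S : E3 →ₗ[ℝ] E3} (hS : S.IsSymmetric) (x : E3) :
    lap (fun x => a + ⟪b, x⟫_ℝ + ⟪S x, x⟫_ℝ) x =
      ∑ i, 2 * ⟪S (EuclideanSpace.single i 1), EuclideanSpace.single i 1⟫_ℝ := by
  let T : E3 →L[ℝ] E3 := LinearMap.toContinuousLinearMap S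
  have hT : ∀ x, T x = S x := fun _ => rfl
  have h1 : ∀ x v, fderiv ℝ (fun x => a + ⟪b, x⟫_ℝ + ⟪S x, x⟫_ℝ) x v =
      ⟪b, v⟫_ℝ + 2 * ⟪S v, x⟫_ℝ := by
    intro x v
    have h2 : HasFDerivAt (fun x => ⟪T x, x⟫_ℝ) _ x := T.hasFDerivAt.inner ℝ (hasFDerivAt_id x)
    have h3 : HasFDerivAt (fun x => a + ⟪b, x⟫_ℝ + ⟪T x, x⟫_ℝ) _ x :=
      ((innerSL ℝ b).hasFDerivAt.const_add a).add h2
    have h4 : ⟪S x, v⟫_ℝ = ⟪S v, x⟫_ℝ := by rw [hS, real_inner_comm]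
    simp only [hT] at h3
    rw [h3.fderiv]
    simp [hT, h4]
    ring
  simp only [lap, h1]
  refine Finset.sum_congr rfl fun i _ => ?_
  have h5 : ∀ v : E3, HasFDerivAt (fun y => ⟪b, v⟫_ℝ + 2 * ⟪S v, y⟫_ℝ)
      ((2:ℝ) • innerSL ℝ (S v)) x := fun v =>
    ((innerSL ℝ (S v)).hasFDerivAt.const_mul 2).const_add _
  rw [(h5 _).fderiv]
  simp

theorem exists_mvPolynomial_quadratic {a : ℝ} {b : E3} {S : E3 →ₗ[ℝ] E3} (hS : S.IsSymmetric)
    (h : S = 0 → b = 0) :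
    ∃ P : MvPolynomial (Fin 3) ℝ, (P.totalDegree = 0 ∨ P.totalDegree = 2) ∧
      ∀ x : E3, a + ⟪b, x⟫_ℝ + ⟪S x, x⟫_ℝ = MvPolynomial.eval (fun i => x i) P := by
  by_cases hS0 : S = 0
  · refine ⟨MvPolynomial.C a, Or.inl (MvPolynomial.totalDegree_C a), fun x => ?_⟩
    rw [h hS0, hS0]
    simp
  let L : MvPolynomial (Fin 3) ℝ := ∑ i, MvPolynomial.C (b i) * MvPolynomial.X i
  let Q : MvPolynomial (Fin 3) ℝ := ∑ i, ∑ j, MvPolynomial.C (S (EuclideanSpace.single i 1) j) *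
    (MvPolynomial.X i * MvPolynomial.X j)
  have hL : L.IsHomogeneous 1 := by
    refine MvPolynomial.IsHomogeneous.sum _ _ _ fun i _ => ?_
    exact (MvPolynomial.isHomogeneous_X _ i).C_mul _
  have hQ : Q.IsHomogeneous 2 := by
    refine MvPolynomial.IsHomogeneous.sum _ _ _ fun i _ => ?_
    refine MvPolynomial.IsHomogeneous.sum _ _ _ fun j _ => ?_
    exact ((MvPolynomial.isHomogeneous_X _ i).mul (MvPolynomial.isHomogeneous_X _ j)).C_mul _
  have eL : ∀ x : E3, MvPolynomial.eval (fun i => x i) L = ⟪b, x⟫_ℝ := by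
    intro x
    simp [L, PiLp.inner_apply, mul_comm]
  have eQ : ∀ x : E3, MvPolynomial.eval (fun i => x i) Q = ⟪S x, x⟫_ℝ := by
    intro x
    have hx : x = ∑ i, x i • EuclideanSpace.single i (1:ℝ) := by
      ext j; simp [Finset.sum_apply, Pi.single_apply]
    have : ⟪S x, x⟫_ℝ = ∑ i, x i * ⟪S (EuclideanSpace.single i 1), x⟫_ℝ := by
      conv_lhs => rw [hx, map_sum, sum_inner, ← hx]
      simp [real_inner_smul_left]
    rw [this]
    simp only [Q, map_sum, map_mul, MvPolynomial.eval_C, MvPolynomial.eval_X, PiLp.inner_apply,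
      Finset.mul_sum]
    refine Finset.sum_congr rfl fun i _ => Finset.sum_congr rfl fun j _ => ?_
    simp; ring
  have hQ0 : Q ≠ 0 := by
    intro hQ0
    apply hS0
    rw [← hS.inner_map_self_eq_zero]
    intro x
    rw [← eQ, hQ0, map_zero]
  refine ⟨MvPolynomial.C a + L + Q, Or.inr ?_, fun x => ?_⟩
  · rw [MvPolynomial.totalDegree_add_eq_right_of_totalDegree_lt, hQ.totalDegree hQ0]
    rw [hQ.totalDegree hQ0]
    refine (MvPolynomial.totalDegree_add _ _).trans_lt (max_lt ?_ ?_)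
    · simp
    · exact hL.totalDegree_le.trans_lt (by norm_num)
  · rw [map_add, map_add, MvPolynomial.eval_C, eL, eQ]

end Quadratic

theorem IsSolution.exists_sub_solV_eq {u : E3 → ℝ} (hu : IsSolution u) :
    ∃ (a : ℝ) (b : E3) (S : E3 →ₗ[ℝ] E3), S.IsSymmetric ∧
      ∀ x, u x - solV u x = a + inner ℝ b x + inner ℝ (S x) x := by
  obtain ⟨c, hi, hmean⟩ := hu.exists_meanValue
  obtain ⟨C, hC, hle⟩ := hu.exists_le_log
  have huc := hu.1.continuous
  have hP : HasMeanValue fun x => u x - solV u x + c * ‖x‖ ^ 2 := by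
    refine ⟨fun x R => ?_, hmean⟩
    have h1 : Integrable fun z => cap z * (u (x + R • z) + c * ‖x + R • z‖ ^ 2) :=
      integrable_cap_mul (by fun_prop)
    refine (h1.sub (hi x R)).congr (Eventually.of_forall fun z => ?_)
    simp only [Pi.sub_apply]; ring
  have hPle : ∀ x, u x - solV u x + c * ‖x‖ ^ 2 ≤ (C + |c|) * (1 + ‖x‖ ^ 2) := by
    intro x
    have h1 := hle x
    have h2 : log (1 + ‖x‖ ^ 2) ≤ ‖x‖ ^ 2 := by
      have := log_le_sub_one_of_pos (show 0 < 1 + ‖x‖ ^ 2 by positivity)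
      linarith
    have h3 := mul_le_mul_of_nonneg_left h2 hC
    have h4 := mul_le_mul_of_nonneg_right (le_abs_self c) (sq_nonneg ‖x‖)
    have := abs_nonneg c
    linarith
  obtain ⟨A, -, hA⟩ := hP.exists_abs_le (by positivity) hPle
  obtain ⟨b, T, hT, hPT⟩ := exists_quadratic (hP.continuous hA) (hP.third_difference hA)
  refine ⟨u 0 - solV u 0 + c * ‖(0 : E3)‖ ^ 2, b, T - c • LinearMap.id, ?_, fun x => ?_⟩
  · intro x y
    simp only [LinearMap.sub_apply, LinearMap.smul_apply, LinearMap.id_apply, inner_sub_left,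
      inner_sub_right, real_inner_smul_left, real_inner_smul_right]
    rw [hT]
  · have h1 := hPT x
    simp only [LinearMap.sub_apply, LinearMap.smul_apply, LinearMap.id_apply, inner_sub_left,
      real_inner_smul_left, real_inner_self_eq_norm_sq]
    linarith
/-- Theorem 10: for a smooth finite-volume solution `u` of `(−Δ)^{3/2}u = 2e^{3u}`, the
function `p := u − v` is a polynomial of degree 0 or 2 (never 1), `Δp` is a nonpositive
constant, and `sup_{ℝ³} p < ∞`. -/
theorem p_is_polynomial (u : E3 → ℝ) (hu : IsSolution u) :
    (∃ P : MvPolynomial (Fin 3) ℝ,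
        (P.totalDegree = 0 ∨ P.totalDegree = 2) ∧
        ∀ x : E3, u x - solV u x = MvPolynomial.eval (fun i => x i) P) ∧
    (∃ c : ℝ, c ≤ 0 ∧ ∀ x : E3, lap (fun y => u y - solV u y) x = c) ∧
    BddAbove (Set.range fun x : E3 => u x - solV u x) := by
  obtain ⟨a, b, S, hS, hp⟩ := hu.exists_sub_solV_eq
  obtain ⟨C, hC, hle⟩ := hu.exists_le_log
  have h : ∀ e : E3, ‖e‖ = 1 →
      inner ℝ (S e) e ≤ 0 ∧ (inner ℝ (S e) e = 0 → inner ℝ b e = 0) := by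
    intro e he
    refine le_zero_of_le_log (a := a) hC fun t => ?_
    have h1 := hle (t • e)
    rw [hp, norm_smul, he, mul_one, Real.norm_eq_abs, sq_abs, map_smul, real_inner_smul_left,
      real_inner_smul_right, real_inner_smul_right] at h1
    linarith
  have hpe : (fun x => u x - solV u x) = fun x => a + inner ℝ b x + inner ℝ (S x) x := funext hp
  refine ⟨?_, ⟨∑ i, 2 * inner ℝ (S (EuclideanSpace.single i 1)) (EuclideanSpace.single i 1), ?_, fun x => ?_⟩, ?_⟩
  · simp only [hp]
    refine exists_mvPolynomial_quadratic hS fun hS0 => ?_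
    ext i
    have := (h (EuclideanSpace.single i 1) (by simp)).2 (by simp [hS0])
    simpa [EuclideanSpace.inner_single_right] using this
  · refine Finset.sum_nonpos fun i _ => ?_
    have := (h (EuclideanSpace.single i 1) (by simp)).1
    linarith
  · rw [hpe]
    exact lap_quadratic a b hS x
  · rw [hpe]
    exact bddAbove_quadratic hS h
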